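/- For every ε > 0 there exists N such that every even integer k ≥ N can be written as a sum of four roughly equal primes: k = p_1 + p_2 + p_3 + p_4 where each p_i is prime and |p_i − k/4| ≤ ε·k for i = 1, 2, 3, 4. -/

import Mathlib

namespace FourPrimes

/-! ### Fejér kernels -/

section

open Complex MeasureTheory Filter Topology Set

/-- The Fejér kernel of bandwidth `l`. -/
noncomputable def fejer (l v : ℝ) : ℝ := l * Real.sinc (l * v / 2) ^ 2

lemma fejer_nonneg {l : ℝ} (hl : 0 ≤ l) (v : ℝ) : 0 ≤ fejer l v := by
  unfold fejer; positivity

lemma fejer_le {l : ℝ} (hl : 0 ≤ l) (v : ℝ) : fejer l v ≤ l := by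
  unfold fejer
  have : Real.sinc (l * v / 2) ^ 2 ≤ 1 := by
    rw [sq_le_one_iff_abs_le_one]; exact Real.abs_sinc_le_one _
  nlinarith

lemma continuous_fejer (l : ℝ) : Continuous (fejer l) := by
  unfold fejer
  have := Real.continuous_sinc
  fun_prop

lemma fejer_scale (l v : ℝ) : fejer l v = l * fejer 1 (l * v) := by
  simp [fejer]

lemma fejer_mul_sq {l : ℝ} (hl : 0 < l) (v : ℝ) :
    fejer l v * (l * v ^ 2) = 2 * (1 - Real.cos (l * v)) := by
  rcases eq_or_ne v 0 with rfl | hv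
  · simp
  · have h2 : Real.cos (l * v) = 1 - 2 * Real.sin (l * v / 2) ^ 2 := by
      have := Real.cos_two_mul (l * v / 2)
      have h3 := Real.sin_sq_add_cos_sq (l * v / 2)
      rw [show 2 * (l * v / 2) = l * v by ring] at this
      linarith
    rw [fejer, Real.sinc_of_ne_zero (by positivity), h2]
    field_simp
    ring

lemma fejer_le_div {l v : ℝ} (hl : 0 < l) (hv : v ≠ 0) : fejer l v ≤ 4 / (l * v ^ 2) := by
  rw [le_div_iff₀ (by positivity), fejer_mul_sq hl]
  linarith [Real.neg_one_le_cos (l * v)]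

lemma fejer_eq_integral {l : ℝ} (hl : 0 < l) (v : ℝ) :
    (fejer l v : ℂ) = ∫ t in (-l)..l, ((1 - |t| / l : ℝ) : ℂ) * cexp (t * v * I) := by
  have hcont : Continuous fun t : ℝ => ((1 - |t| / l : ℝ) : ℂ) * cexp (t * v * I) := by fun_prop
  have hcont2 : Continuous fun t : ℝ => (1 - |t| / l) * Real.cos (t * v) := by fun_prop
  have hcr : Continuous fun t : ℝ => (1 - t / l) * Real.cos (t * v) := by fun_prop
  have key : ∫ t in (0:ℝ)..l, (1 - t / l) * Real.cos (t * v) = fejer l v / 2 := by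
    rcases eq_or_ne v 0 with rfl | hv
    · simp only [mul_zero, Real.cos_zero, mul_one]
      rw [intervalIntegral.integral_sub (by simp) (by apply Continuous.intervalIntegrable; fun_prop)]
      simp [fejer]
      field_simp
      ring
    · have hd : ∀ t ∈ uIcc 0 l, HasDerivAt
          (fun t => (1 - t / l) * (Real.sin (t * v) / v) - Real.cos (t * v) / (l * v ^ 2))
          ((1 - t / l) * Real.cos (t * v)) t := by
        intro t _
        have h1 : HasDerivAt (fun t : ℝ => t * v) v t := by
          simpa using (hasDerivAt_id t).mul_const v
        have h2 : HasDerivAt (fun t : ℝ => 1 - t / l) (-(1 / l)) t := by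
          simpa using ((hasDerivAt_id t).div_const l).const_sub 1
        have h3 := (h2.mul (h1.sin.div_const v)).sub (h1.cos.div_const (l * v ^ 2))
        refine h3.congr_deriv ?_
        field_simp
        ring
      rw [intervalIntegral.integral_eq_sub_of_hasDerivAt hd (hcr.intervalIntegrable _ _)]
      have := fejer_mul_sq hl v
      rw [eq_div_iff two_ne_zero]
      field_simp
      simp
      have h5 : l * (v * Real.sin (0 * v)) = 0 := by simp
      nlinarith
  have hsym : ∫ t in (-l)..l, ((1 - |t| / l : ℝ) : ℂ) * cexp (t * v * I) =
      ∫ t in (0:ℝ)..l, (((1 - t / l) * Real.cos (t * v) * 2 : ℝ) : ℂ) := by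
    rw [← intervalIntegral.integral_add_adjacent_intervals (b := 0)
      (hcont.intervalIntegrable _ _) (hcont.intervalIntegrable _ _)]
    have hneg : ∫ t in (-l)..0, ((1 - |t| / l : ℝ) : ℂ) * cexp (t * v * I) =
        ∫ t in (0:ℝ)..l, ((1 - |t| / l : ℝ) : ℂ) * cexp (-t * v * I) := by
      have := intervalIntegral.integral_comp_neg (a := 0) (b := l)
        (fun t : ℝ => ((1 - |t| / l : ℝ) : ℂ) * cexp (t * v * I))
      rw [neg_zero] at this
      rw [← this]
      simp
    have hc' : Continuous fun t : ℝ => ((1 - |t| / l : ℝ) : ℂ) * cexp (-t * v * I) := by fun_prop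
    rw [hneg, ← intervalIntegral.integral_add (hc'.intervalIntegrable _ _)
      (hcont.intervalIntegrable _ _)]
    refine intervalIntegral.integral_congr fun t ht => ?_
    rw [uIcc_of_le hl.le] at ht
    simp only [abs_of_nonneg ht.1]
    push_cast
    have := Complex.two_cos (t * v)
    rw [mul_assoc _ (Complex.cos _), mul_comm (Complex.cos _) 2, this]
    ring_nf
  rw [hsym, intervalIntegral.integral_ofReal, intervalIntegral.integral_mul_const, key]
  push_cast
  ring

lemma integrable_fejer {l : ℝ} (hl : 0 < l) : Integrable (fejer l) := by
  have hb := integrable_inv_one_add_sq.const_mul (l + 4 / l)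
  refine hb.mono' (continuous_fejer l).aestronglyMeasurable (ae_of_all _ fun v => ?_)
  rw [Real.norm_of_nonneg (fejer_nonneg hl.le v), ← div_eq_mul_inv, le_div_iff₀ (by positivity)]
  have h1 := fejer_le hl.le v
  have h2 := fejer_mul_sq hl v
  have h3 := Real.neg_one_le_cos (l * v)
  have : fejer l v * v ^ 2 ≤ 4 / l := by
    rw [le_div_iff₀ hl]; nlinarith
  nlinarith

lemma integral_fejer_pos : 0 < ∫ v, fejer 1 v := by
  refine integral_pos_of_integrable_nonneg_nonzero (x := 0) (continuous_fejer 1)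
    (integrable_fejer one_pos) (fejer_nonneg zero_le_one) ?_
  simp [fejer]

lemma integral_fejer {l : ℝ} (hl : 0 < l) : ∫ v, fejer l v = ∫ v, fejer 1 v := by
  have := Measure.integral_comp_mul_left (fejer 1) l
  simp_rw [fejer_scale l, integral_const_mul, this, abs_of_pos (inv_pos.2 hl), smul_eq_mul]
  field_simp

/-- Two translates of the kernel dominate an inverse square. -/
lemma four_div_le_fejer_add (x : ℝ) :
    4 / (|x| + Real.pi) ^ 2 ≤ fejer 1 x + fejer 1 (x + Real.pi) := by
  have hpi := Real.pi_pos
  have h : ∀ y : ℝ, |y| ≤ |x| + Real.pi →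
      2 * (1 - Real.cos y) ≤ fejer 1 y * (|x| + Real.pi) ^ 2 := by
    intro y hy
    have h1 := fejer_mul_sq one_pos y
    rw [one_mul, one_mul] at h1
    rw [← h1]
    refine mul_le_mul_of_nonneg_left ?_ (fejer_nonneg zero_le_one _)
    rw [← sq_abs y]
    gcongr
  rw [div_le_iff₀ (by positivity)]
  have h1 := h x (by linarith)
  have h2 := h (x + Real.pi) ((abs_add_le _ _).trans (by rw [abs_of_pos hpi]))
  rw [Real.cos_add_pi] at h2
  linarith

end

/-! ### A Tauberian theorem for Dirichlet series with a simple pole -/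

section

open Complex MeasureTheory Filter Topology Set

/-- The oscillating weight whose integral against `exp (t v I)` is the shifted Fejér kernel. -/
noncomputable def fejerWeight (l u t : ℝ) : ℂ := ((1 - |t| / l : ℝ) : ℂ) * cexp (-(t * u * I))

lemma continuous_fejerWeight (l u : ℝ) : Continuous (fejerWeight l u) := by
  unfold fejerWeight; fun_prop

lemma norm_fejerWeight_le {l t : ℝ} (u : ℝ) (hl : 0 < l) (ht : t ∈ Icc (-l) l) :
    ‖fejerWeight l u t‖ ≤ 1 := by
  have h1 : |t| / l ≤ 1 := by rw [div_le_one hl]; exact abs_le.2 ht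
  have h2 : 0 ≤ |t| / l := by positivity
  rw [fejerWeight, norm_mul, show -((t:ℂ) * u * I) = ((-(t * u) : ℝ) : ℂ) * I by push_cast; ring,
    norm_exp_ofReal_mul_I, mul_one, norm_real, Real.norm_eq_abs, abs_le]
  constructor <;> linarith

lemma fejer_sub_eq_integral {l : ℝ} (hl : 0 < l) (v u : ℝ) :
    (fejer l (v - u) : ℂ) = ∫ t in (-l)..l, fejerWeight l u t * cexp (t * v * I) := by
  rw [fejer_eq_integral hl]
  refine intervalIntegral.integral_congr fun t _ => ?_
  simp only [fejerWeight]
  rw [mul_assoc _ (cexp _), ← Complex.exp_add]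
  congr 2
  push_cast
  ring

lemma integral_fejerWeight_div {l x : ℝ} (hl : 0 < l) (hx : 0 < x) (u : ℝ) :
    ∫ t in (-l)..l, fejerWeight l u t * (1 / (x - t * I)) =
      ((∫ s in Ioi (0:ℝ), Real.exp (-x * s) * fejer l (s - u) : ℝ) : ℂ) := by
  have h1 : ∀ t : ℝ, fejerWeight l u t * (1 / (x - t * I)) =
      ∫ s in Ioi (0:ℝ), fejerWeight l u t * cexp (t * s * I) * cexp (-x * s) := by
    intro t
    have hre : (-(x:ℂ) + t * I).re < 0 := by simpa using hx
    have := integral_exp_mul_complex_Ioi hre 0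
    simp_rw [mul_assoc, integral_const_mul, ← Complex.exp_add]
    congr 1
    have h2 : ∀ s : ℝ, (t:ℂ) * (s * I) + -x * s = (-(x:ℂ) + t * I) * s := by intro s; ring
    simp_rw [h2, this]
    rw [ofReal_zero, mul_zero, Complex.exp_zero, neg_div, ← div_neg]
    congr 1; ring
  simp_rw [h1]
  rw [intervalIntegral_integral_swap, ← integral_complex_ofReal]
  · refine integral_congr_ae (ae_of_all _ fun s => ?_)
    simp only
    rw [intervalIntegral.integral_mul_const, ← fejer_sub_eq_integral hl]
    push_cast
    ring_nf
  · have hw : Integrable (fejerWeight l u) (volume.restrict (uIoc (-l) l)) := by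
      have := (continuous_fejerWeight l u).intervalIntegrable (μ := volume) (-l) l
      exact intervalIntegrable_iff.1 this
    have he : Integrable (fun s : ℝ => cexp (-x * s)) (volume.restrict (Ioi 0)) :=
      integrableOn_exp_mul_complex_Ioi (a := -x) (by simpa using hx) 0
    refine (hw.mul_prod he).mono ?_ (ae_of_all _ fun z => ?_)
    · apply Continuous.aestronglyMeasurable
      have := continuous_fejerWeight l u
      unfold Function.uncurry
      fun_prop
    · simp only [Function.uncurry, norm_mul]
      rw [show ((z.1:ℂ) * z.2 * I) = ((z.1 * z.2 : ℝ) : ℂ) * I by push_cast; ring,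
        norm_exp_ofReal_mul_I, mul_one]

/-- Data of a nonnegative Dirichlet series with a simple pole at `1` and continuous
continuation of the remainder to the closed half plane `1 ≤ re s`. -/
structure PoleData (a : ℕ → ℝ) (A : ℝ) (G : ℂ → ℂ) : Prop where
  nonneg : ∀ n, 0 ≤ a n
  zero : a 0 = 0
  residue_nonneg : 0 ≤ A
  summable : ∀ x : ℝ, 1 < x → LSeriesSummable (fun n => (a n : ℂ)) x
  continuousOn : ContinuousOn G {s | 1 ≤ s.re}
  eq : ∀ s : ℂ, 1 < s.re → LSeries (fun n => (a n : ℂ)) s = A / (s - 1) + G s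

variable {a : ℕ → ℝ} {A : ℝ} {G : ℂ → ℂ}

lemma PoleData.summable_rpow (h : PoleData a A G) {x : ℝ} (hx : 1 < x) :
    Summable fun n : ℕ => a n / (n:ℝ) ^ x := by
  refine (h.summable x hx).norm.congr fun n => ?_
  rw [LSeries.norm_term_eq]
  split_ifs with hn
  · simp [hn, h.zero]
  · simp [abs_of_nonneg (h.nonneg n)]

lemma continuous_tail {x : ℝ} (hG : ContinuousOn G {s | 1 ≤ s.re}) (hx : 1 ≤ x) :
    Continuous fun t : ℝ => G (x - t * I) := by
  refine hG.comp_continuous (by fun_prop) fun t => ?_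
  simpa using hx

lemma PoleData.tsum_fejer (h : PoleData a A G) {l x : ℝ} (hl : 0 < l) (hx : 1 < x) (u : ℝ) :
    ((∑' n : ℕ, a n / (n:ℝ) ^ x * fejer l (Real.log n - u) : ℝ) : ℂ) =
      A * ((∫ s in Ioi (0:ℝ), Real.exp (-(x - 1) * s) * fejer l (s - u) : ℝ) : ℂ) +
        ∫ t in (-l)..l, fejerWeight l u t * G (x - t * I) := by
  have hsum : HasSum (fun n : ℕ => ∫ t in (-l)..l, fejerWeight l u t *
      LSeries.term (fun n => (a n : ℂ)) (x - t * I) n)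
      (∫ t in (-l)..l, fejerWeight l u t * LSeries (fun n => (a n : ℂ)) (x - t * I)) := by
    refine intervalIntegral.hasSum_integral_of_dominated_convergence
      (fun n _ => a n / (n:ℝ) ^ x) (fun n => ?_) (fun n => ?_) ?_ ?_ ?_
    · apply Continuous.aestronglyMeasurable
      have := continuous_fejerWeight l u
      rcases eq_or_ne n 0 with rfl | hn
      · simp [LSeries.term_zero]; fun_prop
      · simp_rw [LSeries.term_of_ne_zero hn]
        have hn' : (n:ℂ) ≠ 0 := by exact_mod_cast hn
        have h2 : Continuous fun t : ℝ => (n:ℂ) ^ (x - t * I) :=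
          Continuous.const_cpow (by fun_prop) (Or.inl hn')
        refine this.mul (continuous_const.div h2 fun t => ?_)
        simp [cpow_eq_zero_iff, hn']
    · refine ae_of_all _ fun t ht => ?_
      rw [uIoc_of_le (by linarith)] at ht
      rw [norm_mul, LSeries.norm_term_eq]
      have := norm_fejerWeight_le u hl ⟨ht.1.le, ht.2⟩
      split_ifs with hn
      · simp [hn, h.zero]
      · have h3 : 0 ≤ a n / (n:ℝ) ^ x := div_nonneg (h.nonneg n) (by positivity)
        simp only [sub_re, ofReal_re, mul_re, I_re, mul_zero, ofReal_im, I_im, mul_one, sub_self,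
          sub_zero, norm_real, Real.norm_of_nonneg (h.nonneg n)]
        nlinarith [norm_nonneg (fejerWeight l u t)]
    · exact ae_of_all _ fun t _ => h.summable_rpow hx
    · exact intervalIntegrable_const
    · refine ae_of_all _ fun t _ => ?_
      have hs : LSeriesSummable (fun n => (a n : ℂ)) (x - t * I) :=
        (h.summable x hx).of_re_le_re (by simp)
      exact (hs.hasSum).mul_left _
  have hterm : ∀ n : ℕ, ∫ t in (-l)..l, fejerWeight l u t *
      LSeries.term (fun n => (a n : ℂ)) (x - t * I) n =
        ((a n / (n:ℝ) ^ x * fejer l (Real.log n - u) : ℝ) : ℂ) := by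
    intro n
    rcases eq_or_ne n 0 with rfl | hn
    · simp [h.zero]
    · push_cast
      rw [fejer_sub_eq_integral hl, ← intervalIntegral.integral_const_mul]
      refine intervalIntegral.integral_congr fun t _ => ?_
      have hn' : (n:ℂ) ≠ 0 := by exact_mod_cast hn
      have hp : (n:ℂ) ^ ((x:ℂ) - t * I) = (((n:ℝ) ^ x : ℝ) : ℂ) * cexp (-(t * Real.log n * I)) := by
        rw [cpow_sub _ _ hn', ofReal_cpow (by positivity), div_eq_mul_inv, ← cpow_neg, 
          cpow_def_of_ne_zero hn' (-_), ← natCast_log, ofReal_natCast]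
        congr 2
        ring
      rw [LSeries.term_of_ne_zero hn, hp, Complex.exp_neg]
      field_simp
  simp_rw [hterm] at hsum
  have hsum' := hsum.tsum_eq
  rw [← ofReal_tsum] at hsum'
  rw [hsum', ← integral_fejerWeight_div hl (by linarith), ← intervalIntegral.integral_const_mul,
    ← intervalIntegral.integral_add]
  · refine intervalIntegral.integral_congr fun t _ => ?_
    rw [h.eq _ (by simpa using hx)]
    push_cast
    ring
  · apply Continuous.intervalIntegrable
    have := continuous_fejerWeight l u
    refine continuous_const.mul (this.mul (continuous_const.div (by fun_prop) fun t => ?_))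
    intro h0
    have := congrArg re h0
    simp at this
    linarith
  · apply Continuous.intervalIntegrable
    exact (continuous_fejerWeight l u).mul (continuous_tail h.continuousOn hx.le)

lemma exists_norm_integral_fejerWeight_le (hG : ContinuousOn G {s | 1 ≤ s.re}) {l ε : ℝ}
    (hl : 0 < l) (hε : 0 < ε) :
    ∃ Y x₀ : ℝ, 1 < x₀ ∧ ∀ u, Y ≤ u → ∀ x, 1 < x → x < x₀ →
      ‖∫ t in (-l)..l, fejerWeight l u t * G (x - t * I)‖ ≤ ε := by
  -- the boundary integral tends to zero by Riemann-Lebesgue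
  have hRL : ∃ Y : ℝ, ∀ u, Y ≤ u →
      ‖∫ t in (-l)..l, fejerWeight l u t * G ((1:ℝ) - t * I)‖ ≤ ε / 2 := by
    have h1 := Real.tendsto_integral_exp_smul_cocompact
      ((Ioc (-l) l).indicator fun t : ℝ => ((1 - |t| / l : ℝ) : ℂ) * G ((1:ℝ) - t * I))
    have h2 := (h1.mono_left atTop_le_cocompact).norm
    rw [norm_zero] at h2
    obtain ⟨Y, hY⟩ := eventually_atTop.1 (h2.eventually (ge_mem_nhds (half_pos hε)))
    refine ⟨Y * (2 * Real.pi), fun u hu => ?_⟩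
    have hpi := Real.pi_pos
    have h3 := hY (u / (2 * Real.pi)) (by rwa [le_div_iff₀ (by positivity)])
    convert! h3 using 2
    rw [intervalIntegral.integral_of_le (by linarith), ← integral_indicator measurableSet_Ioc]
    refine integral_congr_ae (ae_of_all _ fun t => ?_)
    simp only [indicator]
    split_ifs
    · rw [fejerWeight, Circle.smul_def, Real.fourierChar_apply, smul_eq_mul]
      rw [show ((2 * Real.pi * -(t * (u / (2 * Real.pi))) : ℝ) : ℂ) * I = -(t * u * I) by
        push_cast; field_simp]
      ring
    · simp
  obtain ⟨Y, hY⟩ := hRL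
  have hcomp : IsCompact (Icc (1:ℝ) 2 ×ℂ Icc (-l) l) := isCompact_Icc.reProdIm isCompact_Icc
  have huc := hcomp.uniformContinuousOn_of_continuous (f := G)
    (hG.mono fun s hs => (mem_reProdIm.1 hs).1.1)
  rw [Metric.uniformContinuousOn_iff] at huc
  obtain ⟨δ, hδ, hδ'⟩ := huc (ε / (4 * l)) (by positivity)
  refine ⟨Y, 1 + min 1 δ, by simp [hδ], fun u hu x hx hx' => ?_⟩
  have hx2 : x < 2 ∧ x - 1 < δ := by
    constructor
    · linarith [min_le_left 1 δ]
    · linarith [min_le_right 1 δ]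
  have hw := continuous_fejerWeight l u
  have hsub : ∫ t in (-l)..l, fejerWeight l u t * G (x - t * I) =
      (∫ t in (-l)..l, fejerWeight l u t * G ((1:ℝ) - t * I)) +
      ∫ t in (-l)..l, fejerWeight l u t * (G (x - t * I) - G ((1:ℝ) - t * I)) := by
    rw [← intervalIntegral.integral_add]
    · congr 1; ext t; ring
    · exact (hw.mul (continuous_tail hG le_rfl)).intervalIntegrable _ _
    · exact (hw.mul ((continuous_tail hG hx.le).sub
        (continuous_tail hG le_rfl))).intervalIntegrable _ _
  have hsmall : ‖∫ t in (-l)..l, fejerWeight l u t * (G (x - t * I) - G ((1:ℝ) - t * I))‖ ≤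
      ε / (4 * l) * |l - -l| := by
    refine intervalIntegral.norm_integral_le_of_norm_le_const fun t ht => ?_
    rw [uIoc_of_le (by linarith)] at ht
    have hd := hδ' (x - t * I) (by simp [mem_reProdIm]; grind) ((1:ℝ) - t * I)
      (by simp [mem_reProdIm]; grind) (by
        rw [dist_eq_norm, show ((x:ℂ) - t * I) - ((1:ℝ) - t * I) = ((x - 1 : ℝ) : ℂ) by
          push_cast; ring, norm_real, Real.norm_of_nonneg (by linarith)]
        exact hx2.2)
    rw [dist_eq_norm] at hd
    rw [norm_mul]
    calc _ ≤ 1 * (ε / (4 * l)) := by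
          gcongr
          exact norm_fejerWeight_le u hl ⟨ht.1.le, ht.2⟩
      _ = _ := one_mul _
  rw [hsub]
  have h5 : ε / (4 * l) * |l - -l| = ε / 2 := by
    rw [abs_of_pos (by linarith)]; field_simp; ring
  linarith [norm_add_le (∫ t in (-l)..l, fejerWeight l u t * G ((1:ℝ) - t * I))
    (∫ t in (-l)..l, fejerWeight l u t * (G (x - t * I) - G ((1:ℝ) - t * I))), hY u hu]

end

section

open Complex MeasureTheory Filter Topology Set

variable {a : ℕ → ℝ} {A : ℝ} {G : ℂ → ℂ}

lemma PoleData.abs_tsum_fejer_sub_le (h : PoleData a A G) {l ε : ℝ} (hl : 0 < l) (hε : 0 < ε) :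
    ∃ Y x₀ : ℝ, 1 < x₀ ∧ ∀ u, Y ≤ u → ∀ x, 1 < x → x < x₀ →
      |(∑' n : ℕ, a n / (n:ℝ) ^ x * fejer l (Real.log n - u)) -
        A * ∫ s in Ioi (0:ℝ), Real.exp (-(x - 1) * s) * fejer l (s - u)| ≤ ε := by
  obtain ⟨Y, x₀, hx₀, H⟩ := exists_norm_integral_fejerWeight_le h.continuousOn hl hε
  refine ⟨Y, x₀, hx₀, fun u hu x hx hx' => ?_⟩
  have h1 := H u hu x hx hx'
  have h2 := h.tsum_fejer hl hx u
  rw [← sub_eq_iff_eq_add'] at h2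
  rw [← h2] at h1
  rw [← Real.norm_eq_abs, ← norm_real]
  push_cast at h1 ⊢
  exact h1

lemma integrable_exp_mul_fejer {l x : ℝ} (hl : 0 < l) (hx : 1 < x) (u : ℝ) :
    IntegrableOn (fun s => Real.exp (-(x - 1) * s) * fejer l (s - u)) (Ioi (0:ℝ)) := by
  have hf : Integrable fun s => fejer l (s - u) := (integrable_fejer hl).comp_sub_right u
  refine hf.integrableOn.mono' ?_ ?_
  · apply Continuous.aestronglyMeasurable
    have := continuous_fejer l
    fun_prop
  · refine (ae_restrict_mem measurableSet_Ioi).mono fun s hs => ?_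
    have h0 := fejer_nonneg hl.le (s - u)
    rw [Real.norm_of_nonneg (by positivity)]
    have : Real.exp (-(x - 1) * s) ≤ 1 := by
      rw [Real.exp_le_one_iff]
      have : 0 < s := hs
      nlinarith
    nlinarith

lemma integral_exp_mul_fejer_le {l x : ℝ} (hl : 0 < l) (hx : 1 < x) (u : ℝ) :
    ∫ s in Ioi (0:ℝ), Real.exp (-(x - 1) * s) * fejer l (s - u) ≤ ∫ v, fejer 1 v := by
  have hf : Integrable fun s => fejer l (s - u) := (integrable_fejer hl).comp_sub_right u
  calc _ ≤ ∫ s in Ioi (0:ℝ), fejer l (s - u) := by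
        refine setIntegral_mono_on (integrable_exp_mul_fejer hl hx u) hf.integrableOn
          measurableSet_Ioi fun s hs => ?_
        have h0 := fejer_nonneg hl.le (s - u)
        have : Real.exp (-(x - 1) * s) ≤ 1 := by
          rw [Real.exp_le_one_iff]
          have : 0 < s := hs
          nlinarith
        nlinarith
    _ ≤ ∫ s, fejer l (s - u) :=
        setIntegral_le_integral hf (ae_of_all _ fun s => fejer_nonneg hl.le _)
    _ = _ := by rw [integral_sub_right_eq_self (fejer l), integral_fejer hl]

lemma le_integral_exp_mul_fejer {l x u ρ z : ℝ} (hl : 0 < l) (hx : 1 < x) (hρ : 0 < ρ)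
    (hu : ρ ≤ u) (hz : u + ρ ≤ z) :
    Real.exp (-(x - 1) * z) * ∫ v in (-ρ)..ρ, fejer l v ≤
      ∫ s in Ioi (0:ℝ), Real.exp (-(x - 1) * s) * fejer l (s - u) := by
  have hsub : Ioc (u - ρ) (u + ρ) ⊆ Ioi 0 := fun s hs => by
    have := hs.1; simp only [mem_Ioi]; linarith
  calc _ = ∫ s in Ioc (u - ρ) (u + ρ), Real.exp (-(x - 1) * z) * fejer l (s - u) := by
        rw [integral_const_mul, ← intervalIntegral.integral_of_le (by linarith),
          intervalIntegral.integral_comp_sub_right (fejer l)]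
        congr 2 <;> ring
    _ ≤ ∫ s in Ioc (u - ρ) (u + ρ), Real.exp (-(x - 1) * s) * fejer l (s - u) := by
        refine setIntegral_mono_on (((integrable_fejer hl).comp_sub_right u).const_mul _).integrableOn
          ((integrable_exp_mul_fejer hl hx u).mono_set hsub) measurableSet_Ioc fun s hs => ?_
        have h0 := fejer_nonneg hl.le (s - u)
        refine mul_le_mul_of_nonneg_right (Real.exp_le_exp.2 ?_) h0
        have := hs.2
        nlinarith
    _ ≤ _ := by
        refine setIntegral_mono_set (integrable_exp_mul_fejer hl hx u) ?_ hsub.eventuallyLE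
        refine ae_of_all _ fun s => ?_
        have h0 := fejer_nonneg hl.le (s - u)
        positivity

lemma tendsto_integral_fejer {ρ : ℝ} (hρ : 0 < ρ) :
    Tendsto (fun l : ℝ => ∫ v in (-ρ)..ρ, fejer l v) atTop (𝓝 (∫ v, fejer 1 v)) := by
  have h1 := intervalIntegral_tendsto_integral (integrable_fejer one_pos) (l := atTop)
    (a := fun l : ℝ => -(l * ρ)) (b := fun l : ℝ => l * ρ)
    (tendsto_neg_atTop_atBot.comp (tendsto_id.atTop_mul_const hρ)) (tendsto_id.atTop_mul_const hρ)
  refine h1.congr' ?_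
  filter_upwards [eventually_gt_atTop 0] with l hl
  simp_rw [fejer_scale l, intervalIntegral.integral_const_mul]
  rw [intervalIntegral.mul_integral_comp_mul_left]
  simp

lemma PoleData.hasSum_integral_fejer (h : PoleData a A G) {l x : ℝ} (hl : 0 < l) (hx : 1 < x)
    (α β : ℝ) :
    HasSum (fun n : ℕ => a n / (n:ℝ) ^ x * ∫ u in α..β, fejer l (Real.log n - u))
      (∫ u in α..β, ∑' n : ℕ, a n / (n:ℝ) ^ x * fejer l (Real.log n - u)) := by
  simp_rw [← intervalIntegral.integral_const_mul]
  have h0 : ∀ n : ℕ, 0 ≤ a n / (n:ℝ) ^ x := fun n => div_nonneg (h.nonneg n) (by positivity)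
  have hs : Summable fun n : ℕ => a n / (n:ℝ) ^ x * l := (h.summable_rpow hx).mul_right l
  have hb : ∀ (n : ℕ) (u : ℝ), ‖a n / (n:ℝ) ^ x * fejer l (Real.log n - u)‖ ≤
      a n / (n:ℝ) ^ x * l := fun n u => by
    rw [norm_mul, Real.norm_of_nonneg (h0 n), Real.norm_of_nonneg (fejer_nonneg hl.le _)]
    exact mul_le_mul_of_nonneg_left (fejer_le hl.le _) (h0 n)
  refine intervalIntegral.hasSum_integral_of_dominated_convergence
    (fun n _ => a n / (n:ℝ) ^ x * l) (fun n => ?_) (fun n => ae_of_all _ fun u _ => hb n u)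
    (ae_of_all _ fun u _ => hs) intervalIntegrable_const
    (ae_of_all _ fun u _ => (Summable.of_norm_bounded hs fun n => hb n u).hasSum)
  apply Continuous.aestronglyMeasurable
  have := continuous_fejer l
  fun_prop

set_option maxHeartbeats 800000 in
/-- One-sided Wiener–Ikehara estimate on logarithmic windows of bounded length. -/
theorem PoleData.window_lower_bound (h : PoleData a A G) {H ε : ℝ} (hH : 0 < H) (hε : 0 < ε) :
    ∃ Y : ℝ, ∀ y, Y ≤ y → ∀ η, 0 < η → η ≤ H → ∀ S : Finset ℕ,
      (∀ n : ℕ, n ≠ 0 → y < Real.log n → Real.log n ≤ y + η → n ∈ S) →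
      (∀ n ∈ S, n ≠ 0) →
      A * η - ε ≤ ∑ n ∈ S, a n / n := by
  have hA := h.residue_nonneg
  set c := ∫ v, fejer 1 v with hc
  have hcpos : 0 < c := integral_fejer_pos
  have hpi := Real.pi_pos
  obtain ⟨ρ, hρ, hρA⟩ : ∃ ρ > 0, 2 * ρ * A ≤ ε / 4 := by
    refine ⟨ε / (8 * (A + 1)), by positivity, ?_⟩
    rw [show 2 * (ε / (8 * (A + 1))) * A = ε / 4 * (A / (A + 1)) by field_simp; ring]
    have : A / (A + 1) ≤ 1 := by rw [div_le_one (by positivity)]; linarith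
    nlinarith
  obtain ⟨δ, hδ, hδ1, hδA⟩ : ∃ δ > 0, δ < 1 ∧ 2 * δ * A * H ≤ ε / 4 := by
    have hev : ∀ᶠ δ : ℝ in 𝓝[>] 0, δ < 1 ∧ 2 * δ * A * H < ε / 4 := by
      have h1 : Tendsto (fun δ : ℝ => 2 * δ * A * H) (𝓝[>] 0) (𝓝 0) := by
        have : Continuous fun δ : ℝ => 2 * δ * A * H := by fun_prop
        simpa using (this.tendsto 0).mono_left nhdsWithin_le_nhds
      have h2 : Tendsto (fun δ : ℝ => δ) (𝓝[>] 0) (𝓝 0) :=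
        tendsto_id.mono_left nhdsWithin_le_nhds
      exact (h2.eventually (gt_mem_nhds one_pos)).and (h1.eventually (gt_mem_nhds (by positivity)))
    obtain ⟨δ, hδ, hδ'⟩ := (eventually_mem_nhdsWithin.and hev).exists
    exact ⟨δ, hδ, hδ'.1, hδ'.2.le⟩
  set κ := 1 + (H + Real.pi) / ρ with hκ
  have hκpos : 0 < κ := by positivity
  obtain ⟨l, hl, hl1, hl2⟩ : ∃ l > 0, c * (1 - δ) ≤ ∫ v in (-ρ)..ρ, fejer l v ∧
      H * (κ ^ 2 / l) * (2 * A * c + 2) ≤ c * (ε / 4) := by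
    have h1 := (tendsto_integral_fejer hρ).eventually (le_mem_nhds
      (show c * (1 - δ) < ∫ v, fejer 1 v by rw [← hc]; nlinarith))
    have h2 : Tendsto (fun l : ℝ => H * (κ ^ 2 / l) * (2 * A * c + 2)) atTop (𝓝 0) := by
      have : Tendsto (fun l : ℝ => κ ^ 2 / l) atTop (𝓝 0) := tendsto_const_nhds.div_atTop tendsto_id
      simpa using (this.const_mul H).mul_const (2 * A * c + 2)
    obtain ⟨l, hl⟩ := ((eventually_gt_atTop 0).and (h1.and
      (h2.eventually (ge_mem_nhds (show 0 < c * (ε / 4) by positivity))))).exists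
    exact ⟨l, hl⟩
  obtain ⟨Y₁, x₁, hx₁, H₁⟩ := h.abs_tsum_fejer_sub_le hl
    (show 0 < c * ε / (4 * H) by positivity)
  obtain ⟨Y₂, x₂, hx₂, H₂⟩ := h.abs_tsum_fejer_sub_le (l := 1) one_pos one_pos
  refine ⟨max (max Y₁ (Y₂ + Real.pi)) 0, fun y hy η hη hηH S hS hS0 => ?_⟩
  have hy1 : Y₁ ≤ y := (le_max_left _ _).trans ((le_max_left _ _).trans hy)
  have hy2 : Y₂ + Real.pi ≤ y := (le_max_right _ _).trans ((le_max_left _ _).trans hy)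
  have hy0 : 0 ≤ y := (le_max_right _ _).trans hy
  have hSnn : 0 ≤ ∑ n ∈ S, a n / n := Finset.sum_nonneg fun n _ => div_nonneg (h.nonneg n) (by simp)
  by_cases hηρ : η ≤ 2 * ρ
  · nlinarith
  push Not at hηρ
  obtain ⟨x, hx, hxx₁, hxx₂, hexp⟩ : ∃ x > 1, x < x₁ ∧ x < x₂ ∧
      1 - δ ≤ Real.exp (-(x - 1) * (y + η)) := by
    have h1 : Tendsto (fun x : ℝ => Real.exp (-(x - 1) * (y + η))) (𝓝[>] 1) (𝓝 1) := by
      have : Continuous fun x : ℝ => Real.exp (-(x - 1) * (y + η)) := by fun_prop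
      simpa using (this.tendsto 1).mono_left nhdsWithin_le_nhds
    have h2 : Tendsto (fun x : ℝ => x) (𝓝[>] 1) (𝓝 1) := tendsto_id.mono_left nhdsWithin_le_nhds
    obtain ⟨x, hx⟩ := ((eventually_mem_nhdsWithin (a := (1:ℝ)) (s := Ioi 1)).and
      ((h2.eventually (gt_mem_nhds hx₁)).and ((h2.eventually (gt_mem_nhds hx₂)).and
      (h1.eventually (le_mem_nhds (show 1 - δ < 1 by linarith)))))).exists
    exact ⟨x, hx⟩
  set b : ℕ → ℝ := fun n => a n / (n:ℝ) ^ x with hb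
  have hb0 : ∀ n, 0 ≤ b n := fun n => div_nonneg (h.nonneg n) (by positivity)
  have hbs : Summable b := h.summable_rpow hx
  set α := y + ρ with hα
  set β := y + η - ρ with hβ
  have hαβ : α ≤ β := by linarith
  -- lower bound for the smoothed count
  have hlow : (β - α) * (A * c * (1 - δ) ^ 2 - c * ε / (4 * H)) ≤
      ∫ u in α..β, ∑' n : ℕ, b n * fejer l (Real.log n - u) := by
    rw [← smul_eq_mul, ← intervalIntegral.integral_const]
    refine intervalIntegral.integral_mono_on hαβ intervalIntegrable_const ?_ fun u hu => ?_
    · apply Continuous.intervalIntegrable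
      refine continuous_tsum (u := fun n => b n * l) (fun n => ?_) (hbs.mul_right l) fun n u => ?_
      · have := continuous_fejer l
        fun_prop
      · rw [norm_mul, Real.norm_of_nonneg (hb0 n), Real.norm_of_nonneg (fejer_nonneg hl.le _)]
        exact mul_le_mul_of_nonneg_left (fejer_le hl.le _) (hb0 n)
    · have h1 := H₁ u (by linarith [hu.1]) x hx hxx₁
      have h2 := le_integral_exp_mul_fejer (z := y + η) hl hx hρ (u := u)
        (by linarith [hu.1]) (by linarith [hu.2])
      have h3 : (1 - δ) * (c * (1 - δ)) ≤
          Real.exp (-(x - 1) * (y + η)) * ∫ v in (-ρ)..ρ, fejer l v := by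
        gcongr
      have h4 := mul_le_mul_of_nonneg_left (h3.trans h2) hA
      have h5 := (abs_le.1 h1).1
      linarith
  -- upper bound
  have hΘ : Summable (fun n => b n * (fejer 1 (Real.log n - y) +
      fejer 1 (Real.log n - (y - Real.pi)))) ∧ ∑' n, b n * (fejer 1 (Real.log n - y) +
      fejer 1 (Real.log n - (y - Real.pi))) ≤ 2 * A * c + 2 := by
    have hs : ∀ u, Summable fun n => b n * fejer 1 (Real.log n - u) := fun u =>
      Summable.of_nonneg_of_le (fun n => mul_nonneg (hb0 n) (fejer_nonneg zero_le_one _))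
        (fun n => mul_le_of_le_one_right (hb0 n) (fejer_le zero_le_one _)) hbs
    simp_rw [mul_add]
    refine ⟨(hs _).add (hs _), ?_⟩
    rw [(hs _).tsum_add (hs _)]
    have h1 := (abs_le.1 (H₂ y (by linarith) x hx hxx₂)).2
    have h2 := (abs_le.1 (H₂ (y - Real.pi) (by linarith) x hx hxx₂)).2
    have h3 := mul_le_mul_of_nonneg_left (integral_exp_mul_fejer_le one_pos hx y) hA
    have h4 := mul_le_mul_of_nonneg_left (integral_exp_mul_fejer_le one_pos hx (y - Real.pi)) hA
    rw [← hc] at h3 h4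
    linarith
  have hup : ∫ u in α..β, ∑' n : ℕ, b n * fejer l (Real.log n - u) ≤
      c * ∑ n ∈ S, b n + H * (κ ^ 2 / l) * (2 * A * c + 2) := by
    have h1 := h.hasSum_integral_fejer hl hx α β
    have hSs : HasSum (fun n => if n ∈ S then c * b n else 0) (c * ∑ n ∈ S, b n) := by
      rw [Finset.mul_sum]
      have := hasSum_sum_of_ne_finset_zero (L := .unconditional ℕ)
        (f := fun n => if n ∈ S then c * b n else 0) (s := S) (fun n hn => by simp [hn])
      rwa [Finset.sum_congr rfl (g := fun n => c * b n) fun n hn => by simp [hn]] at this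
    refine (hasSum_le (fun n => ?_) h1 (hSs.add (hΘ.1.hasSum.mul_left (H * (κ ^ 2 / l))))).trans ?_
    · have hΘn : 0 ≤ H * (κ ^ 2 / l) * (b n * (fejer 1 (Real.log n - y) +
          fejer 1 (Real.log n - (y - Real.pi)))) :=
        mul_nonneg (by positivity) (mul_nonneg (hb0 n) (add_nonneg (fejer_nonneg zero_le_one _)
          (fejer_nonneg zero_le_one _)))
      by_cases hn : n ∈ S
      · simp only [hn, if_true]
        have : ∫ u in α..β, fejer l (Real.log n - u) ≤ c := by
          rw [intervalIntegral.integral_comp_sub_left (fejer l), hc, ← integral_fejer hl,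
            intervalIntegral.integral_of_le (by linarith)]
          exact setIntegral_le_integral (integrable_fejer hl)
            (ae_of_all _ fun s => fejer_nonneg hl.le _)
        have := mul_le_mul_of_nonneg_left this (hb0 n)
        linarith
      · simp only [hn, if_false, zero_add]
        rcases eq_or_ne n 0 with rfl | hn0
        · simp [hb, h.zero]
        have hout : Real.log n ≤ y ∨ y + η < Real.log n := by
          by_contra! hcon
          exact hn (hS n hn0 hcon.1 hcon.2)
        set v := Real.log n with hv
        have hpt : ∀ u ∈ Icc α β, fejer l (v - u) ≤
            κ ^ 2 / l * (fejer 1 (v - y) + fejer 1 (v - (y - Real.pi))) := by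
          intro u hu
          have hd : ρ ≤ |v - u| := by
            rcases hout with ho | ho
            · rw [abs_of_nonpos] <;> linarith [hu.1]
            · rw [abs_of_nonneg] <;> linarith [hu.2]
          have hne : v - u ≠ 0 := by
            intro h0; rw [h0, abs_zero] at hd; linarith
          have huy : |u - y| ≤ H := by
            rw [abs_of_nonneg] <;> linarith [hu.1, hu.2]
          have hcmp : |v - y| + Real.pi ≤ |v - u| * κ := by
            have h3 : |v - y| ≤ |v - u| + |u - y| := abs_sub_le _ _ _
            have h4 : H + Real.pi ≤ |v - u| * ((H + Real.pi) / ρ) := by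
              rw [mul_div_assoc', le_div_iff₀ hρ, mul_comm]
              gcongr
            rw [hκ, mul_add, mul_one]
            linarith
          have h5 := four_div_le_fejer_add (v - y)
          rw [show v - y + Real.pi = v - (y - Real.pi) by ring] at h5
          calc fejer l (v - u) ≤ 4 / (l * (v - u) ^ 2) := fejer_le_div hl hne
            _ ≤ κ ^ 2 / l * (4 / (|v - y| + Real.pi) ^ 2) := by
              rw [← sq_abs (v - u), div_mul_div_comm, div_le_div_iff₀ (by positivity)
                (by positivity)]
              have : (|v - y| + Real.pi) ^ 2 ≤ (|v - u| * κ) ^ 2 := by gcongr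
              nlinarith
            _ ≤ _ := by gcongr
        have hintegral : ∫ u in α..β, fejer l (v - u) ≤
            (β - α) * (κ ^ 2 / l * (fejer 1 (v - y) + fejer 1 (v - (y - Real.pi)))) := by
          rw [← smul_eq_mul (β - α), ← intervalIntegral.integral_const]
          refine intervalIntegral.integral_mono_on hαβ ?_ intervalIntegrable_const hpt
          apply Continuous.intervalIntegrable
          have := continuous_fejer l
          fun_prop
        have h6 : 0 ≤ κ ^ 2 / l * (fejer 1 (v - y) + fejer 1 (v - (y - Real.pi))) :=
          mul_nonneg (by positivity) (add_nonneg (fejer_nonneg zero_le_one _)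
            (fejer_nonneg zero_le_one _))
        have h7 : (β - α) * (κ ^ 2 / l * (fejer 1 (v - y) + fejer 1 (v - (y - Real.pi)))) ≤
            H * (κ ^ 2 / l * (fejer 1 (v - y) + fejer 1 (v - (y - Real.pi)))) := by
          gcongr
          linarith
        have := mul_le_mul_of_nonneg_left (hintegral.trans h7) (hb0 n)
        calc _ ≤ _ := this
          _ = _ := by ring
    · gcongr
      exact hΘ.2
  have hSb : ∑ n ∈ S, b n ≤ ∑ n ∈ S, a n / n := by
    refine Finset.sum_le_sum fun n hn => ?_
    have hn1 : (1:ℝ) ≤ n := by exact_mod_cast Nat.one_le_iff_ne_zero.2 (hS0 n hn)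
    have := h.nonneg n
    simp only [hb]
    gcongr
    simpa using Real.rpow_le_rpow_of_exponent_le hn1 hx.le
  have hfin : (β - α) * (A * c * (1 - δ) ^ 2 - c * ε / (4 * H)) ≤
      c * (∑ n ∈ S, a n / n + ε / 4) := by
    have := mul_le_mul_of_nonneg_left hSb hcpos.le
    linarith
  have hfin2 : (β - α) * (A * (1 - δ) ^ 2 - ε / (4 * H)) ≤ ∑ n ∈ S, a n / n + ε / 4 := by
    refine le_of_mul_le_mul_left ?_ hcpos
    refine le_trans (le_of_eq ?_) hfin
    field_simp
  have hlen : β - α = η - 2 * ρ := by rw [hα, hβ]; ring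
  have e1 : (η - 2 * ρ) * (ε / (4 * H)) ≤ ε / 4 := by
    rw [mul_div_assoc', div_le_div_iff₀ (by positivity) (by positivity)]
    nlinarith
  have e2 : (η - 2 * ρ) * (A * (1 - δ) ^ 2) ≥ A * η - 2 * ρ * A - 2 * δ * A * H := by
    have h8 : (1 - δ) ^ 2 ≥ 1 - 2 * δ := by nlinarith [sq_nonneg δ]
    have h9 : (η - 2 * ρ) * A * (1 - δ) ^ 2 ≥ (η - 2 * ρ) * A * (1 - 2 * δ) := by
      have : 0 ≤ (η - 2 * ρ) * A := mul_nonneg (by linarith) hA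
      gcongr
    have h10 : (η - 2 * ρ) * (A * δ) ≤ H * (A * δ) := by
      gcongr
      linarith
    linarith
  rw [hlen, mul_sub] at hfin2
  linarith

end

/-! ### Primes in short intervals and residue classes -/

section

open Complex MeasureTheory Filter Topology Set

lemma poleData_residueClass {q : ℕ} [NeZero q] {a : ZMod q} (ha : IsUnit a) :
    PoleData (ArithmeticFunction.vonMangoldt.residueClass a) ((q.totient : ℝ)⁻¹)
      (ArithmeticFunction.vonMangoldt.LFunctionResidueClassAux a) where
  nonneg := ArithmeticFunction.vonMangoldt.residueClass_nonneg a
  zero := ArithmeticFunction.vonMangoldt.residueClass_apply_zero a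
  residue_nonneg := by positivity
  summable x hx := LSeriesSummable_of_abscissaOfAbsConv_lt_re <|
    (ArithmeticFunction.vonMangoldt.abscissaOfAbsConv_residueClass_le_one a).trans_lt <| by
      simpa using by exact_mod_cast hx
  continuousOn := ArithmeticFunction.vonMangoldt.continuousOn_LFunctionResidueClassAux a
  eq s hs := by
    rw [ArithmeticFunction.vonMangoldt.eqOn_LFunctionResidueClassAux ha hs]
    push_cast
    ring

/-- Lower bound for the number of primes of a residue class in an interval of length comparable
to its left endpoint. -/
theorem card_primes_residueClass_lower_bound {q : ℕ} [NeZero q] {a : ZMod q} (ha : IsUnit a)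
    {κ ε : ℝ} (hκ : 0 < κ) (hε : 0 < ε) :
    ∃ U : ℕ, ∀ u h : ℕ, U ≤ u → κ * u ≤ h → h ≤ u →
      h / q.totient * (1 - h / u - ε) ≤
        ((Finset.Ioc u (u + h)).filter fun p : ℕ => p.Prime ∧ (p : ZMod q) = a).card *
          Real.log (u + h : ℕ) := by
  set A := ((q.totient : ℝ)⁻¹) with hA
  have hφ : 0 < (q.totient : ℝ) := by exact_mod_cast Nat.totient_pos.2 (NeZero.pos q)
  have hApos : 0 < A := by positivity
  set ε₁ := ε * κ * A / 2 with hε₁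
  have hε₁pos : 0 < ε₁ := by positivity
  obtain ⟨Y, hY⟩ := (poleData_residueClass ha).window_lower_bound one_pos hε₁pos
  obtain ⟨s, hs⟩ := summable_iff_vanishing_norm.1
    (ArithmeticFunction.vonMangoldt.summable_residueClass_non_primes_div a) ε₁ hε₁pos
  refine ⟨max (max (s.sup id) ⌈Real.exp Y⌉₊) 1, fun u h hu hκh hhu => ?_⟩
  have hu1 : 1 ≤ u := (le_max_right _ _).trans hu
  have huY : Y ≤ Real.log u := by
    rw [Real.le_log_iff_exp_le (by exact_mod_cast hu1)]
    exact (Nat.le_ceil _).trans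
      (by exact_mod_cast (le_max_right _ _).trans ((le_max_left _ _).trans hu))
  have hus : s.sup id ≤ u := (le_max_left _ _).trans ((le_max_left _ _).trans hu)
  have hu0 : (0:ℝ) < u := by exact_mod_cast hu1
  have hh0 : (0:ℝ) < h := lt_of_lt_of_le (by positivity) hκh
  have hh1 : (h:ℝ) ≤ u := by exact_mod_cast hhu
  set t := (h:ℝ) / u with ht
  have ht0 : 0 < t := by positivity
  have ht1 : t ≤ 1 := by rw [ht, div_le_one hu0]; exact hh1
  have hlog : Real.log (u + h : ℕ) = Real.log u + Real.log (1 + t) := by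
    rw [← Real.log_mul (by positivity) (by positivity), ht]
    congr 1
    push_cast
    field_simp
  have hη : 0 < Real.log (1 + t) := Real.log_pos (by linarith)
  have hη1 : Real.log (1 + t) ≤ 1 := by
    linarith [Real.log_le_sub_one_of_pos (show 0 < 1 + t by linarith)]
  have hη2 : t - t ^ 2 ≤ Real.log (1 + t) := by
    have h1 := Real.one_sub_inv_le_log_of_pos (show 0 < 1 + t by linarith)
    refine le_trans ?_ h1
    rw [show 1 - (1 + t)⁻¹ = t / (1 + t) by field_simp; ring, le_div_iff₀ (by linarith)]
    nlinarith [pow_pos ht0 3]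
  have hwin := hY (Real.log u) huY _ hη hη1 (Finset.Ioc u (u + h)) (fun n hn h1 h2 => by
      have hn0 : (0:ℝ) < n := by exact_mod_cast Nat.pos_of_ne_zero hn
      rw [← hlog] at h2
      rw [Real.log_lt_log_iff hu0 hn0] at h1
      rw [Real.log_le_log_iff hn0 (by positivity)] at h2
      rw [Finset.mem_Ioc]
      exact ⟨by exact_mod_cast h1, by exact_mod_cast h2⟩)
    (fun n hn => by rw [Finset.mem_Ioc] at hn; omega)
  have htail := hs (Finset.Ioc u (u + h)) (by
    rw [Finset.disjoint_left]
    intro n hn hns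
    have := Finset.le_sup (f := id) hns
    rw [Finset.mem_Ioc] at hn
    simp only [id] at this
    omega)
  rw [Real.norm_eq_abs] at htail
  have htail' := (abs_lt.1 htail).2
  have hsplit : ∑ n ∈ Finset.Ioc u (u + h), ArithmeticFunction.vonMangoldt.residueClass a n / n =
      ∑ n ∈ Finset.Ioc u (u + h),
        (if n.Prime then 0 else ArithmeticFunction.vonMangoldt.residueClass a n) / (n:ℝ) +
      ∑ n ∈ Finset.Ioc u (u + h),
        (if n.Prime then ArithmeticFunction.vonMangoldt.residueClass a n else 0) / (n:ℝ) := by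
    rw [← Finset.sum_add_distrib]
    refine Finset.sum_congr rfl fun n _ => ?_
    split_ifs <;> simp
  have hprime : ∑ n ∈ Finset.Ioc u (u + h),
      (if n.Prime then ArithmeticFunction.vonMangoldt.residueClass a n else 0) / (n:ℝ) ≤
      ((Finset.Ioc u (u + h)).filter fun p : ℕ => p.Prime ∧ (p : ZMod q) = a).card *
        (Real.log (u + h : ℕ) / u) := by
    rw [← nsmul_eq_mul, ← Finset.sum_const, Finset.sum_filter]
    refine Finset.sum_le_sum fun n hn => ?_
    rw [Finset.mem_Ioc] at hn
    have hn0 : (0:ℝ) < n := by exact_mod_cast (by omega : 0 < n)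
    by_cases hp : n.Prime
    · by_cases hna : (n : ZMod q) = a
      · simp only [hp, hna, if_true, and_self, ArithmeticFunction.vonMangoldt.residueClass,
          Set.indicator, Set.mem_ofPred_eq, ArithmeticFunction.vonMangoldt_apply_prime hp]
        have : Real.log n ≤ Real.log (u + h : ℕ) :=
          Real.log_le_log hn0 (by exact_mod_cast hn.2)
        have h3 : 0 ≤ Real.log n := Real.log_natCast_nonneg n
        gcongr
        exact_mod_cast hn.1.le
      · simp [hp, hna, ArithmeticFunction.vonMangoldt.residueClass, Set.indicator]
    · simp [hp]
  set N := (((Finset.Ioc u (u + h)).filter fun p : ℕ => p.Prime ∧ (p : ZMod q) = a).card : ℝ)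
  have hfin : A * (t - t ^ 2) - 2 * ε₁ ≤ N * (Real.log (u + h : ℕ) / u) := by
    have := mul_le_mul_of_nonneg_left hη2 hApos.le
    linarith
  have hfin2 := mul_le_mul_of_nonneg_left hfin hu0.le
  have h4 : (u:ℝ) * (N * (Real.log (u + h : ℕ) / u)) = N * Real.log (u + h : ℕ) := by
    field_simp
  have hut : (u:ℝ) * t = h := by rw [ht]; field_simp
  have h5 : κ * u * (ε * A) ≤ h * (ε * A) := by gcongr
  rw [h4] at hfin2
  refine le_trans ?_ hfin2
  rw [div_eq_mul_inv, ← hA, hε₁]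
  have h6 : (u:ℝ) * t ^ 2 = h * t := by rw [← hut]; ring
  calc _ = h * A - h * t * A - h * (ε * A) := by ring
    _ ≤ h * A - h * t * A - κ * u * (ε * A) := by linarith
    _ = (u * t) * A - u * t ^ 2 * A - κ * u * (ε * A) := by rw [h6, hut]
    _ = _ := by ring

end

/-! ### Additive characters and the Dirichlet kernel -/

section

open Finset

/-- The additive character `θ ↦ exp (2 π i θ)`. -/
noncomputable def e (θ : ℝ) : ℂ := Complex.exp (2 * Real.pi * θ * Complex.I)

lemma e_add (x y : ℝ) : e (x + y) = e x * e y := by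
  simp only [e, ← Complex.exp_add]; congr 1; push_cast; ring

@[simp] lemma e_zero : e 0 = 1 := by simp [e]

@[simp] lemma norm_e (x : ℝ) : ‖e x‖ = 1 := by
  rw [e, show (2 * Real.pi * x * Complex.I : ℂ) = ((2 * Real.pi * x : ℝ) : ℂ) * Complex.I by
    push_cast; ring, Complex.norm_exp_ofReal_mul_I]

@[simp] lemma e_int (n : ℤ) : e n = 1 := by
  rw [e, Complex.exp_eq_one_iff]; exact ⟨n, by push_cast; ring⟩

@[simp] lemma e_nat (n : ℕ) : e n = 1 := by simpa using e_int n

lemma e_add_int (x : ℝ) (n : ℤ) : e (x + n) = e x := by rw [e_add, e_int, mul_one]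

lemma e_fract (x : ℝ) : e (Int.fract x) = e x := by
  conv_rhs => rw [← Int.fract_add_floor x, e_add_int]

lemma e_neg (x : ℝ) : e (-x) = starRingEnd ℂ (e x) := by
  rw [e, e, ← Complex.exp_conj]
  congr 1
  simp only [map_mul, map_ofNat, Complex.conj_ofReal, Complex.conj_I]
  push_cast
  ring

lemma e_mul_nat (x : ℝ) (n : ℕ) : e (x * n) = e x ^ n := by
  rw [e, e, ← Complex.exp_nat_mul]; congr 1; push_cast; ring

lemma e_sum {ι : Type*} (s : Finset ι) (f : ι → ℝ) : e (∑ i ∈ s, f i) = ∏ i ∈ s, e (f i) := by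
  classical
  induction s using Finset.induction_on with
  | empty => simp
  | insert a s ha ih => rw [Finset.sum_insert ha, Finset.prod_insert ha, e_add, ih]

lemma e_eq_one_iff {x : ℝ} : e x = 1 ↔ ∃ n : ℤ, x = n := by
  constructor
  · intro h
    rw [e, Complex.exp_eq_one_iff] at h
    obtain ⟨n, hn⟩ := h
    refine ⟨n, ?_⟩
    have hpi : (2 * Real.pi * Complex.I : ℂ) ≠ 0 := Complex.two_pi_I_ne_zero
    have : (x : ℂ) = n := by
      apply mul_right_cancel₀ hpi
      rw [← hn]; ring
    exact_mod_cast this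
  · rintro ⟨n, rfl⟩; exact e_int n

lemma norm_e_sub_one (x : ℝ) : ‖e x - 1‖ = 2 * |Real.sin (Real.pi * x)| := by
  have h := Complex.norm_exp_I_mul_ofReal_sub_one (2 * Real.pi * x)
  rw [e, show (2 * Real.pi * x * Complex.I : ℂ) =
    Complex.I * ((2 * Real.pi * x : ℝ) : ℂ) by push_cast; ring, h, norm_mul,
    show 2 * Real.pi * x / 2 = Real.pi * x by ring]
  simp

/-- The Dirichlet kernel of length `L`. -/
noncomputable def dir (L : ℕ) (θ : ℝ) : ℂ := ∑ x ∈ range L, e (θ * x)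

lemma norm_dir_le (L : ℕ) (θ : ℝ) : ‖dir L θ‖ ≤ L := by
  refine (norm_sum_le _ _).trans ?_
  simp

lemma dir_fract (L : ℕ) (θ : ℝ) : dir L (Int.fract θ) = dir L θ := by
  unfold dir
  refine sum_congr rfl fun x _ => ?_
  rw [e_mul_nat, e_mul_nat, e_fract]

lemma dir_mul_sub_one (L : ℕ) (θ : ℝ) : dir L θ * (e θ - 1) = e (θ * L) - 1 := by
  simp_rw [dir, e_mul_nat]
  rw [geom_sum_mul]

lemma norm_dir_le_div {L : ℕ} {θ : ℝ} (h0 : 0 < θ) (h1 : θ < 1) :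
    ‖dir L θ‖ ≤ (1 / θ + 1 / (1 - θ)) / 2 := by
  have hpi := Real.pi_pos
  have hs : 2 * min θ (1 - θ) ≤ Real.sin (Real.pi * θ) := by
    rcases le_total θ (1 - θ) with h | h
    · rw [min_eq_left h]
      have := Real.mul_le_sin (x := Real.pi * θ) (by positivity) (by nlinarith)
      calc 2 * θ = 2 / Real.pi * (Real.pi * θ) := by field_simp
        _ ≤ _ := this
    · rw [min_eq_right h]
      have := Real.mul_le_sin (x := Real.pi * (1 - θ)) (by nlinarith) (by nlinarith)
      rw [show Real.pi * (1 - θ) = Real.pi - Real.pi * θ by ring, Real.sin_pi_sub] at this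
      calc 2 * (1 - θ) = 2 / Real.pi * (Real.pi - Real.pi * θ) := by field_simp
        _ ≤ _ := this
  have hmin : 0 < min θ (1 - θ) := lt_min h0 (by linarith)
  have h2 : ‖dir L θ‖ * (2 * Real.sin (Real.pi * θ)) ≤ 2 := by
    have h3 := congrArg norm (dir_mul_sub_one L θ)
    rw [norm_mul, norm_e_sub_one, abs_of_pos (by linarith)] at h3
    rw [h3]
    calc _ ≤ ‖e (θ * L)‖ + ‖(1:ℂ)‖ := norm_sub_le _ _
      _ = 2 := by simp; norm_num
  have h4 : ‖dir L θ‖ * (2 * min θ (1 - θ)) ≤ 1 := by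
    have := mul_le_mul_of_nonneg_left hs (norm_nonneg (dir L θ))
    linarith
  have h5 : ‖dir L θ‖ ≤ 1 / min θ (1 - θ) / 2 := by
    rw [div_div, le_div_iff₀ (by positivity)]; linarith
  refine h5.trans ?_
  have e1 : 0 < 1 / θ := by positivity
  have e2 : 0 < 1 / (1 - θ) := one_div_pos.2 (by linarith)
  rcases min_choice θ (1 - θ) with h | h <;> rw [h] <;> linarith

/-- Points of `[0,1)` that fall into distinct bins of width `1/N`. -/
lemma sum_norm_dir_le {ι : Type*} (s : Finset ι) (y : ι → ℝ) (L N : ℕ) (hN : 0 < N)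
    (hsep : ∀ i ∈ s, ∀ j ∈ s, i ≠ j → 1 / (N : ℝ) ≤ |Int.fract (y i) - Int.fract (y j)|) :
    ∑ i ∈ s, ‖dir L (y i)‖ ≤ 2 * L + N * (1 + Real.log N) := by
  classical
  have hNr : (0:ℝ) < N := by exact_mod_cast hN
  set bin : ι → ℕ := fun i => ⌊(N:ℝ) * Int.fract (y i)⌋₊ with hbin
  have hbinlt : ∀ i, bin i < N := fun i => by
    rw [hbin]; simp only
    rw [Nat.floor_lt (mul_nonneg hNr.le (Int.fract_nonneg _))]
    have := Int.fract_lt_one (y i)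
    nlinarith
  have hinj : Set.InjOn bin s := by
    intro i hi j hj hij
    by_contra hne
    have h1 := hsep i hi j hj hne
    have h2 : |(N:ℝ) * Int.fract (y i) - N * Int.fract (y j)| < 1 := by
      have a1 := Nat.floor_le (mul_nonneg hNr.le (Int.fract_nonneg (y i)))
      have a2 := Nat.lt_floor_add_one ((N:ℝ) * Int.fract (y i))
      have b1 := Nat.floor_le (mul_nonneg hNr.le (Int.fract_nonneg (y j)))
      have b2 := Nat.lt_floor_add_one ((N:ℝ) * Int.fract (y j))
      simp only [hbin] at hij
      rw [hij] at a1 a2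
      rw [abs_lt]
      constructor <;> linarith
    rw [← mul_sub, abs_mul, abs_of_pos hNr] at h2
    rw [div_le_iff₀ hNr] at h1
    linarith
  set g : ℕ → ℝ := fun b => if b = 0 then (L:ℝ) else N / (2 * b) with hg
  have hg0 : ∀ b, 0 ≤ g b := fun b => by simp only [hg]; split_ifs <;> positivity
  have hpt : ∀ i ∈ s, ‖dir L (y i)‖ ≤ g (bin i) + g (N - 1 - bin i) := by
    intro i _
    by_cases h0 : bin i = 0
    · have : g (bin i) = L := by simp [hg, h0]
      linarith [norm_dir_le L (y i), hg0 (N - 1 - bin i)]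
    by_cases h1 : N - 1 - bin i = 0
    · have : g (N - 1 - bin i) = L := by simp [hg, h1]
      linarith [norm_dir_le L (y i), hg0 (bin i)]
    have hb := hbinlt i
    have hlow : (bin i : ℝ) ≤ N * Int.fract (y i) :=
      Nat.floor_le (mul_nonneg hNr.le (Int.fract_nonneg (y i)))
    have hhigh : N * Int.fract (y i) < bin i + 1 := Nat.lt_floor_add_one _
    have hbpos : (0:ℝ) < bin i := by exact_mod_cast Nat.pos_of_ne_zero h0
    have hcpos : (0:ℝ) < ((N - 1 - bin i : ℕ) : ℝ) := by exact_mod_cast Nat.pos_of_ne_zero h1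
    have hcc : ((N - 1 - bin i : ℕ) : ℝ) = N - 1 - bin i := by
      rw [Nat.cast_sub (by omega), Nat.cast_sub (by omega)]; simp
    have hf0 : 0 < Int.fract (y i) := by
      by_contra hcon
      have : Int.fract (y i) = 0 := le_antisymm (not_lt.1 hcon) (Int.fract_nonneg _)
      rw [this, mul_zero] at hlow
      linarith
    have hf1 := Int.fract_lt_one (y i)
    have h2 := norm_dir_le_div (L := L) hf0 hf1
    rw [dir_fract] at h2
    refine h2.trans ?_
    have e1 : 1 / Int.fract (y i) ≤ N / bin i := by
      rw [div_le_div_iff₀ hf0 hbpos]; linarith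
    have e2 : 1 / (1 - Int.fract (y i)) ≤ N / ((N - 1 - bin i : ℕ) : ℝ) := by
      rw [div_le_div_iff₀ (by linarith) hcpos, hcc]; linarith
    simp only [hg, h0, h1, if_false]
    rw [mul_comm 2, ← div_div, mul_comm 2, ← div_div]
    linarith
  calc ∑ i ∈ s, ‖dir L (y i)‖ ≤ ∑ i ∈ s, (g (bin i) + g (N - 1 - bin i)) := sum_le_sum hpt
    _ = ∑ b ∈ s.image bin, (g b + g (N - 1 - b)) := by rw [sum_image hinj]
    _ ≤ ∑ b ∈ range N, (g b + g (N - 1 - b)) := by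
        refine sum_le_sum_of_subset_of_nonneg ?_ fun b _ _ => add_nonneg (hg0 _) (hg0 _)
        intro b hb
        obtain ⟨i, _, rfl⟩ := mem_image.1 hb
        exact mem_range.2 (hbinlt i)
    _ = 2 * ∑ b ∈ range N, g b := by
        rw [sum_add_distrib, sum_range_reflect g N]; ring
    _ ≤ 2 * (L + N / 2 * (1 + Real.log N)) := by
        gcongr
        obtain ⟨m, rfl⟩ : ∃ m, N = m + 1 := ⟨N - 1, by omega⟩
        rw [sum_range_succ']
        have h1 : ∑ k ∈ range m, g (k + 1) = ((m + 1 : ℕ):ℝ) / 2 * (harmonic m : ℝ) := by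
          rw [harmonic, Rat.cast_sum, mul_sum]
          refine sum_congr rfl fun k _ => ?_
          simp only [hg, Nat.succ_ne_zero, if_false]
          push_cast
          field_simp
        have h2 : (harmonic m : ℝ) ≤ 1 + Real.log (m + 1 : ℕ) := by
          rcases Nat.eq_zero_or_pos m with rfl | hm
          · simp
          · refine (harmonic_le_one_add_log m).trans ?_
            gcongr
            simp
        rw [h1]
        have h3 : g 0 = L := by simp [hg]
        rw [h3, add_comm]
        gcongr
    _ = _ := by ring

end

/-! ### A Selberg majorant -/

section

open Finset

/-- The Ramanujan sum to a prime modulus. -/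
noncomputable def ram (p n : ℕ) : ℝ := if p ∣ n then (p:ℝ) - 1 else -1

/-- Multiplicative extension of `ram` to sets of primes. -/
noncomputable def ramProd (P : Finset ℕ) (n : ℕ) : ℝ := ∏ p ∈ P, ram p n

/-- Euler's function of the product of a set of primes. -/
noncomputable def phi (P : Finset ℕ) : ℝ := ∏ p ∈ P, ((p:ℝ) - 1)

/-- Sets of primes from `S` with product at most `Q`. -/
def fam (S : Finset ℕ) (Q : ℕ) : Finset (Finset ℕ) :=
  S.powerset.filter fun P => ∏ p ∈ P, p ≤ Q

/-- The normalising factor of the sieve weight. -/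
noncomputable def mass (S : Finset ℕ) (Q : ℕ) : ℝ := ∑ P ∈ fam S Q, (phi P)⁻¹

/-- The sieve weight, equal to one on integers free of prime factors in `S`. -/
noncomputable def lam (S : Finset ℕ) (Q n : ℕ) : ℝ :=
  (mass S Q)⁻¹ * ∑ P ∈ fam S Q, (-1) ^ P.card * ramProd P n / phi P

variable {S : Finset ℕ} {Q : ℕ}

lemma phi_pos {P : Finset ℕ} (hP : ∀ p ∈ P, p.Prime) : 0 < phi P :=
  prod_pos fun p hp => by
    have : (2:ℝ) ≤ p := by exact_mod_cast (hP p hp).two_le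
    linarith

lemma phi_union {P P' : Finset ℕ} (h : Disjoint P P') : phi (P ∪ P') = phi P * phi P' :=
  prod_union h

lemma ramProd_union {P P' : Finset ℕ} (h : Disjoint P P') (n : ℕ) :
    ramProd (P ∪ P') n = ramProd P n * ramProd P' n :=
  prod_union h

lemma prime_of_mem_fam (hS : ∀ p ∈ S, p.Prime) {P : Finset ℕ} (hP : P ∈ fam S Q) :
    ∀ p ∈ P, p.Prime := fun p hp =>
  hS p (mem_powerset.1 (mem_filter.1 hP).1 hp)

lemma empty_mem_fam (hQ : 1 ≤ Q) : ∅ ∈ fam S Q := by simp [fam, hQ]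

lemma one_le_mass (hS : ∀ p ∈ S, p.Prime) (hQ : 1 ≤ Q) : 1 ≤ mass S Q := by
  have h := single_le_sum (f := fun P => (phi P)⁻¹) (fun P hP =>
    (inv_pos.2 (phi_pos (prime_of_mem_fam hS hP))).le) (empty_mem_fam (S := S) hQ)
  simpa [phi, mass] using h

lemma lam_eq_one (hS : ∀ p ∈ S, p.Prime) (hQ : 1 ≤ Q) {n : ℕ} (hn : ∀ p ∈ S, ¬ p ∣ n) :
    lam S Q n = 1 := by
  have h1 : ∀ P ∈ fam S Q, (-1 : ℝ) ^ P.card * ramProd P n / phi P = (phi P)⁻¹ := by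
    intro P hP
    have hr : ramProd P n = (-1) ^ P.card := by
      rw [ramProd, prod_congr rfl (g := fun _ => (-1:ℝ)), prod_const]
      intro p hp
      simp [ram, hn p (mem_powerset.1 (mem_filter.1 hP).1 hp)]
    rw [hr, ← mul_pow]
    simp
  rw [lam, sum_congr rfl h1, ← mass, inv_mul_cancel₀ (by linarith [one_le_mass hS hQ])]

lemma ram_sq (p n : ℕ) : ram p n * ram p n = ((p:ℝ) - 2) * ram p n + ((p:ℝ) - 1) := by
  unfold ram; split_ifs <;> ring

lemma ramProd_mul_ramProd (P P' : Finset ℕ) (n : ℕ) :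
    ramProd P n * ramProd P' n = ∑ R ∈ (P ∩ P').powerset,
      (∏ p ∈ R, ((p:ℝ) - 2)) * (∏ p ∈ (P ∩ P') \ R, ((p:ℝ) - 1)) *
        ramProd (R ∪ ((P \ P') ∪ (P' \ P))) n := by
  have h1 : ramProd P n = ramProd (P ∩ P') n * ramProd (P \ P') n := by
    rw [← ramProd_union (disjoint_sdiff_inter P P').symm, union_comm, sdiff_union_inter]
  have h2 : ramProd P' n = ramProd (P ∩ P') n * ramProd (P' \ P) n := by
    rw [inter_comm, ← ramProd_union (disjoint_sdiff_inter P' P).symm, union_comm,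
      sdiff_union_inter]
  have h3 : ramProd (P ∩ P') n * ramProd (P ∩ P') n = ∑ R ∈ (P ∩ P').powerset,
      (∏ p ∈ R, ((p:ℝ) - 2)) * (∏ p ∈ (P ∩ P') \ R, ((p:ℝ) - 1)) * ramProd R n := by
    rw [ramProd, ← prod_mul_distrib, prod_congr rfl fun p _ => ram_sq p n, prod_add]
    refine sum_congr rfl fun R _ => ?_
    rw [prod_mul_distrib, ramProd]
    ring
  calc _ = (ramProd (P ∩ P') n * ramProd (P ∩ P') n) * (ramProd (P \ P') n * ramProd (P' \ P) n) := by
        rw [h1, h2]; ring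
    _ = _ := by
      rw [h3, sum_mul]
      refine sum_congr rfl fun R hR => ?_
      have hR' := mem_powerset.1 hR
      have hd1 : Disjoint (P \ P') (P' \ P) := disjoint_sdiff_sdiff
      have hd2 : Disjoint R ((P \ P') ∪ (P' \ P)) := by
        rw [disjoint_left]
        intro p hp
        have := hR' hp
        simp only [mem_inter] at this
        simp [this.1, this.2]
      rw [ramProd_union hd2, ramProd_union hd1]
      ring

/-- Numerators allowed at the prime `p` for fractions with denominator the product of `T`. -/
def numer (S T : Finset ℕ) (p : S) : Finset ℕ := if (p:ℕ) ∈ T then Ioo 0 (p:ℕ) else {0}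

/-- The sum of Dirichlet kernels over shifted fractions with denominator the product of `T`. -/
noncomputable def shiftSum (S T : Finset ℕ) (L W : ℕ) (θ : ℝ) : ℝ :=
  ∑ z ∈ Fintype.piFinset (numer S T), ‖dir L (θ + W * ∑ p : S, (z p : ℝ) / (p:ℕ))‖

lemma shiftSum_nonneg (S T : Finset ℕ) (L W : ℕ) (θ : ℝ) : 0 ≤ shiftSum S T L W θ :=
  sum_nonneg fun _ _ => norm_nonneg _

lemma shiftSum_empty (S : Finset ℕ) (L W : ℕ) (θ : ℝ) : shiftSum S ∅ L W θ = ‖dir L θ‖ := by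
  have : Fintype.piFinset (numer S ∅) = {fun _ => 0} := by
    ext z; simp [numer, Fintype.mem_piFinset, funext_iff]
  simp [shiftSum, this]

lemma sum_e_Ioo {p : ℕ} (hp : 0 < p) (n : ℕ) :
    ∑ a ∈ Ioo 0 p, e ((a:ℝ) / p * n) = (ram p n : ℂ) := by
  have hpr : (p:ℝ) ≠ 0 := by exact_mod_cast hp.ne'
  have h1 : ∑ a ∈ range p, e ((a:ℝ) / p * n) = if p ∣ n then (p:ℂ) else 0 := by
    split_ifs with h
    · obtain ⟨m, rfl⟩ := h
      rw [sum_congr rfl (g := fun _ => (1:ℂ))]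
      · simp
      · intro a _
        have : (a:ℝ) / p * ((p * m : ℕ) : ℝ) = ((a * m : ℕ) : ℝ) := by
          push_cast; field_simp
        rw [this, e_nat]
    · have h2 := dir_mul_sub_one p ((n:ℝ) / p)
      have h3 : e ((n:ℝ) / p * p) = 1 := by rw [div_mul_cancel₀ _ hpr, e_nat]
      rw [h3, sub_self, mul_eq_zero] at h2
      rcases h2 with h2 | h2
      · rw [← h2, dir]
        refine sum_congr rfl fun a _ => ?_
        congr 1; ring
      · exfalso
        rw [sub_eq_zero, e_eq_one_iff] at h2
        obtain ⟨m, hm⟩ := h2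
        rw [div_eq_iff hpr] at hm
        apply h
        have hm' : (n:ℤ) = m * p := by exact_mod_cast hm
        exact_mod_cast (Dvd.intro_left m hm'.symm : (p:ℤ) ∣ n)
  have h4 : range p = insert 0 (Ioo 0 p) := by
    ext a; simp only [mem_range, mem_insert, mem_Ioo]; omega
  rw [h4, sum_insert (by simp)] at h1
  have h5 : ∑ a ∈ Ioo 0 p, e ((a:ℝ) / p * n) = (if p ∣ n then (p:ℂ) else 0) - 1 := by
    rw [← h1]; simp
  rw [h5, ram]
  split_ifs <;> push_cast <;> ring

lemma ramProd_eq_sum (hS : ∀ p ∈ S, p.Prime) {T : Finset ℕ} (hT : T ⊆ S) (n : ℕ) :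
    (ramProd T n : ℂ) =
      ∑ z ∈ Fintype.piFinset (numer S T), e ((∑ p : S, (z p : ℝ) / (p:ℕ)) * n) := by
  have h1 : ∀ z : S → ℕ, e ((∑ p : S, (z p : ℝ) / (p:ℕ)) * n) =
      ∏ p : S, e ((z p : ℝ) / (p:ℕ) * n) := fun z => by rw [sum_mul, e_sum]
  simp_rw [h1]
  rw [← prod_univ_sum (numer S T) fun p a => e ((a : ℝ) / (p:ℕ) * n)]
  have h2 : ∀ p : S, ∑ a ∈ numer S T p, e ((a : ℝ) / (p:ℕ) * n) =
      if (p:ℕ) ∈ T then (ram p n : ℂ) else 1 := by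
    intro p
    unfold numer
    split_ifs
    · exact sum_e_Ioo (hS p p.2).pos n
    · simp
  simp_rw [h2]
  rw [prod_coe_sort S fun p => if p ∈ T then (ram p n : ℂ) else 1, prod_ite_mem,
    inter_eq_right.2 hT, ramProd]
  push_cast
  rfl

lemma norm_sum_ramProd_le (hS : ∀ p ∈ S, p.Prime) {T : Finset ℕ} (hT : T ⊆ S) (L W b : ℕ)
    (θ : ℝ) :
    ‖∑ x ∈ range L, (ramProd T (W * x + b) : ℂ) * e (θ * x)‖ ≤ shiftSum S T L W θ := by
  have h1 : ∑ x ∈ range L, (ramProd T (W * x + b) : ℂ) * e (θ * x) =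
      ∑ z ∈ Fintype.piFinset (numer S T), e ((∑ p : S, (z p : ℝ) / (p:ℕ)) * b) *
        dir L (θ + W * ∑ p : S, (z p : ℝ) / (p:ℕ)) := by
    simp_rw [ramProd_eq_sum hS hT]
    rw [sum_congr rfl fun x _ => sum_mul _ _ _, sum_comm]
    refine sum_congr rfl fun z _ => ?_
    rw [dir, mul_sum]
    refine sum_congr rfl fun x _ => ?_
    rw [← e_add, ← e_add]
    congr 1
    generalize (∑ p : S, (z p : ℝ) / (p:ℕ)) = A
    push_cast
    ring
  rw [h1]
  refine (norm_sum_le _ _).trans (sum_le_sum fun z _ => ?_)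
  rw [norm_mul, norm_e, one_mul]

end

section

open Finset

variable {S : Finset ℕ} {Q : ℕ}

lemma prod_le_prod_of_subset_primes {P P' : Finset ℕ} (hP : ∀ p ∈ P', p.Prime) (h : P ⊆ P') :
    ∏ p ∈ P, p ≤ ∏ p ∈ P', p :=
  prod_le_prod_of_subset_of_one_le' h fun p hp _ => (hP p hp).one_le

lemma coeff_le {P P' R : Finset ℕ} (hP : ∀ p ∈ P, p.Prime) (hP' : ∀ p ∈ P', p.Prime)
    (hR : R ⊆ P ∩ P') :
    |(-1 : ℝ) ^ P.card / phi P * ((-1) ^ P'.card / phi P') *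
      ((∏ p ∈ R, ((p:ℝ) - 2)) * (∏ p ∈ (P ∩ P') \ R, ((p:ℝ) - 1)))| ≤
      (phi (R ∪ ((P \ P') ∪ (P' \ P))))⁻¹ * (phi ((P ∩ P') \ R))⁻¹ := by
  have hd1 : Disjoint (P \ P') (P' \ P) := disjoint_sdiff_sdiff
  have hd2 : Disjoint R ((P \ P') ∪ (P' \ P)) := by
    rw [disjoint_left]
    intro p hp
    have := hR hp
    simp only [mem_inter] at this
    simp [this.1, this.2]
  have hi : ∀ p ∈ P ∩ P', p.Prime := fun p hp => hP p (mem_inter.1 hp).1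
  have h1 : phi P = phi R * phi ((P ∩ P') \ R) * phi (P \ P') := by
    rw [← phi_union disjoint_sdiff, union_sdiff_of_subset hR,
      ← phi_union (disjoint_sdiff_inter P P').symm, union_comm, sdiff_union_inter]
  have h2 : phi P' = phi R * phi ((P ∩ P') \ R) * phi (P' \ P) := by
    rw [← phi_union disjoint_sdiff, union_sdiff_of_subset hR, inter_comm,
      ← phi_union (disjoint_sdiff_inter P' P).symm, union_comm, sdiff_union_inter]
  have hRp := phi_pos fun p hp => hi p (hR hp)
  have hBp := phi_pos (P := (P ∩ P') \ R) fun p hp => hi p (sdiff_subset hp)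
  have hUp := phi_pos (P := P \ P') fun p hp => hP p (sdiff_subset hp)
  have hVp := phi_pos (P := P' \ P) fun p hp => hP' p (sdiff_subset hp)
  have h3 : |∏ p ∈ R, ((p:ℝ) - 2)| ≤ phi R := by
    rw [abs_prod]
    refine prod_le_prod (fun _ _ => abs_nonneg _) fun p hp => ?_
    have : (2:ℝ) ≤ p := by exact_mod_cast (hi p (hR hp)).two_le
    rw [abs_of_nonneg (by linarith)]
    linarith
  rw [abs_mul, abs_mul, abs_mul, abs_div, abs_div, abs_pow, abs_pow, abs_neg, abs_one, one_pow,
    one_pow, abs_of_pos (phi_pos hP), abs_of_pos (phi_pos hP'), phi_union hd2, phi_union hd1]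
  change _ * _ * (_ * |phi ((P ∩ P') \ R)|) ≤ _
  rw [abs_of_pos hBp, h1, h2]
  generalize phi R = r at *
  generalize phi ((P ∩ P') \ R) = b at *
  generalize phi (P \ P') = u at *
  generalize phi (P' \ P) = v at *
  have : 1 / (r * b * u) * (1 / (r * b * v)) * (r * b) = (r * (u * v))⁻¹ * b⁻¹ := by
    field_simp
  rw [← this]
  gcongr

lemma norm_sum_lam_sq_le_sum (hS : ∀ p ∈ S, p.Prime) (hQ : 1 ≤ Q) (L W b : ℕ) (θ : ℝ) :
    ‖∑ x ∈ range L, ((lam S Q (W * x + b) ^ 2 : ℝ) : ℂ) * e (θ * x)‖ ≤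
      (mass S Q)⁻¹ * ∑ T ∈ fam S (Q ^ 2), 4 ^ T.card / phi T * shiftSum S T L W θ := by
  set H := mass S Q
  have hH : 1 ≤ H := one_le_mass hS hQ
  let c : Finset ℕ → Finset ℕ → Finset ℕ → ℝ := fun P P' R =>
    (-1 : ℝ) ^ P.card / phi P * ((-1) ^ P'.card / phi P') *
      ((∏ p ∈ R, ((p:ℝ) - 2)) * (∏ p ∈ (P ∩ P') \ R, ((p:ℝ) - 1)))
  let I : Finset (Σ _ : Finset ℕ × Finset ℕ, Finset ℕ) :=
    (fam S Q ×ˢ fam S Q).sigma fun PP => (PP.1 ∩ PP.2).powerset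
  let t : (Σ _ : Finset ℕ × Finset ℕ, Finset ℕ) → Finset ℕ := fun i =>
    i.2 ∪ ((i.1.1 \ i.1.2) ∪ (i.1.2 \ i.1.1))
  have hsq : ∀ n, lam S Q n ^ 2 = H⁻¹ ^ 2 * ∑ i ∈ I, c i.1.1 i.1.2 i.2 * ramProd (t i) n := by
    intro n
    rw [lam, mul_pow]
    congr 1
    rw [sum_sigma, sum_product, sq, sum_mul_sum]
    refine sum_congr rfl fun P _ => sum_congr rfl fun P' _ => ?_
    have h := ramProd_mul_ramProd P P' n
    calc _ = (-1 : ℝ) ^ P.card / phi P * ((-1) ^ P'.card / phi P') *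
          (ramProd P n * ramProd P' n) := by ring
      _ = _ := by
        rw [h, mul_sum]
        exact sum_congr rfl fun R _ => by simp only [c, t]; ring
  have hmem : ∀ i ∈ I, i.1.1 ∈ fam S Q ∧ i.1.2 ∈ fam S Q ∧ i.2 ⊆ i.1.1 ∩ i.1.2 := by
    intro i hi
    simpa only [I, mem_sigma, mem_product, mem_powerset, and_assoc] using hi
  have htS : ∀ i ∈ I, t i ⊆ i.1.1 ∪ i.1.2 := by
    intro i hi p hp
    have := (hmem i hi).2.2
    simp only [t, mem_union, mem_sdiff] at hp ⊢
    rcases hp with hp | hp | hp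
    · exact Or.inl (mem_inter.1 (this hp)).1
    · exact Or.inl hp.1
    · exact Or.inr hp.1
  have hUS : ∀ i ∈ I, i.1.1 ∪ i.1.2 ⊆ S := fun i hi => union_subset
    (mem_powerset.1 (mem_filter.1 (hmem i hi).1).1)
    (mem_powerset.1 (mem_filter.1 (hmem i hi).2.1).1)
  have htF : ∀ i ∈ I, t i ∈ fam S (Q ^ 2) := by
    intro i hi
    refine mem_filter.2 ⟨mem_powerset.2 ((htS i hi).trans (hUS i hi)), ?_⟩
    refine (prod_le_prod_of_subset_primes (fun p hp => hS p (hUS i hi hp)) (htS i hi)).trans ?_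
    have h0 : ∏ p ∈ i.1.1 ∪ i.1.2, p ≤ (∏ p ∈ i.1.1, p) * ∏ p ∈ i.1.2, p := by
      rw [← prod_union_inter]
      refine le_mul_of_one_le_right (Nat.zero_le _) (one_le_prod' fun p hp => ?_)
      exact (hS p (hUS i hi (mem_union_left _ (mem_inter.1 hp).1))).one_le
    rw [sq]
    exact h0.trans (Nat.mul_le_mul (mem_filter.1 (hmem i hi).1).2 (mem_filter.1 (hmem i hi).2.1).2)
  have hmain : ‖∑ x ∈ range L, ((lam S Q (W * x + b) ^ 2 : ℝ) : ℂ) * e (θ * x)‖ ≤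
      H⁻¹ ^ 2 * ∑ i ∈ I, (phi (t i))⁻¹ * (phi ((i.1.1 ∩ i.1.2) \ i.2))⁻¹ *
        shiftSum S (t i) L W θ := by
    have h1 : ∑ x ∈ range L, ((lam S Q (W * x + b) ^ 2 : ℝ) : ℂ) * e (θ * x) =
        ((H⁻¹ ^ 2 : ℝ) : ℂ) * ∑ i ∈ I, (c i.1.1 i.1.2 i.2 : ℂ) *
          ∑ x ∈ range L, (ramProd (t i) (W * x + b) : ℂ) * e (θ * x) := by
      simp_rw [hsq]
      push_cast
      simp_rw [mul_sum, sum_mul]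
      rw [sum_comm]
      refine sum_congr rfl fun i _ => sum_congr rfl fun x _ => ?_
      ring
    rw [h1, norm_mul, Complex.norm_real, Real.norm_of_nonneg (by positivity)]
    gcongr
    refine (norm_sum_le _ _).trans (sum_le_sum fun i hi => ?_)
    rw [norm_mul, Complex.norm_real, Real.norm_eq_abs]
    have hc := coeff_le (prime_of_mem_fam hS (hmem i hi).1) (prime_of_mem_fam hS (hmem i hi).2.1)
      (hmem i hi).2.2
    refine mul_le_mul hc (norm_sum_ramProd_le hS ((htS i hi).trans (hUS i hi)) L W b θ)
      (norm_nonneg _) ((abs_nonneg _).trans hc)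
  have hre : ∑ i ∈ I, (phi (t i))⁻¹ * (phi ((i.1.1 ∩ i.1.2) \ i.2))⁻¹ *
        shiftSum S (t i) L W θ ≤
      ∑ T ∈ fam S (Q ^ 2), ∑ B ∈ fam S Q, ∑ _U ∈ T.powerset, ∑ _V ∈ T.powerset,
        (phi T)⁻¹ * (phi B)⁻¹ * shiftSum S T L W θ := by
    let K : Finset (Σ _ : Finset ℕ, Finset ℕ × Finset ℕ × Finset ℕ) :=
      (fam S (Q ^ 2)).sigma fun T => fam S Q ×ˢ T.powerset ×ˢ T.powerset
    let f : (Σ _ : Finset ℕ × Finset ℕ, Finset ℕ) → (Σ _ : Finset ℕ, Finset ℕ × Finset ℕ × Finset ℕ) :=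
      fun i => ⟨t i, (i.1.1 ∩ i.1.2) \ i.2, i.1.1 \ i.1.2, i.1.2 \ i.1.1⟩
    let g : (Σ _ : Finset ℕ, Finset ℕ × Finset ℕ × Finset ℕ) → ℝ := fun k =>
      (phi k.1)⁻¹ * (phi k.2.1)⁻¹ * shiftSum S k.1 L W θ
    have hK : ∑ k ∈ K, g k = ∑ T ∈ fam S (Q ^ 2), ∑ B ∈ fam S Q, ∑ _U ∈ T.powerset,
        ∑ _V ∈ T.powerset, (phi T)⁻¹ * (phi B)⁻¹ * shiftSum S T L W θ := by
      rw [sum_sigma]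
      refine sum_congr rfl fun T _ => ?_
      rw [sum_product]
      refine sum_congr rfl fun B _ => ?_
      rw [sum_product]
    rw [← hK]
    have hinj : Set.InjOn f I := by
      intro i hi j hj hij
      have hi' := (hmem i hi).2.2
      have hj' := (hmem j hj).2.2
      have hrec : ∀ i ∈ I, i = ⟨((i.1.1 \ i.1.2) ∪ (((i.1.1 ∩ i.1.2) \ i.2) ∪
          (t i \ ((i.1.1 \ i.1.2) ∪ (i.1.2 \ i.1.1)))), (i.1.2 \ i.1.1) ∪
          (((i.1.1 ∩ i.1.2) \ i.2) ∪ (t i \ ((i.1.1 \ i.1.2) ∪ (i.1.2 \ i.1.1))))),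
          t i \ ((i.1.1 \ i.1.2) ∪ (i.1.2 \ i.1.1))⟩ := by
        rintro ⟨⟨P, P'⟩, R⟩ hi
        have hR := (hmem _ hi).2.2
        have hR' : ∀ p ∈ R, p ∈ P ∧ p ∈ P' := fun p hp => mem_inter.1 (hR hp)
        have e3 : t ⟨⟨P, P'⟩, R⟩ \ ((P \ P') ∪ (P' \ P)) = R := by
          ext p
          have := hR' p
          simp only [t, mem_sdiff, mem_union]
          tauto
        simp only [e3]
        have e1 : (P \ P') ∪ (((P ∩ P') \ R) ∪ R) = P := by
          ext p
          have := hR' p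
          simp only [mem_sdiff, mem_union, mem_inter]
          tauto
        have e2 : (P' \ P) ∪ (((P ∩ P') \ R) ∪ R) = P' := by
          ext p
          have := hR' p
          simp only [mem_sdiff, mem_union, mem_inter]
          tauto
        rw [e1, e2]
      rw [hrec i hi, hrec j hj]
      have a1 : t i = t j := congrArg Sigma.fst hij
      have a2 : ((i.1.1 ∩ i.1.2) \ i.2, i.1.1 \ i.1.2, i.1.2 \ i.1.1) =
          ((j.1.1 ∩ j.1.2) \ j.2, j.1.1 \ j.1.2, j.1.2 \ j.1.1) :=
        eq_of_heq (Sigma.mk.inj_iff.1 hij).2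
      simp only [Prod.mk.injEq] at a2
      rw [a1, a2.1, a2.2.1, a2.2.2]
    have himg : I.image f ⊆ K := by
      intro k hk
      obtain ⟨i, hi, rfl⟩ := mem_image.1 hk
      simp only [K, f, mem_sigma, mem_product, mem_powerset]
      refine ⟨htF i hi, ?_, ?_, ?_⟩
      · have hP := mem_filter.1 (hmem i hi).1
        have hsub : (i.1.1 ∩ i.1.2) \ i.2 ⊆ i.1.1 := sdiff_subset.trans inter_subset_left
        exact mem_filter.2 ⟨mem_powerset.2 (hsub.trans (mem_powerset.1 hP.1)),
          (prod_le_prod_of_subset_primes (prime_of_mem_fam hS (hmem i hi).1) hsub).trans hP.2⟩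
      · exact subset_union_left.trans subset_union_right
      · exact subset_union_right.trans subset_union_right
    have hg : ∀ k ∈ K, 0 ≤ g k := by
      rintro ⟨T, B, U, V⟩ hk
      simp only [K, mem_sigma, mem_product] at hk
      have h1 := phi_pos (prime_of_mem_fam hS hk.1)
      have h2 := phi_pos (prime_of_mem_fam hS hk.2.1)
      have h3 := shiftSum_nonneg S T L W θ
      simp only [g]
      positivity
    calc _ = ∑ k ∈ I.image f, g k := by rw [sum_image hinj]
      _ ≤ _ := sum_le_sum_of_subset_of_nonneg himg fun k hk _ => hg k hk
  refine hmain.trans ?_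
  have hfin : ∑ T ∈ fam S (Q ^ 2), ∑ B ∈ fam S Q, ∑ _U ∈ T.powerset, ∑ _V ∈ T.powerset,
        (phi T)⁻¹ * (phi B)⁻¹ * shiftSum S T L W θ =
      H * ∑ T ∈ fam S (Q ^ 2), 4 ^ T.card / phi T * shiftSum S T L W θ := by
    rw [mul_sum]
    refine sum_congr rfl fun T _ => ?_
    simp only [sum_const, card_powerset, nsmul_eq_mul, H, mass, sum_mul]
    refine sum_congr rfl fun B _ => ?_
    have : (4:ℝ) ^ T.card = 2 ^ T.card * 2 ^ T.card := by rw [← mul_pow]; norm_num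
    rw [this]
    push_cast
    ring
  calc _ ≤ H⁻¹ ^ 2 * (H * ∑ T ∈ fam S (Q ^ 2), 4 ^ T.card / phi T * shiftSum S T L W θ) := by
        rw [← hfin]; gcongr
    _ = _ := by field_simp

end

section

open Finset

variable {S : Finset ℕ} {Q : ℕ}

lemma fract_sub_fract_ge {V : Finset ℕ} (hS : ∀ p ∈ S, p.Prime) (hV : V ⊆ S) {W : ℕ}
    (hW : ∀ p ∈ S, ¬ p ∣ W) (d : S → ℤ) (hd0 : ∀ p : S, (p:ℕ) ∉ V → d p = 0)
    (hd : ∀ p : S, |d p| < (p:ℕ)) (p₀ : S) (hp₀ : d p₀ ≠ 0) {y y' : ℝ}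
    (hy : y - y' = W * ∑ p : S, (d p : ℝ) / (p:ℕ)) :
    1 / ((∏ p ∈ V, p : ℕ) : ℝ) ≤ |Int.fract y - Int.fract y'| := by
  set N := ∏ p ∈ V, p with hN
  have hNpos : 0 < N := prod_pos fun p hp => (hS p (hV hp)).pos
  have hNr : (0:ℝ) < N := by exact_mod_cast hNpos
  have hp₀V : (p₀:ℕ) ∈ V := by
    by_contra h
    exact hp₀ (hd0 p₀ h)
  set m : ℤ := W * ∑ p : S, d p * (∏ q ∈ V.erase (p:ℕ), q : ℕ) with hm
  have h1 : (N:ℝ) * (y - y') = m := by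
    rw [hy, hm]
    push_cast
    rw [mul_left_comm, mul_sum]
    congr 1
    refine sum_congr rfl fun p _ => ?_
    by_cases hp : (p:ℕ) ∈ V
    · have h2 : (N:ℝ) = (p:ℕ) * ∏ q ∈ V.erase (p:ℕ), (q:ℝ) := by
        rw [hN, Nat.cast_prod, mul_prod_erase V (fun q => (q:ℝ)) hp]
      have h3 : ((p:ℕ):ℝ) ≠ 0 := by exact_mod_cast (hS p p.2).ne_zero
      rw [h2]
      field_simp
    · simp [hd0 p hp]
  have hpp := (hS p₀ p₀.2)
  have hndvd : ¬ ((p₀:ℕ):ℤ) ∣ m := by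
    intro hdiv
    have hpI : Prime ((p₀:ℕ):ℤ) := Nat.prime_iff_prime_int.1 hpp
    rcases hpI.dvd_or_dvd hdiv with h | h
    · exact hW p₀ p₀.2 (by exact_mod_cast h)
    · rw [← add_sum_erase _ _ (mem_univ p₀)] at h
      have h4 : ((p₀:ℕ):ℤ) ∣ ∑ p ∈ univ.erase p₀, d p * (∏ q ∈ V.erase (p:ℕ), q : ℕ) := by
        refine dvd_sum fun p hp => Dvd.dvd.mul_left ?_ _
        have : (p₀:ℕ) ∈ V.erase (p:ℕ) := by
          refine mem_erase.2 ⟨fun h => (mem_erase.1 hp).1 (Subtype.ext h.symm), hp₀V⟩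
        exact_mod_cast dvd_prod_of_mem (fun q => q) this
      rw [Int.dvd_add_left h4] at h
      rcases hpI.dvd_or_dvd h with h | h
      · exact hp₀ (Int.eq_zero_of_abs_lt_dvd h (hd p₀))
      · have h5 : (p₀:ℕ) ∣ ∏ q ∈ V.erase (p₀:ℕ), q := by exact_mod_cast h
        rw [hpp.prime.dvd_finsetProd_iff] at h5
        obtain ⟨q, hq, hqd⟩ := h5
        have hqV := mem_erase.1 hq
        exact hqV.1 ((Nat.prime_dvd_prime_iff_eq hpp (hS q (hV hqV.2))).1 hqd).symm
  have h6 : (N:ℝ) * (Int.fract y - Int.fract y') = (m - N * (⌊y⌋ - ⌊y'⌋) : ℤ) := by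
    push_cast
    rw [← h1]
    simp only [Int.fract]
    ring
  have h7 : m - N * (⌊y⌋ - ⌊y'⌋) ≠ 0 := by
    intro h
    apply hndvd
    have h8 : m = N * (⌊y⌋ - ⌊y'⌋) := by linarith
    rw [h8]
    refine Dvd.dvd.mul_right ?_ _
    exact_mod_cast dvd_prod_of_mem (fun q => q) hp₀V
  have h9 : (1:ℝ) ≤ |((m - N * (⌊y⌋ - ⌊y'⌋) : ℤ) : ℝ)| := by
    exact_mod_cast Int.one_le_abs h7
  rw [← h6, abs_mul, abs_of_pos hNr] at h9
  rw [div_le_iff₀ hNr]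
  linarith

lemma sum_shiftSum_le (hS : ∀ p ∈ S, p.Prime) {W : ℕ} (hW : ∀ p ∈ S, ¬ p ∣ W) (L : ℕ) (θ : ℝ)
    {s : ℕ} (hs : 0 < s) :
    ∑ T ∈ fam S s, shiftSum S T L W θ ≤
      2 * L + (s ^ 2 : ℕ) * (1 + Real.log (s ^ 2 : ℕ)) := by
  let X : Finset (Σ _ : Finset ℕ, S → ℕ) :=
    (fam S s).sigma fun T => Fintype.piFinset (numer S T)
  let y : (Σ _ : Finset ℕ, S → ℕ) → ℝ := fun i => θ + W * ∑ p : S, (i.2 p : ℝ) / (p:ℕ)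
  have h1 : ∑ T ∈ fam S s, shiftSum S T L W θ = ∑ i ∈ X, ‖dir L (y i)‖ := by
    rw [sum_sigma]; rfl
  rw [h1]
  refine sum_norm_dir_le X y L (s ^ 2) (by positivity) ?_
  rintro ⟨T, z⟩ hi ⟨T', z'⟩ hj hij
  simp only [X, mem_sigma, Fintype.mem_piFinset, numer] at hi hj
  have hT := mem_filter.1 hi.1
  have hT' := mem_filter.1 hj.1
  have hTS := mem_powerset.1 hT.1
  have hTS' := mem_powerset.1 hT'.1
  have hmem : ∀ {T : Finset ℕ} {z : S → ℕ},
      (∀ p : S, z p ∈ if (p:ℕ) ∈ T then Ioo 0 (p:ℕ) else {0}) →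
      ∀ p : S, ((p:ℕ) ∈ T ↔ z p ≠ 0) ∧ z p < (p:ℕ) := by
    intro T z h p
    have := h p
    split_ifs at this with hp
    · rw [mem_Ioo] at this
      exact ⟨⟨fun _ => by omega, fun _ => hp⟩, this.2⟩
    · rw [mem_singleton] at this
      exact ⟨⟨fun h => absurd h hp, fun h => absurd this h⟩, by rw [this]; exact (hS p p.2).pos⟩
  have hz := hmem hi.2
  have hz' := hmem hj.2
  have hne : ∃ p, z p ≠ z' p := by
    by_contra! h
    have hzz : z = z' := funext h
    subst hzz
    apply hij
    have : T = T' := by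
      ext p
      constructor
      · intro hp
        exact (hz' ⟨p, hTS hp⟩).1.2 ((hz ⟨p, hTS hp⟩).1.1 hp)
      · intro hp
        exact (hz ⟨p, hTS' hp⟩).1.2 ((hz' ⟨p, hTS' hp⟩).1.1 hp)
    rw [this]
  obtain ⟨p₀, hp₀⟩ := hne
  have h2 := fract_sub_fract_ge hS (V := T ∪ T') (union_subset hTS hTS') hW
    (fun p => (z p : ℤ) - z' p) (fun p hp => by
      have a1 : z p = 0 := by
        by_contra h
        exact hp (mem_union_left _ ((hz p).1.2 h))
      have a2 : z' p = 0 := by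
        by_contra h
        exact hp (mem_union_right _ ((hz' p).1.2 h))
      simp [a1, a2])
    (fun p => by
      have a1 := (hz p).2
      have a2 := (hz' p).2
      rw [abs_lt]
      constructor <;> omega) p₀ (by
        simpa [sub_eq_zero] using hp₀) (y := y ⟨T, z⟩) (y' := y ⟨T', z'⟩) (by
        simp only [y]
        push_cast
        simp_rw [sub_div, sum_sub_distrib]
        ring)
  refine le_trans ?_ h2
  have hpos : 0 < ∏ p ∈ T ∪ T', p :=
    prod_pos fun p hp => (hS p (union_subset hTS hTS' hp)).pos
  have hle : ∏ p ∈ T ∪ T', p ≤ s ^ 2 := by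
    have h0 : ∏ p ∈ T ∪ T', p ≤ (∏ p ∈ T, p) * ∏ p ∈ T', p := by
      rw [← prod_union_inter]
      refine le_mul_of_one_le_right (Nat.zero_le _) (one_le_prod' fun p hp => ?_)
      exact (hS p (hTS (mem_inter.1 hp).1)).one_le
    rw [sq]
    exact h0.trans (Nat.mul_le_mul hT.2 hT'.2)
  exact one_div_le_one_div_of_le (by exact_mod_cast hpos) (by exact_mod_cast hle)

/-- Partial summation: a weighted sum with decreasing weights is controlled by a quadratic bound for
the counting sums. -/
lemma sum_antitone_mul_le {ι : Type*} (s : Finset ι) (N : ι → ℕ) (a : ι → ℝ) {f : ℕ → ℝ}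
    (hf : Antitone f) {c Λ : ℝ} (D : ℕ)
    (hF : ∀ i ≤ D, ∑ T ∈ s.filter (fun T => N T ≤ i), a T ≤ c + Λ * i ^ 2) :
    ∑ T ∈ s.filter (fun T => N T ≤ D), f (N T) * a T ≤
      f D * (∑ T ∈ s.filter (fun T => N T ≤ D), a T - c - Λ * D ^ 2) + c * f 0 +
        Λ * ∑ t ∈ range D, f (t + 1) * (2 * t + 1) := by
  classical
  have hsplit : ∀ D (g : ι → ℝ), ∑ T ∈ s.filter (fun T => N T ≤ D + 1), g T =
      ∑ T ∈ s.filter (fun T => N T ≤ D), g T + ∑ T ∈ s.filter (fun T => N T = D + 1), g T := by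
    intro D g
    rw [← sum_union]
    · congr 1
      ext T
      simp only [mem_filter, mem_union, ← and_or_left]
      refine and_congr_right fun _ => by omega
    · rw [disjoint_filter]; intros; omega
  induction D with
  | zero =>
    have : ∑ T ∈ s.filter (fun T => N T ≤ 0), f (N T) * a T =
        f 0 * ∑ T ∈ s.filter (fun T => N T ≤ 0), a T := by
      rw [mul_sum]
      refine sum_congr rfl fun T hT => ?_
      rw [Nat.le_zero.1 (mem_filter.1 hT).2]
    rw [this]
    simp
    linarith
  | succ D ih =>
    have ih' := ih fun i hi => hF i (by omega)
    have h0 := hF D (by omega)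
    rw [hsplit D, hsplit D, sum_range_succ]
    have h1 : ∑ T ∈ s.filter (fun T => N T = D + 1), f (N T) * a T =
        f (D + 1) * ∑ T ∈ s.filter (fun T => N T = D + 1), a T := by
      rw [mul_sum]
      refine sum_congr rfl fun T hT => ?_
      rw [(mem_filter.1 hT).2]
    rw [h1]
    have h2 : f (D + 1) ≤ f D := hf (Nat.le_succ D)
    push_cast
    nlinarith [mul_nonneg (sub_nonneg.2 h2) (sub_nonneg.2 h0)]

end

/-! ### The sieve majorant for primes in an interval -/

section

open Finset

/-- The primes in `(w, Q]`. -/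
def sievePrimes (w Q : ℕ) : Finset ℕ := (Ioc w Q).filter Nat.Prime

lemma prime_of_mem_sievePrimes {w Q p : ℕ} (hp : p ∈ sievePrimes w Q) : p.Prime :=
  (mem_filter.1 hp).2

lemma lt_of_mem_sievePrimes {w Q p : ℕ} (hp : p ∈ sievePrimes w Q) : w < p :=
  (mem_Ioc.1 (mem_filter.1 hp).1).1

lemma four_div_le_rpow {p : ℕ} (hp : 5 ^ 10 ≤ p) : 4 / ((p:ℝ) - 1) ≤ (p:ℝ) ^ (-(9/10) : ℝ) := by
  have hp' : ((5:ℝ) ^ 10) ≤ p := by exact_mod_cast hp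
  have hpos : (0:ℝ) < p := by linarith [show (0:ℝ) < 5 ^ 10 by norm_num]
  have h1 : (5:ℝ) ≤ (p:ℝ) ^ (1/10 : ℝ) := by
    calc (5:ℝ) = ((5:ℝ) ^ 10) ^ (1/10 : ℝ) := by
          rw [← Real.rpow_natCast, ← Real.rpow_mul (by norm_num)]; norm_num
      _ ≤ _ := Real.rpow_le_rpow (by norm_num) hp' (by norm_num)
  have h2 : (p:ℝ) ^ (-(9/10) : ℝ) * p = (p:ℝ) ^ (1/10 : ℝ) := by
    rw [← Real.rpow_add_one hpos.ne']; norm_num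
  have h3 : (p:ℝ) ^ (-(9/10) : ℝ) = (p:ℝ) ^ (1/10 : ℝ) / p := by
    rw [← h2]; field_simp
  rw [h3, div_le_div_iff₀ (by linarith [show (2:ℝ) < 5 ^ 10 by norm_num]) hpos]
  nlinarith [show (10:ℝ) < 5 ^ 10 by norm_num]

lemma sum_shiftSum_weighted_le {w Q L W : ℕ} (hw : 5 ^ 10 ≤ w) (hQ : 1 ≤ Q)
    (hW : ∀ p ∈ sievePrimes w Q, ¬ p ∣ W) (θ : ℝ) :
    ∑ T ∈ fam (sievePrimes w Q) (Q ^ 2),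
        4 ^ T.card / phi T * shiftSum (sievePrimes w Q) T L W θ ≤
      ‖dir L θ‖ + 2 * L * (w:ℝ) ^ (-(9/10) : ℝ) +
        2 * (1 + 4 * Real.log Q) * (Q:ℝ) ^ (11/5 : ℝ) := by
  set S := sievePrimes w Q
  have hS : ∀ p ∈ S, p.Prime := fun p hp => prime_of_mem_sievePrimes hp
  set D := Q ^ 2 with hD
  have hD1 : 1 ≤ D := Nat.one_le_pow _ _ hQ
  have hlogD : Real.log (D ^ 2 : ℕ) = 4 * Real.log Q := by
    rw [hD, ← pow_mul, Nat.cast_pow, Real.log_pow]; norm_num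
  rw [← add_sum_erase _ _ (empty_mem_fam hD1)]
  have h0 : (4:ℝ) ^ (∅ : Finset ℕ).card / phi ∅ * shiftSum S ∅ L W θ = ‖dir L θ‖ := by
    simp [phi, shiftSum_empty]
  rw [h0, add_assoc]
  gcongr
  let f : ℕ → ℝ := fun t => ((max t w : ℕ) : ℝ) ^ (-(9/10) : ℝ)
  have hwpos : 0 < w := lt_of_lt_of_le (by norm_num) hw
  have hmaxpos : ∀ t, (0:ℝ) < ((max t w : ℕ) : ℝ) := fun t => by
    exact_mod_cast lt_of_lt_of_le hwpos (le_max_right t w)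
  have hf : Antitone f := fun s t hst =>
    Real.rpow_le_rpow_of_nonpos (hmaxpos s) (by exact_mod_cast max_le_max_right w hst)
      (by norm_num)
  have hf0 : f 0 = (w:ℝ) ^ (-(9/10) : ℝ) := by simp [f]
  have hfnn : ∀ t, 0 ≤ f t := fun t => (Real.rpow_pos_of_pos (hmaxpos t) _).le
  have hmem : ∀ T ∈ (fam S D).erase ∅, T ≠ ∅ ∧ T ⊆ S ∧ ∏ p ∈ T, p ≤ D := by
    intro T hT
    rw [mem_erase] at hT
    have := mem_filter.1 hT.2
    exact ⟨hT.1, mem_powerset.1 this.1, this.2⟩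
  have hweight : ∀ T ∈ (fam S D).erase ∅, (4:ℝ) ^ T.card / phi T ≤ f (∏ p ∈ T, p) := by
    intro T hT
    obtain ⟨hne, hTS, hTD⟩ := hmem T hT
    have hle : ∀ p ∈ T, w ≤ p := fun p hp => (lt_of_mem_sievePrimes (hTS hp)).le
    have hwT : w ≤ ∏ p ∈ T, p := by
      obtain ⟨p, hp⟩ := nonempty_iff_ne_empty.2 hne
      exact (hle p hp).trans (Nat.le_of_dvd (prod_pos fun q hq => (hS q (hTS hq)).pos)
        (dvd_prod_of_mem (fun q => q) hp))
    simp only [f, max_eq_left hwT]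
    rw [phi, ← prod_const, ← prod_div_distrib, Nat.cast_prod,
      ← Real.finsetProd_rpow _ _ fun p _ => Nat.cast_nonneg p]
    refine prod_le_prod (fun p hp => ?_) fun p hp => four_div_le_rpow (hw.trans (hle p hp))
    have : (2:ℝ) ≤ p := by exact_mod_cast (hS p (hTS hp)).two_le
    exact div_nonneg (by norm_num) (by linarith)
  set Λ : ℝ := 1 + 4 * Real.log Q with hΛ
  have hlogQ : 0 ≤ Real.log Q := Real.log_natCast_nonneg Q
  have hΛ0 : 0 ≤ Λ := by positivity
  have hF : ∀ i ≤ D, ∑ T ∈ ((fam S D).erase ∅).filter (fun T => ∏ p ∈ T, p ≤ i),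
      shiftSum S T L W θ ≤ 2 * L + Λ * i ^ 2 := by
    intro i hi
    rcases Nat.eq_zero_or_pos i with rfl | hi0
    · rw [filter_false_of_mem]
      · simp
      · intro T hT
        have := prod_pos fun p hp => (hS p ((hmem T hT).2.1 hp)).pos
        omega
    · have h1 := sum_shiftSum_le hS hW L θ hi0
      have h2 : Real.log (i ^ 2 : ℕ) ≤ 4 * Real.log Q := by
        rw [← hlogD]
        exact Real.log_le_log (by positivity) (by exact_mod_cast Nat.pow_le_pow_left hi 2)
      calc _ ≤ ∑ T ∈ fam S i, shiftSum S T L W θ := by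
            refine sum_le_sum_of_subset_of_nonneg (fun T hT => ?_)
              fun T _ _ => shiftSum_nonneg S T L W θ
            rw [mem_filter] at hT
            exact mem_filter.2 ⟨mem_powerset.2 (hmem T hT.1).2.1, hT.2⟩
        _ ≤ 2 * L + (i ^ 2 : ℕ) * (1 + Real.log (i ^ 2 : ℕ)) := h1
        _ ≤ 2 * L + (i ^ 2 : ℕ) * Λ := by rw [hΛ]; gcongr
        _ = _ := by push_cast; ring
  have hab := sum_antitone_mul_le ((fam S D).erase ∅) (fun T => ∏ p ∈ T, p)
    (fun T => shiftSum S T L W θ) hf D hF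
  have hfull : ((fam S D).erase ∅).filter (fun T => ∏ p ∈ T, p ≤ D) = (fam S D).erase ∅ :=
    filter_true_of_mem fun T hT => (hmem T hT).2.2
  have hFD := hF D le_rfl
  rw [hfull] at hab hFD
  have hsum : ∑ t ∈ range D, f (t + 1) * (2 * t + 1) ≤ 2 * (Q:ℝ) ^ (11/5 : ℝ) := by
    have hterm : ∀ t ∈ range D, f (t + 1) * (2 * t + 1) ≤ 2 * (D:ℝ) ^ (1/10 : ℝ) := by
      intro t ht
      have ht0 : (0:ℝ) < (t:ℝ) + 1 := by positivity
      have h1 : f (t + 1) ≤ ((t:ℝ) + 1) ^ (-(9/10) : ℝ) := by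
        refine Real.rpow_le_rpow_of_nonpos ht0 ?_ (by norm_num)
        exact_mod_cast le_max_left (t + 1) w
      have h2 : ((t:ℝ) + 1) ^ (-(9/10) : ℝ) * (t + 1) = ((t:ℝ) + 1) ^ (1/10 : ℝ) := by
        rw [← Real.rpow_add_one ht0.ne']; norm_num
      have h3 : ((t:ℝ) + 1) ^ (1/10 : ℝ) ≤ (D:ℝ) ^ (1/10 : ℝ) := by
        refine Real.rpow_le_rpow ht0.le ?_ (by norm_num)
        exact_mod_cast mem_range.1 ht
      calc f (t + 1) * (2 * t + 1) ≤ ((t:ℝ) + 1) ^ (-(9/10) : ℝ) * (2 * (t + 1)) := by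
            gcongr; linarith
        _ = 2 * ((t:ℝ) + 1) ^ (1/10 : ℝ) := by rw [← h2]; ring
        _ ≤ _ := by gcongr
    refine (sum_le_sum hterm).trans (le_of_eq ?_)
    rw [sum_const, card_range, nsmul_eq_mul]
    have hQ0 : (0:ℝ) < Q := by exact_mod_cast hQ
    have h4 : (D:ℝ) = (Q:ℝ) ^ (2:ℝ) := by rw [hD]; norm_num
    rw [h4, ← Real.rpow_mul hQ0.le, mul_left_comm, ← Real.rpow_add hQ0]
    norm_num
  calc _ ≤ ∑ T ∈ (fam S D).erase ∅, f (∏ p ∈ T, p) * shiftSum S T L W θ :=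
        sum_le_sum fun T hT => mul_le_mul_of_nonneg_right (hweight T hT)
          (shiftSum_nonneg S T L W θ)
    _ ≤ _ := hab
    _ ≤ 0 + 2 * L * f 0 + Λ * (2 * (Q:ℝ) ^ (11/5 : ℝ)) := by
        gcongr
        exact mul_nonpos_of_nonneg_of_nonpos (hfnn D) (by linarith)
    _ = _ := by rw [hf0]; ring

/-- Exponential sums of the squared sieve weight along an arithmetic progression. -/
lemma norm_sum_lam_sq_le {w Q W : ℕ} (hw : 5 ^ 10 ≤ w) (hQ : 1 ≤ Q)
    (hW : ∀ p ∈ sievePrimes w Q, ¬ p ∣ W) (L b : ℕ) (θ : ℝ) :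
    ‖∑ x ∈ range L, ((lam (sievePrimes w Q) Q (W * x + b) ^ 2 : ℝ) : ℂ) * e (θ * x)‖ ≤
      (mass (sievePrimes w Q) Q)⁻¹ * (‖dir L θ‖ + 2 * L * (w:ℝ) ^ (-(9/10) : ℝ) +
        2 * (1 + 4 * Real.log Q) * (Q:ℝ) ^ (11/5 : ℝ)) := by
  have hS : ∀ p ∈ sievePrimes w Q, p.Prime := fun p hp => prime_of_mem_sievePrimes hp
  refine (norm_sum_lam_sq_le_sum hS hQ L W b θ).trans ?_
  have := one_le_mass hS hQ
  gcongr
  exact sum_shiftSum_weighted_le hw hQ hW θ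

/-- The reciprocal of the natural number, as a multiplicative map. -/
noncomputable def invHom : ℕ →* ℝ where
  toFun n := (n:ℝ)⁻¹
  map_one' := by simp
  map_mul' m n := by push_cast; exact mul_inv _ _

lemma sum_inv_image_le (X s : Finset ℕ) (hX : ∀ m ∈ X, m ∈ Nat.factoredNumbers s) :
    ∑ m ∈ X, (m:ℝ)⁻¹ ≤ ∏ p ∈ s.filter Nat.Prime, (1 - (p:ℝ)⁻¹)⁻¹ := by
  have h := (EulerProduct.summable_and_hasSum_factoredNumbers_prod_filter_prime_geometric
    (f := invHom) (fun {p} hp => by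
      change ‖(p:ℝ)⁻¹‖ < 1
      rw [norm_inv, Real.norm_natCast]
      exact inv_lt_one_of_one_lt₀ (by exact_mod_cast hp.one_lt)) s).2
  have h' := (hasSum_subtype_iff_indicator (f := fun m : ℕ => (m:ℝ)⁻¹)).1 h
  refine le_trans (le_of_eq ?_) (sum_le_hasSum X (fun m _ => ?_) h')
  · exact sum_congr rfl fun m hm => by
      rw [Set.indicator_of_mem (hX m hm)]
  · exact Set.indicator_nonneg (fun _ _ => by positivity) m

lemma log_mul_prod_le_mass (w Q : ℕ) :
    Real.log Q * ∏ p ∈ (Ioc 0 w).filter Nat.Prime, (1 - (p:ℝ)⁻¹) ≤ mass (sievePrimes w Q) Q := by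
  set S := sievePrimes w Q
  set E := ∏ p ∈ (Ioc 0 w).filter Nat.Prime, (1 - (p:ℝ)⁻¹) with hE
  have hEpos : 0 < E := prod_pos fun p hp => by
    have : (p:ℝ)⁻¹ < 1 := inv_lt_one_of_one_lt₀ (by exact_mod_cast (mem_filter.1 hp).2.one_lt)
    linarith
  let P : ℕ → Finset ℕ := fun n => n.primeFactors.filter (w < ·)
  have hmaps : ∀ n ∈ Ioc 0 Q, P n ∈ fam S Q := by
    intro n hn
    rw [mem_Ioc] at hn
    have hsub : P n ⊆ n.primeFactors := filter_subset _ _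
    refine mem_filter.2 ⟨mem_powerset.2 fun p hp => ?_, ?_⟩
    · have hp' := mem_filter.1 hp
      have hpr := Nat.prime_of_mem_primeFactors hp'.1
      refine mem_filter.2 ⟨mem_Ioc.2 ⟨hp'.2, ?_⟩, hpr⟩
      exact (Nat.le_of_mem_primeFactors hp'.1).trans hn.2
    · exact (prod_le_prod_of_subset_primes (fun p hp => Nat.prime_of_mem_primeFactors hp)
        hsub).trans ((Nat.le_of_dvd hn.1 (Nat.prod_primeFactors_dvd n)).trans hn.2)
  have hfib : ∀ T ∈ fam S Q, ∑ n ∈ (Ioc 0 Q).filter (fun n => P n = T), (n:ℝ)⁻¹ ≤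
      (phi T)⁻¹ * E⁻¹ := by
    intro T hT
    have hTS := mem_powerset.1 (mem_filter.1 hT).1
    have hTp : ∀ p ∈ T, p.Prime := fun p hp => prime_of_mem_sievePrimes (hTS hp)
    set N := ∏ p ∈ T, p with hN
    have hNpos : 0 < N := prod_pos fun p hp => (hTp p hp).pos
    have hdvd : ∀ n ∈ (Ioc 0 Q).filter (fun n => P n = T), N ∣ n := by
      intro n hn
      have h1 := (mem_filter.1 hn).2
      rw [hN, ← h1]
      exact (prod_dvd_prod_of_subset _ _ _ (filter_subset _ _)).trans
        (Nat.prod_primeFactors_dvd n)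
    have hinj : Set.InjOn (fun n => n / N) ((Ioc 0 Q).filter (fun n => P n = T)) := by
      intro a ha b hb hab
      have h1 := Nat.div_mul_cancel (hdvd a ha)
      have h2 := Nat.div_mul_cancel (hdvd b hb)
      simp only at hab
      rw [← h1, ← h2, hab]
    have h1 : ∑ n ∈ (Ioc 0 Q).filter (fun n => P n = T), (n:ℝ)⁻¹ = (N:ℝ)⁻¹ *
        ∑ m ∈ ((Ioc 0 Q).filter (fun n => P n = T)).image (fun n => n / N), (m:ℝ)⁻¹ := by
      rw [sum_image hinj, mul_sum]
      refine sum_congr rfl fun n hn => ?_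
      rw [← mul_inv, ← Nat.cast_mul, Nat.mul_div_cancel' (hdvd n hn)]
    have h2 := sum_inv_image_le
      (((Ioc 0 Q).filter (fun n => P n = T)).image (fun n => n / N))
      (T ∪ (Ioc 0 w).filter Nat.Prime) (by
        intro m hm
        obtain ⟨n, hn, rfl⟩ := mem_image.1 hm
        have hn' := mem_filter.1 hn
        have hnpos := (mem_Ioc.1 hn'.1).1
        rw [Nat.mem_factoredNumbers']
        intro p hp hpd
        have hpn : p ∣ n := hpd.trans (Nat.div_dvd_of_dvd (hdvd n hn))
        rw [mem_union]
        by_cases hpw : w < p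
        · left
          rw [← hn'.2]
          exact mem_filter.2 ⟨Nat.mem_primeFactors.2 ⟨hp, hpn, by omega⟩, hpw⟩
        · right
          exact mem_filter.2 ⟨mem_Ioc.2 ⟨hp.pos, by omega⟩, hp⟩)
    have hdisj : Disjoint T ((Ioc 0 w).filter Nat.Prime) := by
      rw [disjoint_left]
      intro p hp hp'
      have := lt_of_mem_sievePrimes (hTS hp)
      have := (mem_Ioc.1 (mem_filter.1 hp').1).2
      omega
    have h3 : (T ∪ (Ioc 0 w).filter Nat.Prime).filter Nat.Prime =
        T ∪ (Ioc 0 w).filter Nat.Prime := by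
      refine filter_true_of_mem fun p hp => ?_
      rcases mem_union.1 hp with h | h
      · exact hTp p h
      · exact (mem_filter.1 h).2
    rw [h3, prod_union hdisj] at h2
    have h4 : (N:ℝ)⁻¹ * ∏ p ∈ T, (1 - (p:ℝ)⁻¹)⁻¹ = (phi T)⁻¹ := by
      rw [hN, Nat.cast_prod, phi, ← prod_inv_distrib, ← prod_inv_distrib, ← prod_mul_distrib]
      refine prod_congr rfl fun p hp => ?_
      have : (p:ℝ) ≠ 0 := by exact_mod_cast (hTp p hp).ne_zero
      rw [← mul_inv]
      congr 1
      field_simp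
    rw [h1]
    refine (mul_le_mul_of_nonneg_left h2 (by positivity)).trans (le_of_eq ?_)
    rw [← mul_assoc, h4, prod_inv_distrib]
  have hsum : Real.log Q ≤ ∑ n ∈ Ioc 0 Q, (n:ℝ)⁻¹ := by
    rcases Nat.eq_zero_or_pos Q with rfl | hQ
    · simp
    have h1 := log_add_one_le_harmonic Q
    have h2 : ((harmonic Q : ℚ) : ℝ) = ∑ n ∈ Ioc 0 Q, (n:ℝ)⁻¹ := by
      rw [harmonic_eq_sum_Icc]
      push_cast
      rfl
    rw [← h2]
    refine (Real.log_le_log (by exact_mod_cast hQ) ?_).trans h1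
    exact_mod_cast Nat.le_succ Q
  have htot : ∑ n ∈ Ioc 0 Q, (n:ℝ)⁻¹ ≤ mass S Q * E⁻¹ := by
    rw [← sum_fiberwise_of_maps_to hmaps, mass, sum_mul]
    exact sum_le_sum hfib
  calc Real.log Q * E ≤ mass S Q * E⁻¹ * E := by gcongr; exact hsum.trans htot
    _ = _ := by field_simp

end

/-! ### Fourier analysis of sifted sets -/

section

open Finset

/-- The Fourier transform of the indicator function of a finite set. -/
noncomputable def hat (A : Finset ℕ) (θ : ℝ) : ℂ := ∑ x ∈ A, e (θ * x)

lemma norm_hat_le (A : Finset ℕ) (θ : ℝ) : ‖hat A θ‖ ≤ A.card := by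
  refine (norm_sum_le _ _).trans ?_
  simp [norm_e]

lemma hat_zero (A : Finset ℕ) : hat A 0 = A.card := by simp [hat, e_zero]

lemma norm_hat_neg (A : Finset ℕ) (θ : ℝ) : ‖hat A (-θ)‖ = ‖hat A θ‖ := by
  have : hat A (-θ) = starRingEnd ℂ (hat A θ) := by
    simp only [hat, map_sum]
    refine sum_congr rfl fun x _ => ?_
    rw [neg_mul, e_neg]
  rw [this, RCLike.norm_conj]

/-- The dual large sieve inequality with a majorant. -/
lemma sum_norm_hat_sq_le_of_majorant {ι : Type*} {L : ℕ} {A : Finset ℕ} (hA : A ⊆ range L)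
    (ν : ℕ → ℝ) (hν : ∀ x, 0 ≤ ν x) (hνA : ∀ x ∈ A, 1 ≤ ν x) (R : Finset ι) (θ : ι → ℝ) {B : ℝ}
    (hB0 : 0 ≤ B)
    (hB : ∀ r ∈ R, ∑ s ∈ R, ‖∑ x ∈ range L, (ν x : ℂ) * e ((θ r - θ s) * x)‖ ≤ B) :
    ∑ r ∈ R, ‖hat A (θ r)‖ ^ 2 ≤ A.card * B := by
  set N : ι → ι → ℝ := fun r s => ‖∑ x ∈ range L, (ν x : ℂ) * e ((θ r - θ s) * x)‖ with hN
  have hsymm : ∀ r s, N r s = N s r := by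
    intro r s
    have : ∑ x ∈ range L, (ν x : ℂ) * e ((θ r - θ s) * x) =
        starRingEnd ℂ (∑ x ∈ range L, (ν x : ℂ) * e ((θ s - θ r) * x)) := by
      rw [map_sum]
      refine sum_congr rfl fun x _ => ?_
      rw [map_mul, Complex.conj_ofReal, ← e_neg]
      congr 2
      ring
    simp only [hN]
    rw [this, RCLike.norm_conj]
  set X := ∑ r ∈ R, ‖hat A (θ r)‖ ^ 2 with hX
  set c : ι → ℂ := fun r => starRingEnd ℂ (hat A (θ r)) with hc
  have hcn : ∀ r, ‖c r‖ = ‖hat A (θ r)‖ := fun r => RCLike.norm_conj _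
  set F : ℕ → ℂ := fun x => ∑ r ∈ R, c r * e (θ r * x) with hF
  have h1 : (X : ℂ) = ∑ x ∈ A, F x := by
    rw [hX]
    push_cast
    simp only [hF]
    rw [sum_comm]
    refine sum_congr rfl fun r _ => ?_
    rw [← mul_sum, ← hat, hc, ← Complex.conj_mul']
  have hX0 : 0 ≤ X := sum_nonneg fun _ _ => by positivity
  have h2 : X ≤ ∑ x ∈ A, ‖F x‖ := by
    have := norm_sum_le A F
    rwa [← h1, Complex.norm_real, Real.norm_of_nonneg hX0] at this
  have h3 : X ^ 2 ≤ A.card * ∑ x ∈ A, ‖F x‖ ^ 2 := by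
    calc X ^ 2 ≤ (∑ x ∈ A, ‖F x‖) ^ 2 := by gcongr
      _ ≤ _ := sq_sum_le_card_mul_sum_sq
  have h4 : ∑ x ∈ A, ‖F x‖ ^ 2 ≤ ∑ x ∈ range L, ν x * ‖F x‖ ^ 2 := by
    calc _ ≤ ∑ x ∈ A, ν x * ‖F x‖ ^ 2 := sum_le_sum fun x hx =>
          le_mul_of_one_le_left (by positivity) (hνA x hx)
      _ ≤ _ := sum_le_sum_of_subset_of_nonneg hA fun x _ _ => mul_nonneg (hν x) (by positivity)
  have h5 : ((∑ x ∈ range L, ν x * ‖F x‖ ^ 2 : ℝ) : ℂ) = ∑ r ∈ R, ∑ s ∈ R,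
      c r * starRingEnd ℂ (c s) * ∑ x ∈ range L, (ν x : ℂ) * e ((θ r - θ s) * x) := by
    push_cast
    simp_rw [← Complex.mul_conj', mul_sum]
    rw [sum_congr rfl fun r _ => sum_comm, sum_comm]
    refine sum_congr rfl fun x _ => ?_
    simp only [hF, map_sum]
    rw [sum_mul_sum, mul_sum]
    refine sum_congr rfl fun r _ => ?_
    rw [mul_sum]
    refine sum_congr rfl fun s _ => ?_
    rw [map_mul, ← e_neg, sub_mul, sub_eq_add_neg, e_add]
    ring
  have h6 : ∑ x ∈ range L, ν x * ‖F x‖ ^ 2 ≤ B * X := by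
    have hnn : 0 ≤ ∑ x ∈ range L, ν x * ‖F x‖ ^ 2 :=
      sum_nonneg fun x _ => mul_nonneg (hν x) (by positivity)
    calc _ = ‖((∑ x ∈ range L, ν x * ‖F x‖ ^ 2 : ℝ) : ℂ)‖ := by
          rw [Complex.norm_real, Real.norm_of_nonneg hnn]
      _ ≤ ∑ r ∈ R, ∑ s ∈ R, ‖c r‖ * ‖c s‖ * N r s := by
          rw [h5]
          refine (norm_sum_le _ _).trans (sum_le_sum fun r _ => (norm_sum_le _ _).trans
            (sum_le_sum fun s _ => ?_))
          rw [norm_mul, norm_mul, RCLike.norm_conj (c s)]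
      _ ≤ ∑ r ∈ R, ∑ s ∈ R, (‖c r‖ ^ 2 / 2 * N r s + ‖c s‖ ^ 2 / 2 * N r s) := by
          refine sum_le_sum fun r _ => sum_le_sum fun s _ => ?_
          rw [← add_mul]
          refine mul_le_mul_of_nonneg_right ?_ (norm_nonneg _)
          nlinarith [sq_nonneg (‖c r‖ - ‖c s‖)]
      _ = ∑ r ∈ R, ‖c r‖ ^ 2 * ∑ s ∈ R, N r s := by
          simp_rw [sum_add_distrib]
          rw [sum_comm (f := fun r s => ‖c s‖ ^ 2 / 2 * N r s), ← sum_add_distrib]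
          refine sum_congr rfl fun r _ => ?_
          rw [← mul_sum, ← mul_sum, sum_congr rfl fun s _ => hsymm s r]
          ring
      _ ≤ ∑ r ∈ R, ‖c r‖ ^ 2 * B :=
          sum_le_sum fun r hr => mul_le_mul_of_nonneg_left (hB r hr) (by positivity)
      _ = B * X := by
          rw [← sum_mul, hX, mul_comm]
          simp_rw [hcn]
  have h7 : X * X ≤ (A.card * B) * X := by
    calc X * X = X ^ 2 := (sq X).symm
      _ ≤ A.card * (B * X) := h3.trans (by gcongr; exact h4.trans h6)
      _ = _ := by ring
  rcases hX0.eq_or_lt with h | h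
  · rw [← h]; positivity
  · exact le_of_mul_le_mul_right h7 h

/-- The error term of the sieve weight of level `Q`. -/
noncomputable def sieveErr (Q : ℕ) : ℝ := 2 * (1 + 4 * Real.log Q) * (Q:ℝ) ^ (11/5 : ℝ)

lemma sieveErr_nonneg (Q : ℕ) : 0 ≤ sieveErr Q := by
  have := Real.log_natCast_nonneg Q
  unfold sieveErr
  positivity

/-- The dual large sieve inequality for sets avoiding multiples of primes. -/
lemma sum_norm_hat_sq_le {ι : Type*} {w Q W b L : ℕ} (hw : 5 ^ 10 ≤ w) (hQ : 1 ≤ Q)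
    (hW : ∀ p ∈ sievePrimes w Q, ¬ p ∣ W) {A : Finset ℕ} (hA : A ⊆ range L)
    (hAS : ∀ x ∈ A, ∀ p ∈ sievePrimes w Q, ¬ p ∣ W * x + b) (R : Finset ι) (θ : ι → ℝ) {G : ℝ}
    (hG0 : 0 ≤ G) (hG : ∀ r ∈ R, ∑ s ∈ R, ‖dir L (θ r - θ s)‖ ≤ G) :
    ∑ r ∈ R, ‖hat A (θ r)‖ ^ 2 ≤ A.card * ((mass (sievePrimes w Q) Q)⁻¹ *
      (G + R.card * (2 * L * (w:ℝ) ^ (-(9/10) : ℝ) + sieveErr Q))) := by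
  have hS : ∀ p ∈ sievePrimes w Q, p.Prime := fun p hp => prime_of_mem_sievePrimes hp
  have hm := one_le_mass hS hQ
  have hm0 : 0 < mass (sievePrimes w Q) Q := by linarith
  have he := sieveErr_nonneg Q
  refine sum_norm_hat_sq_le_of_majorant hA (fun x => lam (sievePrimes w Q) Q (W * x + b) ^ 2)
    (fun x => sq_nonneg _) (fun x hx => ?_) R θ (by positivity) fun r hr => ?_
  · rw [lam_eq_one hS hQ (hAS x hx)]
    norm_num
  · calc _ ≤ ∑ s ∈ R, (mass (sievePrimes w Q) Q)⁻¹ * (‖dir L (θ r - θ s)‖ +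
          (2 * L * (w:ℝ) ^ (-(9/10) : ℝ) + sieveErr Q)) := sum_le_sum fun s _ => by
            rw [← add_assoc]
            exact norm_sum_lam_sq_le hw hQ hW L b _
      _ ≤ _ := by
        rw [← mul_sum, sum_add_distrib, sum_const, nsmul_eq_mul]
        gcongr
        exact hG r hr

/-- The product of `1 - 1 / p` over the primes up to `w`. -/
noncomputable def eulerProd (w : ℕ) : ℝ := ∏ p ∈ (Ioc 0 w).filter Nat.Prime, (1 - (p:ℝ)⁻¹)

lemma eulerProd_pos (w : ℕ) : 0 < eulerProd w := prod_pos fun p hp => by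
  have : (p:ℝ)⁻¹ < 1 := inv_lt_one_of_one_lt₀ (by exact_mod_cast (mem_filter.1 hp).2.one_lt)
  linarith

lemma eulerProd_succ (w : ℕ) : eulerProd (w + 1) =
    eulerProd w * if (w + 1).Prime then 1 - ((w + 1 : ℕ) : ℝ)⁻¹ else 1 := by
  rw [eulerProd, eulerProd, prod_filter, prod_filter, prod_Ioc_succ_top (Nat.zero_le w)]

lemma eulerProd_mono_step {m : ℕ} (hm : 1 ≤ m) :
    eulerProd (6 * m) ^ 3 * ((m:ℝ) - 1) ≤ eulerProd (6 * (m + 1)) ^ 3 * m := by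
  have hm' : (1:ℝ) ≤ m := by exact_mod_cast hm
  have hp2 : ¬ (6 * m + 1 + 1).Prime := fun h => by
    have := (Nat.prime_dvd_prime_iff_eq Nat.prime_two h).1 (by omega); omega
  have hp3 : ¬ (6 * m + 1 + 1 + 1).Prime := fun h => by
    have := (Nat.prime_dvd_prime_iff_eq Nat.prime_three h).1 (by omega); omega
  have hp4 : ¬ (6 * m + 1 + 1 + 1 + 1).Prime := fun h => by
    have := (Nat.prime_dvd_prime_iff_eq Nat.prime_two h).1 (by omega); omega
  have hp6 : ¬ (6 * m + 1 + 1 + 1 + 1 + 1 + 1).Prime := fun h => by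
    have := (Nat.prime_dvd_prime_iff_eq Nat.prime_two h).1 (by omega); omega
  rw [show 6 * (m + 1) = 6 * m + 1 + 1 + 1 + 1 + 1 + 1 by ring, eulerProd_succ, eulerProd_succ,
    eulerProd_succ, eulerProd_succ, eulerProd_succ, eulerProd_succ, if_neg hp2, if_neg hp3,
    if_neg hp4, if_neg hp6]
  set y : ℝ := 1 - (6 * (m:ℝ) + 1)⁻¹ with hy
  have hx0 : 0 < (6 * (m:ℝ) + 1)⁻¹ := by positivity
  have hx1 : (6 * (m:ℝ) + 1)⁻¹ ≤ 1 := inv_le_one_of_one_le₀ (by linarith)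
  have hite : ∀ n : ℕ, 6 * m + 1 ≤ n → y ≤ if n.Prime then 1 - (n:ℝ)⁻¹ else 1 := by
    intro n hn
    have hn' : 6 * (m:ℝ) + 1 ≤ n := by exact_mod_cast hn
    split_ifs
    · have := inv_anti₀ (by positivity) hn'
      linarith
    · linarith
  have h1 := hite (6 * m + 1) le_rfl
  have h5 := hite (6 * m + 1 + 1 + 1 + 1 + 1) (by omega)
  generalize (if (6 * m + 1).Prime then 1 - ((6 * m + 1 : ℕ) : ℝ)⁻¹ else 1) = u at h1 ⊢
  generalize (if (6 * m + 1 + 1 + 1 + 1 + 1).Prime then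
    1 - ((6 * m + 1 + 1 + 1 + 1 + 1 : ℕ) : ℝ)⁻¹ else 1) = v at h5 ⊢
  have hE := eulerProd_pos (6 * m)
  have hy0 : 0 ≤ y := by linarith
  have hb : (m:ℝ) - 1 ≤ y ^ 6 * m := by
    have h7 : 1 + ((6:ℕ):ℝ) * (-(6 * (m:ℝ) + 1)⁻¹) ≤ (1 + -(6 * (m:ℝ) + 1)⁻¹) ^ 6 :=
      one_add_mul_le_pow (by linarith) 6
    rw [← sub_eq_add_neg 1 (6 * (m:ℝ) + 1)⁻¹, ← hy] at h7
    have h8 : (6 * (m:ℝ) + 1)⁻¹ * (6 * m + 1) = 1 := inv_mul_cancel₀ (by positivity)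
    push_cast at h7
    nlinarith
  have huv : y ^ 6 ≤ (u * v) ^ 3 := by
    calc y ^ 6 = (y * y) ^ 3 := by ring
      _ ≤ (u * v) ^ 3 := by
        have := hy0.trans h1
        gcongr
  calc eulerProd (6 * m) ^ 3 * ((m:ℝ) - 1) ≤ eulerProd (6 * m) ^ 3 * (y ^ 6 * m) := by gcongr
    _ ≤ eulerProd (6 * m) ^ 3 * ((u * v) ^ 3 * m) := by gcongr
    _ = _ := by ring

lemma eulerProd_mono {m₀ m : ℕ} (h0 : 1 ≤ m₀) (h : m₀ ≤ m) :
    eulerProd (6 * m₀) ^ 3 * ((m₀:ℝ) - 1) ≤ eulerProd (6 * m) ^ 3 * ((m:ℝ) - 1) := by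
  induction m, h using Nat.le_induction with
  | base => exact le_rfl
  | succ m hm ih =>
    refine ih.trans ((eulerProd_mono_step (h0.trans hm)).trans (le_of_eq ?_))
    push_cast
    ring

lemma eulerProd_le_mul {m₀ m t j : ℕ} (h0 : 2 ≤ m₀) (ht : 1 ≤ t)
    (hm : m = max m₀ ((t ^ 3 - 1) * 2 ^ (12 * j))) :
    eulerProd (6 * m₀) ≤ t * 2 ^ (4 * j) * eulerProd (6 * m) := by
  have h1 := eulerProd_mono (by omega : 1 ≤ m₀) (hm ▸ le_max_left _ _ : m₀ ≤ m)
  have hm₀ : (1:ℝ) ≤ (m₀:ℝ) - 1 := by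
    have : (2:ℝ) ≤ m₀ := by exact_mod_cast h0
    linarith
  have hE := eulerProd_pos (6 * m)
  have hE0 := eulerProd_pos (6 * m₀)
  have h2 : (m:ℝ) - 1 ≤ (t * 2 ^ (4 * j)) ^ 3 * ((m₀:ℝ) - 1) := by
    have ht3 : ((t ^ 3 - 1 : ℕ) : ℝ) = (t:ℝ) ^ 3 - 1 := by
      rw [Nat.cast_sub (Nat.one_le_pow _ _ ht)]; simp
    have ht1 : (1:ℝ) ≤ (t:ℝ) ^ 3 := one_le_pow₀ (by exact_mod_cast ht)
    have hj1 : (1:ℝ) ≤ 2 ^ (12 * j) := one_le_pow₀ (by norm_num)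
    have hb : ((t:ℝ) * 2 ^ (4 * j)) ^ 3 = t ^ 3 * 2 ^ (12 * j) := by
      rw [mul_pow, ← pow_mul]; congr 2; ring
    rw [hb]
    have hmle : (m:ℝ) ≤ max (m₀:ℝ) (((t:ℝ) ^ 3 - 1) * 2 ^ (12 * j)) := by
      rw [hm]; push_cast [ht3]; exact le_rfl
    have hprod : 1 ≤ (t:ℝ) ^ 3 * 2 ^ (12 * j) := one_le_mul_of_one_le_of_one_le ht1 hj1
    rcases le_max_iff.1 hmle with h | h
    · nlinarith
    · nlinarith
  have h3 : eulerProd (6 * m₀) ^ 3 ≤ (t * 2 ^ (4 * j) * eulerProd (6 * m)) ^ 3 := by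
    refine le_of_mul_le_mul_right (h1.trans ?_) (by linarith : (0:ℝ) < (m₀:ℝ) - 1)
    calc _ ≤ eulerProd (6 * m) ^ 3 * ((t * 2 ^ (4 * j)) ^ 3 * ((m₀:ℝ) - 1)) := by gcongr
      _ = _ := by ring
  exact le_of_pow_le_pow_left₀ (by norm_num) (by positivity) h3

end

section

open Finset Filter

/-- The sieve level used modulo `M`. -/
noncomputable def level (M : ℕ) : ℕ := ⌊(M:ℝ) ^ (9/20 : ℝ)⌋₊

lemma one_le_level {M : ℕ} (hM : 1 ≤ M) : 1 ≤ level M :=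
  Nat.one_le_floor_iff _ |>.2 (Real.one_le_rpow (by exact_mod_cast hM) (by norm_num))

lemma level_le_rpow (M : ℕ) : (level M : ℝ) ≤ (M:ℝ) ^ (9/20 : ℝ) :=
  Nat.floor_le (by positivity)

lemma level_le {M : ℕ} (hM : 1 ≤ M) : level M ≤ M := by
  have h := (level_le_rpow M).trans (Real.rpow_le_rpow_of_exponent_le
    (by exact_mod_cast hM : (1:ℝ) ≤ M) (by norm_num : (9/20 : ℝ) ≤ 1))
  rw [Real.rpow_one] at h
  exact_mod_cast h

lemma sieveErr_level_le {M : ℕ} (hM : 1 ≤ M) :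
    sieveErr (level M) ≤ 2 * (1 + 4 * Real.log M) * (M:ℝ) ^ (99/100 : ℝ) := by
  have hl := one_le_level hM
  have h1 : Real.log (level M) ≤ Real.log M :=
    Real.log_le_log (by exact_mod_cast hl) (by exact_mod_cast level_le hM)
  have h2 : (level M : ℝ) ^ (11/5 : ℝ) ≤ (M:ℝ) ^ (99/100 : ℝ) := by
    calc _ ≤ ((M:ℝ) ^ (9/20 : ℝ)) ^ (11/5 : ℝ) :=
          Real.rpow_le_rpow (by positivity) (level_le_rpow M) (by norm_num)
      _ = _ := by rw [← Real.rpow_mul (by positivity)]; norm_num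
  have h3 : 0 ≤ Real.log (level M) := Real.log_natCast_nonneg _
  unfold sieveErr
  gcongr

lemma eventually_log_pow_mul_sieveErr_le (c : ℝ) (n : ℕ) :
    ∀ᶠ M : ℕ in atTop, c * Real.log M ^ n * sieveErr (level M) ≤ M := by
  have h1 := (isLittleO_log_rpow_rpow_atTop ((n + 1 : ℕ) : ℝ)
    (by norm_num : (0:ℝ) < 1/100)).bound (by positivity : (0:ℝ) < (10 * (|c| + 1))⁻¹)
  have h2 := tendsto_natCast_atTop_atTop (R := ℝ) |>.eventually h1
  filter_upwards [h2, (Real.tendsto_log_atTop.comp tendsto_natCast_atTop_atTop).eventually_ge_atTop 1,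
    eventually_ge_atTop 1] with M h hl hM
  simp only [Function.comp_apply] at hl
  have hM0 : (0:ℝ) < M := by exact_mod_cast hM
  rw [Real.rpow_natCast, Real.norm_of_nonneg (by positivity), Real.norm_of_nonneg (by positivity),
    inv_mul_eq_div, le_div_iff₀ (by positivity)] at h
  have he := sieveErr_level_le hM
  have h3 : (M:ℝ) ^ (1/100 : ℝ) * (M:ℝ) ^ (99/100 : ℝ) = M := by
    rw [← Real.rpow_add hM0]; norm_num
  calc c * Real.log M ^ n * sieveErr (level M)
      ≤ (|c| + 1) * Real.log M ^ n * (2 * (1 + 4 * Real.log M) * (M:ℝ) ^ (99/100 : ℝ)) := by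
        refine mul_le_mul ?_ he (sieveErr_nonneg _) (by positivity)
        gcongr
        linarith [le_abs_self c]
    _ ≤ (|c| + 1) * Real.log M ^ n * (10 * Real.log M * (M:ℝ) ^ (99/100 : ℝ)) := by
        have h4 : 2 * (1 + 4 * Real.log M) ≤ 10 * Real.log M := by linarith
        exact mul_le_mul_of_nonneg_left (mul_le_mul_of_nonneg_right h4 (by positivity))
          (by positivity)
    _ = (Real.log M ^ (n + 1) * (10 * (|c| + 1))) * (M:ℝ) ^ (99/100 : ℝ) := by ring
    _ ≤ (M:ℝ) ^ (1/100 : ℝ) * (M:ℝ) ^ (99/100 : ℝ) := by gcongr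
    _ = M := h3

/-- A set of residues on which a linear form avoids multiples of the medium primes, and which has
density comparable with the upper bound sieve. -/
structure SieveSet (w₀ : ℕ) (C : ℝ) (M W b : ℕ) (A : Finset ℕ) : Prop where
  subset : A ⊆ range M
  coprime : ∀ p : ℕ, p.Prime → w₀ < p → ¬ p ∣ W
  sifted : ∀ x ∈ A, ∀ p ∈ sievePrimes w₀ (level M), ¬ p ∣ W * x + b
  dense : (M:ℝ) ≤ C * (Real.log (level M) * eulerProd w₀) * A.card

lemma dir_div_eq_zero {M r s : ℕ} (hr : r < M) (hs : s < M) (hrs : r ≠ s) :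
    dir M ((r:ℝ) / M - s / M) = 0 := by
  have hM : (M:ℝ) ≠ 0 := by
    have : 0 < M := by omega
    exact_mod_cast this.ne'
  have h := dir_mul_sub_one M ((r:ℝ) / M - s / M)
  have h1 : ((r:ℝ) / M - s / M) * M = ((r - s : ℤ) : ℝ) := by
    push_cast
    field_simp
  rw [h1, e_int, sub_self, mul_eq_zero] at h
  refine h.resolve_right fun h2 => ?_
  rw [sub_eq_zero, e_eq_one_iff] at h2
  obtain ⟨n, hn⟩ := h2
  rw [hn] at h1
  have h3 : n * M = (r:ℤ) - s := by exact_mod_cast h1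
  have h4 : n = 0 := by
    by_contra hn0
    have h5 : (M:ℤ) ≤ |n * M| := by
      rw [abs_mul, Nat.abs_cast]
      exact le_mul_of_one_le_left (by positivity) (Int.one_le_abs hn0)
    rw [h3] at h5
    have h6 : |(r:ℤ) - s| < M := by rw [abs_lt]; constructor <;> omega
    omega
  rw [h4] at h3
  omega

lemma sum_norm_dir_div {M r : ℕ} {R : Finset ℕ} (hR : R ⊆ range M) (hr : r ∈ R) :
    ∑ s ∈ R, ‖dir M ((r:ℝ) / M - s / M)‖ = M := by
  rw [sum_eq_single_of_mem r hr]
  · simp [dir]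
  · intro s hs hsr
    rw [dir_div_eq_zero (mem_range.1 (hR hr)) (mem_range.1 (hR hs)) hsr.symm, norm_zero]

/-- The frequencies at which the Fourier transform is at least `8 ^ (-j)` times the trivial
bound. -/
noncomputable def large (A : Finset ℕ) (M j : ℕ) : Finset ℕ :=
  (range M).filter fun r => (A.card : ℝ) ≤ 8 ^ j * ‖hat A ((r:ℝ) / M)‖

lemma rpow_neg_le {t j x : ℕ} (ht : 1 ≤ t) (hx : t ^ 3 * 2 ^ (12 * j) ≤ x) :
    (x:ℝ) ^ (-(9/10) : ℝ) * (t ^ 2 * 2 ^ (10 * j)) ≤ 1 := by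
  have ht' : (1:ℝ) ≤ t := by exact_mod_cast ht
  have hv : (0:ℝ) < (t:ℝ) ^ 3 * 2 ^ (12 * j) := by positivity
  have hx' : (t:ℝ) ^ 3 * 2 ^ (12 * j) ≤ x := by exact_mod_cast hx
  have h1 : (t:ℝ) ^ 2 * 2 ^ (10 * j) ≤ ((t:ℝ) ^ 3 * 2 ^ (12 * j)) ^ (9/10 : ℝ) := by
    have hpow : ∀ (y : ℝ) (a c : ℕ), 1 ≤ y → 10 * a ≤ 9 * c → y ^ a ≤ (y ^ c) ^ (9/10 : ℝ) := by
      intro y a c hy hac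
      rw [← Real.rpow_natCast, ← Real.rpow_natCast, ← Real.rpow_mul (by linarith)]
      refine Real.rpow_le_rpow_of_exponent_le hy ?_
      have : (10:ℝ) * a ≤ 9 * c := by exact_mod_cast hac
      linarith
    rw [Real.mul_rpow (by positivity) (by positivity)]
    exact mul_le_mul (hpow _ _ _ ht' (by norm_num)) (hpow _ _ _ (by norm_num) (by omega))
      (by positivity) (by positivity)
  calc (x:ℝ) ^ (-(9/10) : ℝ) * (t ^ 2 * 2 ^ (10 * j))
      ≤ ((t:ℝ) ^ 3 * 2 ^ (12 * j)) ^ (-(9/10) : ℝ) *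
        ((t:ℝ) ^ 3 * 2 ^ (12 * j)) ^ (9/10 : ℝ) :=
        mul_le_mul (Real.rpow_le_rpow_of_nonpos hv hx' (by norm_num)) h1 (by positivity)
          (by positivity)
    _ = 1 := by rw [← Real.rpow_add hv]; norm_num

lemma sievePrimes_anti {w₀ w Q p : ℕ} (h : w₀ ≤ w) (hp : p ∈ sievePrimes w Q) :
    p ∈ sievePrimes w₀ Q := by
  simp only [sievePrimes, mem_filter, mem_Ioc] at hp ⊢
  exact ⟨⟨by omega, hp.1.2⟩, hp.2⟩

set_option maxHeartbeats 1000000 in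
/-- A sieve set has few large Fourier coefficients, uniformly in the sieving range. -/
lemma exists_card_large_le {C : ℝ} (hC : 0 < C) : ∃ B : ℝ, 0 < B ∧ ∀ m₀ : ℕ, 5 ^ 10 ≤ 6 * m₀ →
    ∀ᶠ M : ℕ in atTop, ∀ W b A, SieveSet (6 * m₀) C M W b A → ∀ j : ℕ, (8:ℝ) ^ j ≤ Real.log M →
      ((large A M j).card : ℝ) ≤ B * 2 ^ (10 * j) := by
  set t : ℕ := ⌈6 * C⌉₊ + 2 with ht
  have htC : 6 * C ≤ t := by
    rw [ht]; push_cast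
    linarith [Nat.le_ceil (6 * C)]
  have ht2 : 2 ≤ t := by omega
  have ht0 : (0:ℝ) < t := by positivity
  refine ⟨2 * C * t, by positivity, fun m₀ hm₀ => ?_⟩
  filter_upwards [eventually_log_pow_mul_sieveErr_le ((6 * m₀ + 6 * t ^ 3 : ℕ) : ℝ) 4,
    (Real.tendsto_log_atTop.comp tendsto_natCast_atTop_atTop).eventually_ge_atTop 1,
    eventually_ge_atTop 1] with M hMerr hMlog hM1 W b A hA j hj
  simp only [Function.comp_apply] at hMlog
  set m := max m₀ ((t ^ 3 - 1) * 2 ^ (12 * j)) with hm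
  set w := 6 * m with hw
  set Q := level M with hQdef
  have hQ : 1 ≤ Q := one_le_level hM1
  have hm₀m : m₀ ≤ m := le_max_left _ _
  have hw5 : 5 ^ 10 ≤ w := by omega
  have hw0 : (0:ℝ) < w := by
    have : 0 < w := lt_of_lt_of_le (by norm_num) hw5
    exact_mod_cast this
  set R := large A M j with hR
  have hRM : R ⊆ range M := filter_subset _ _
  set n : ℝ := (A.card : ℝ) with hn
  have hM0 : (0:ℝ) < M := by exact_mod_cast hM1
  have hEul := eulerProd_pos w
  have hEul0 := eulerProd_pos (6 * m₀)
  have hlogQ : 0 ≤ Real.log Q := Real.log_natCast_nonneg _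
  have hn0 : 0 < n := by
    by_contra h
    have h1 : n = 0 := le_antisymm (not_lt.1 h) (Nat.cast_nonneg _)
    have := hA.dense
    rw [← hn, h1, mul_zero] at this
    linarith
  have hmass : Real.log Q * eulerProd w ≤ mass (sievePrimes w Q) Q := log_mul_prod_le_mass w Q
  have hmass1 := one_le_mass (S := sievePrimes w Q) (fun p hp => prime_of_mem_sievePrimes hp) hQ
  have hmain := sum_norm_hat_sq_le hw5 hQ
    (fun p hp => hA.coprime p (prime_of_mem_sievePrimes hp)
      (lt_of_mem_sievePrimes (sievePrimes_anti (by omega) hp))) hA.subset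
    (fun x hx p hp => hA.sifted x hx p (sievePrimes_anti (by omega) hp)) R
    (fun r => (r:ℝ) / M) (G := M) (Nat.cast_nonneg M)
    (fun r hr => (sum_norm_dir_div hRM hr).le)
  rw [← hn] at hmain
  set K : ℝ := (R.card : ℝ) with hK
  set ω : ℝ := (w:ℝ) ^ (-(9/10) : ℝ) with hω
  have hωpos : 0 < ω := Real.rpow_pos_of_pos hw0 _
  have h8 : ∀ r ∈ R, (n / 8 ^ j) ^ 2 ≤ ‖hat A ((r:ℝ) / M)‖ ^ 2 := by
    intro r hr
    have := (mem_filter.1 hr).2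
    gcongr
    rw [div_le_iff₀ (by positivity)]
    linarith
  have hlow : K * (n / 8 ^ j) ^ 2 ≤ ∑ r ∈ R, ‖hat A ((r:ℝ) / M)‖ ^ 2 := by
    rw [hK, ← nsmul_eq_mul]
    exact card_nsmul_le_sum R _ _ h8
  have herr : sieveErr Q ≤ M * ω := by
    have hww : (w:ℝ) ≤ ((6 * m₀ + 6 * t ^ 3 : ℕ) : ℝ) * Real.log M ^ 4 := by
      have hj4 : (2:ℝ) ^ (12 * j) ≤ Real.log M ^ 4 := by
        calc (2:ℝ) ^ (12 * j) = (8 ^ j) ^ 4 := by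
              rw [← pow_mul, show (8:ℝ) = 2 ^ 3 by norm_num, ← pow_mul]; congr 1; ring
          _ ≤ _ := by gcongr
      have hl4 : 1 ≤ Real.log M ^ 4 := one_le_pow₀ hMlog
      have hmle : w ≤ 6 * m₀ + 6 * (t ^ 3 * 2 ^ (12 * j)) := by
        have : m ≤ m₀ + t ^ 3 * 2 ^ (12 * j) := by
          refine max_le (by omega) ?_
          calc _ ≤ t ^ 3 * 2 ^ (12 * j) := Nat.mul_le_mul_right _ (Nat.sub_le _ _)
            _ ≤ _ := by omega
        omega
      calc (w:ℝ) ≤ 6 * m₀ + 6 * (t ^ 3 * 2 ^ (12 * j)) := by exact_mod_cast hmle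
        _ ≤ 6 * m₀ * Real.log M ^ 4 + 6 * (t ^ 3 * Real.log M ^ 4) := by
            have h3 : (6 * m₀ : ℝ) ≤ 6 * m₀ * Real.log M ^ 4 :=
              le_mul_of_one_le_right (by positivity) hl4
            exact add_le_add h3 (by gcongr)
        _ = _ := by push_cast; ring
    have hw1 : (w:ℝ) ^ (9/10 : ℝ) ≤ w := by
      have h := Real.rpow_le_rpow_of_exponent_le (x := (w:ℝ)) (y := 9/10) (z := 1)
        (by exact_mod_cast (le_trans (by norm_num) hw5 : 1 ≤ w)) (by norm_num)
      rwa [Real.rpow_one] at h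
    have h1 : (w:ℝ) ^ (9/10 : ℝ) * sieveErr Q ≤ M :=
      (mul_le_mul_of_nonneg_right (hw1.trans hww) (sieveErr_nonneg Q)).trans hMerr
    have h2 : ω * (w:ℝ) ^ (9/10 : ℝ) = 1 := by
      rw [hω, ← Real.rpow_add hw0]; norm_num
    calc sieveErr Q = ω * ((w:ℝ) ^ (9/10 : ℝ) * sieveErr Q) := by rw [← mul_assoc, h2, one_mul]
      _ ≤ ω * M := by gcongr
      _ = _ := mul_comm _ _
  have hMm : (M:ℝ) ≤ C * n * (t * 2 ^ (4 * j)) * mass (sievePrimes w Q) Q := by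
    have h1 := eulerProd_le_mul (by omega : 2 ≤ m₀) (by omega : 1 ≤ t) hm
    calc (M:ℝ) ≤ C * (Real.log Q * eulerProd (6 * m₀)) * n := hA.dense
      _ ≤ C * (Real.log Q * (t * 2 ^ (4 * j) * eulerProd w)) * n := by gcongr
      _ = C * n * (t * 2 ^ (4 * j)) * (Real.log Q * eulerProd w) := by ring
      _ ≤ _ := by gcongr
  have hK0 : 0 ≤ K := Nat.cast_nonneg _
  have hup : K * (n / 8 ^ j) ^ 2 ≤ n * (C * n * (t * 2 ^ (4 * j)) * (1 + 3 * K * ω)) := by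
    have hm0 : 0 < mass (sievePrimes w Q) Q := by linarith
    refine (hlow.trans hmain).trans (mul_le_mul_of_nonneg_left ?_ hn0.le)
    rw [inv_mul_le_iff₀ hm0]
    calc M + K * (2 * M * ω + sieveErr Q) ≤ M + K * (2 * M * ω + M * ω) :=
          add_le_add le_rfl (mul_le_mul_of_nonneg_left (add_le_add le_rfl herr) hK0)
      _ = M * (1 + 3 * K * ω) := by ring
      _ ≤ C * n * (t * 2 ^ (4 * j)) * mass (sievePrimes w Q) Q * (1 + 3 * K * ω) :=
          mul_le_mul_of_nonneg_right hMm (by positivity)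
      _ = _ := by ring
  have hωt : ω * (t ^ 2 * 2 ^ (10 * j)) ≤ 1 := by
    refine rpow_neg_le (by omega) ?_
    have h1 : (t ^ 3 - 1) * 2 ^ (12 * j) ≤ m := le_max_right _ _
    have h2 : t ^ 3 ≤ 6 * (t ^ 3 - 1) := by
      have : 2 ^ 3 ≤ t ^ 3 := Nat.pow_le_pow_left ht2 3
      omega
    calc t ^ 3 * 2 ^ (12 * j) ≤ 6 * (t ^ 3 - 1) * 2 ^ (12 * j) := Nat.mul_le_mul_right _ h2
      _ = 6 * ((t ^ 3 - 1) * 2 ^ (12 * j)) := by ring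
      _ ≤ w := by omega
  have h64 : ((8:ℝ) ^ j) ^ 2 = 2 ^ (6 * j) := by
    rw [← pow_mul, show (8:ℝ) = 2 ^ 3 by norm_num, ← pow_mul]; congr 1; ring
  have hup2 : K ≤ C * (t * 2 ^ (10 * j)) * (1 + 3 * K * ω) := by
    rw [div_pow, h64, mul_div_assoc', div_le_iff₀ (by positivity)] at hup
    have h10 : (2:ℝ) ^ (10 * j) = 2 ^ (4 * j) * 2 ^ (6 * j) := by
      rw [← pow_add]; congr 1; ring
    have : K * n ^ 2 ≤ C * (t * 2 ^ (10 * j)) * (1 + 3 * K * ω) * n ^ 2 := by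
      rw [h10]
      calc _ ≤ _ := hup
        _ = _ := by ring
    exact le_of_mul_le_mul_right this (by positivity)
  have hhalf : C * (t * 2 ^ (10 * j)) * (3 * K * ω) ≤ K / 2 := by
    have h1 : 3 * C * (t * 2 ^ (10 * j)) * ω * 2 ≤ ω * (t ^ 2 * 2 ^ (10 * j)) := by
      have : 6 * C * (t * 2 ^ (10 * j) * ω) ≤ t * (t * 2 ^ (10 * j) * ω) := by gcongr
      linarith
    nlinarith
  nlinarith

end

section

open Finset Filter

lemma sum_norm_hat_sq_le_card {A : Finset ℕ} {M : ℕ} (hA : A ⊆ range M) :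
    ∑ r ∈ range M, ‖hat A ((r:ℝ) / M)‖ ^ 2 ≤ M * A.card := by
  rw [mul_comm]
  refine sum_norm_hat_sq_le_of_majorant hA (fun _ => 1) (fun _ => zero_le_one) (fun _ _ => le_rfl)
    (range M) (fun r : ℕ => (r:ℝ) / M) (Nat.cast_nonneg M) fun r hr => ?_
  refine le_of_eq ((sum_congr rfl fun s _ => ?_).trans (sum_norm_dir_div (Subset.refl _) hr))
  simp [dir]

lemma norm_hat_le_of_not_mem_large {A : Finset ℕ} {M i r : ℕ} (hr : r ∈ range M \ large A M i) :
    ‖hat A ((r:ℝ) / M)‖ ≤ A.card / 8 ^ i := by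
  rw [Finset.mem_sdiff, large, mem_filter, not_and, not_le] at hr
  rw [le_div_iff₀ (by positivity), mul_comm]
  exact (hr.2 hr.1).le

/-- The fourth moment of the Fourier transform off the large frequencies. -/
noncomputable def tail (A : Finset ℕ) (M i : ℕ) : ℝ :=
  ∑ r ∈ range M \ large A M i, ‖hat A ((r:ℝ) / M)‖ ^ 4

lemma tail_le_succ (A : Finset ℕ) (M i : ℕ) :
    tail A M i ≤ (large A M (i + 1)).card * ((A.card : ℝ) / 8 ^ i) ^ 4 + tail A M (i + 1) := by
  have hsub : range M \ large A M i ⊆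
      (large A M (i + 1) \ large A M i) ∪ (range M \ large A M (i + 1)) := by
    intro r hr
    rw [Finset.mem_sdiff] at hr
    rw [mem_union, Finset.mem_sdiff, Finset.mem_sdiff]
    tauto
  calc tail A M i ≤ ∑ r ∈ (large A M (i + 1) \ large A M i) ∪ (range M \ large A M (i + 1)),
        ‖hat A ((r:ℝ) / M)‖ ^ 4 := sum_le_sum_of_subset_of_nonneg hsub fun _ _ _ => by positivity
    _ ≤ ∑ r ∈ large A M (i + 1) \ large A M i, ‖hat A ((r:ℝ) / M)‖ ^ 4 + tail A M (i + 1) := by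
        rw [tail, ← sum_union_inter]
        exact le_add_of_nonneg_right (sum_nonneg fun _ _ => by positivity)
    _ ≤ _ := by
        gcongr
        calc _ ≤ ∑ r ∈ large A M (i + 1) \ large A M i, ((A.card : ℝ) / 8 ^ i) ^ 4 := by
              refine sum_le_sum fun r hr => ?_
              gcongr
              refine norm_hat_le_of_not_mem_large (Finset.mem_sdiff.2 ⟨?_, (Finset.mem_sdiff.1 hr).2⟩)
              exact filter_subset _ _ (Finset.mem_sdiff.1 hr).1
          _ ≤ _ := by
              rw [sum_const, nsmul_eq_mul]
              gcongr
              exact sdiff_subset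

lemma tail_le_of_card_large_le {A : Finset ℕ} {M i J : ℕ} {B : ℝ} (hB : 0 ≤ B) (hiJ : i ≤ J)
    (h : ∀ j ≤ J, ((large A M j).card : ℝ) ≤ B * 2 ^ (10 * j)) :
    tail A M i ≤ 2048 * B * (1 / 4 ^ i - 1 / 4 ^ J) * A.card ^ 4 + tail A M J := by
  induction J, hiJ using Nat.le_induction with
  | base => simp
  | succ J hiJ ih =>
    have h1 := ih fun j hj => h j (by omega)
    have h2 := tail_le_succ A M J
    have h3 : ((large A M (J + 1)).card : ℝ) * ((A.card : ℝ) / 8 ^ J) ^ 4 ≤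
        1024 * B * (1 / 4 ^ J) * A.card ^ 4 := by
      calc _ ≤ B * 2 ^ (10 * (J + 1)) * ((A.card : ℝ) / 8 ^ J) ^ 4 := by
            gcongr
            exact h (J + 1) le_rfl
        _ = _ := by
            have e1 : (2:ℝ) ^ (10 * (J + 1)) = 1024 * (2 ^ J) ^ 10 := by
              rw [← pow_mul]; ring
            have e2 : (8:ℝ) ^ J = (2 ^ J) ^ 3 := by
              rw [← pow_mul, mul_comm, pow_mul]; norm_num
            have e3 : (4:ℝ) ^ J = (2 ^ J) ^ 2 := by
              rw [← pow_mul, mul_comm, pow_mul]; norm_num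
            rw [e1, e2, e3]
            field_simp
    have h4 : 1024 * B * (1 / 4 ^ J) * (A.card : ℝ) ^ 4 ≤
        2048 * B * (1 / 4 ^ J - 1 / 4 ^ (J + 1)) * A.card ^ 4 := by
      have : (1:ℝ) / 4 ^ J - 1 / 4 ^ (J + 1) = 3 / 4 * (1 / 4 ^ J) := by
        rw [pow_succ]; field_simp; norm_num
      rw [this]
      have : 0 ≤ B * (1 / 4 ^ J) * (A.card : ℝ) ^ 4 := by positivity
      linarith
    have h5 : 2048 * B * (1 / 4 ^ i - 1 / 4 ^ (J + 1)) * (A.card : ℝ) ^ 4 =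
        2048 * B * (1 / 4 ^ i - 1 / 4 ^ J) * A.card ^ 4 +
        2048 * B * (1 / 4 ^ J - 1 / 4 ^ (J + 1)) * A.card ^ 4 := by ring
    linarith

lemma tail_le_of_log_lt {A : Finset ℕ} {M J : ℕ} {C : ℝ} (hC : 0 < C) (hA : A ⊆ range M)
    (hl : 0 < Real.log M) (hd : (M:ℝ) ≤ C * Real.log M * A.card)
    (hJ : Real.log M < 8 ^ (J + 1)) :
    tail A M J ≤ 64 * C / Real.log M * A.card ^ 4 := by
  set n : ℝ := (A.card : ℝ) with hn
  have hn0 : 0 ≤ n := Nat.cast_nonneg _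
  have h1 : n / 8 ^ J ≤ 8 * n / Real.log M := by
    rw [div_le_div_iff₀ (by positivity) hl]
    rw [pow_succ] at hJ
    nlinarith
  calc tail A M J ≤ ∑ r ∈ range M \ large A M J,
        (8 * n / Real.log M) ^ 2 * ‖hat A ((r:ℝ) / M)‖ ^ 2 := by
        refine sum_le_sum fun r hr => ?_
        have := (norm_hat_le_of_not_mem_large hr).trans h1
        rw [show ‖hat A ((r:ℝ) / M)‖ ^ 4 = ‖hat A ((r:ℝ) / M)‖ ^ 2 * ‖hat A ((r:ℝ) / M)‖ ^ 2 by ring]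
        gcongr
    _ ≤ (8 * n / Real.log M) ^ 2 * ∑ r ∈ range M, ‖hat A ((r:ℝ) / M)‖ ^ 2 := by
        rw [mul_sum]
        exact sum_le_sum_of_subset_of_nonneg sdiff_subset fun _ _ _ => by positivity
    _ ≤ (8 * n / Real.log M) ^ 2 * (C * Real.log M * n * n) := by
        gcongr
        exact (sum_norm_hat_sq_le_card hA).trans (by gcongr)
    _ = _ := by
        field_simp
        ring

lemma eulerProd_le_one (w : ℕ) : eulerProd w ≤ 1 :=
  prod_le_one (fun p hp => by
    have : (p:ℝ)⁻¹ ≤ 1 := inv_le_one_of_one_le₀ (by exact_mod_cast (mem_filter.1 hp).2.one_lt.le)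
    linarith) fun p _ => by
      have : (0:ℝ) ≤ (p:ℝ)⁻¹ := by positivity
      linarith

lemma SieveSet.le_log_mul {w₀ M W b : ℕ} {C : ℝ} {A : Finset ℕ} (hC : 0 < C) (hM : 1 ≤ M)
    (hA : SieveSet w₀ C M W b A) : (M:ℝ) ≤ C * Real.log M * A.card := by
  have h1 : Real.log (level M) ≤ Real.log M :=
    Real.log_le_log (by exact_mod_cast one_le_level hM) (by exact_mod_cast level_le hM)
  have h2 : Real.log (level M) * eulerProd w₀ ≤ Real.log M * 1 :=
    mul_le_mul h1 (eulerProd_le_one _) (eulerProd_pos _).le (Real.log_natCast_nonneg _)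
  rw [mul_one] at h2
  exact hA.dense.trans (by gcongr)

/-- The fourth moment of the Fourier transform of a sieve set is bounded and concentrated on a
bounded number of frequencies, uniformly in the sieving range. -/
theorem exists_fourth_moment_le {C : ℝ} (hC : 0 < C) : ∃ B : ℝ, 0 < B ∧
    ∀ m₀ : ℕ, 5 ^ 10 ≤ 6 * m₀ → ∀ i : ℕ, ∀ᶠ M : ℕ in atTop, ∀ W b A, SieveSet (6 * m₀) C M W b A →
      ((large A M i).card : ℝ) ≤ B * 2 ^ (10 * i) ∧ tail A M i ≤ B / 4 ^ i * A.card ^ 4 ∧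
      ∑ r ∈ range M, ‖hat A ((r:ℝ) / M)‖ ^ 4 ≤ B * A.card ^ 4 := by
  obtain ⟨B, hB, h⟩ := exists_card_large_le hC
  refine ⟨2049 * B + 64 * C, by positivity, fun m₀ hm₀ i => ?_⟩
  filter_upwards [h m₀ hm₀,
    (Real.tendsto_log_atTop.comp tendsto_natCast_atTop_atTop).eventually_ge_atTop ((8:ℝ) ^ i),
    eventually_ge_atTop 1] with M hM hl hM1 W b A hA
  simp only [Function.comp_apply] at hl
  have hl1 : 1 ≤ Real.log M := le_trans (one_le_pow₀ (by norm_num)) hl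
  obtain ⟨J, hJ1, hJ2⟩ := exists_nat_pow_near hl1 (by norm_num : (1:ℝ) < 8)
  have hiJ : i ≤ J := by
    have := (pow_lt_pow_iff_right₀ (by norm_num : (1:ℝ) < 8)).1 (hl.trans_lt hJ2)
    omega
  have hcard : ∀ j ≤ J, ((large A M j).card : ℝ) ≤ B * 2 ^ (10 * j) := fun j hj =>
    hM W b A hA j (le_trans (pow_le_pow_right₀ (by norm_num) hj) hJ1)
  have htJ := tail_le_of_log_lt hC hA.subset (by linarith) (hA.le_log_mul hC hM1) hJ2
  have htail : ∀ i' ≤ i, tail A M i' ≤ (2048 * B + 64 * C) / 4 ^ i' * A.card ^ 4 := by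
    intro i' hi'
    have h1 := tail_le_of_card_large_le hB.le (hi'.trans hiJ) hcard
    have h2 : 64 * C / Real.log M ≤ 64 * C / 4 ^ i' := by
      gcongr
      calc (4:ℝ) ^ i' ≤ 8 ^ i' := by gcongr; norm_num
        _ ≤ 8 ^ i := pow_le_pow_right₀ (by norm_num) hi'
        _ ≤ _ := hl
    calc tail A M i' ≤ 2048 * B * (1 / 4 ^ i' - 1 / 4 ^ J) * A.card ^ 4
          + 64 * C / Real.log M * A.card ^ 4 := by linarith
      _ ≤ 2048 * B * (1 / 4 ^ i' - 0) * A.card ^ 4 + 64 * C / 4 ^ i' * A.card ^ 4 := by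
          gcongr
          positivity
      _ = _ := by ring
  refine ⟨(hcard i hiJ).trans (by gcongr; linarith), (htail i le_rfl).trans ?_, ?_⟩
  · gcongr
    linarith
  · have h1 := htail 0 (Nat.zero_le i)
    have h2 := hcard 0 (Nat.zero_le J)
    rw [pow_zero, div_one] at h1
    rw [mul_zero, pow_zero, mul_one] at h2
    have hsub : large A M 0 ⊆ range M := filter_subset _ _
    rw [← sum_sdiff hsub]
    have h3 : ∑ r ∈ large A M 0, ‖hat A ((r:ℝ) / M)‖ ^ 4 ≤ B * A.card ^ 4 := by
      calc _ ≤ ∑ r ∈ large A M 0, (A.card : ℝ) ^ 4 :=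
            sum_le_sum fun r _ => by gcongr; exact norm_hat_le _ _
        _ ≤ _ := by rw [sum_const, nsmul_eq_mul]; gcongr
    unfold tail at h1
    linarith

end

/-! ### Sifted sets with evenly filled blocks -/

section

open Finset Filter

/-- A sifted set of residues which is evenly distributed among `N` blocks of length `ℓ` and the two
parities. -/
structure BlockSet (w₀ Q W b ℓ N a : ℕ) (A : Finset ℕ) : Prop where
  subset : A ⊆ range (N * ℓ)
  card_block : ∀ j < N, ∀ d < 2, (A.filter fun x => x / ℓ = j ∧ x % 2 = d).card = a
  coprime : ∀ p : ℕ, p.Prime → w₀ < p → ¬ p ∣ W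
  sifted : ∀ x ∈ A, ∀ p ∈ sievePrimes w₀ Q, ¬ p ∣ W * x + b

namespace BlockSet

variable {w₀ Q W b ℓ N a : ℕ} {A : Finset ℕ}

lemma sum_eq (h : BlockSet w₀ Q W b ℓ N a A) (f : ℕ → ℕ → ℂ) :
    ∑ x ∈ A, f (x / ℓ) (x % 2) = a * ∑ j ∈ range N, ∑ d ∈ range 2, f j d := by
  have hmaps : ∀ x ∈ A, (x / ℓ, x % 2) ∈ range N ×ˢ range 2 := fun x hx => by
    rw [mem_product, mem_range, mem_range]
    exact ⟨Nat.div_lt_of_lt_mul (by simpa [mul_comm] using h.subset hx), Nat.mod_lt _ two_pos⟩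
  rw [← sum_fiberwise_of_maps_to hmaps, ← sum_product', mul_sum]
  refine sum_congr rfl fun jd hjd => ?_
  rw [mem_product, mem_range, mem_range] at hjd
  rw [← h.card_block jd.1 hjd.1 jd.2 hjd.2, ← nsmul_eq_mul, ← sum_const]
  simp only [Prod.ext_iff]
  refine sum_congr rfl fun x hx => ?_
  rw [(mem_filter.1 hx).2.1, (mem_filter.1 hx).2.2]

lemma card_eq (h : BlockSet w₀ Q W b ℓ N a A) : (A.card : ℝ) = 2 * a * N := by
  have := h.sum_eq fun _ _ => 1
  simp only [sum_const, card_range, nsmul_eq_mul, mul_one] at this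
  have h2 : A.card = a * (N * 2) := by exact_mod_cast this
  rw [h2]; push_cast; ring

end BlockSet

lemma norm_e_sub_e_le (x y : ℝ) : ‖e x - e y‖ ≤ 2 * Real.pi * |x - y| := by
  have h1 : e x - e y = e y * (e (x - y) - 1) := by
    rw [mul_sub, mul_one, ← e_add]; congr 2; ring
  rw [h1, norm_mul, norm_e, one_mul, norm_e_sub_one]
  have := Real.abs_sin_le_abs (x := Real.pi * (x - y))
  rw [abs_mul, abs_of_pos Real.pi_pos] at this
  linarith

lemma e_int_mul_nat_div_two (c : ℤ) (x : ℕ) :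
    e ((c:ℝ) / 2 * x) = e ((c:ℝ) / 2 * ((x % 2 : ℕ) : ℝ)) := by
  conv_lhs => rw [← Nat.mod_add_div x 2]
  generalize x / 2 = y
  have : (c:ℝ) / 2 * ((x % 2 + 2 * y : ℕ) : ℝ) =
      (c:ℝ) / 2 * ((x % 2 : ℕ) : ℝ) + ((c * y : ℤ) : ℝ) := by
    push_cast; ring
  rw [this, e_add_int]

lemma dir_int_div_eq_zero {J : ℕ} (hJ : 0 < J) {s : ℤ} (hs : ¬ (J:ℤ) ∣ s) :
    dir J ((s:ℝ) / J) = 0 := by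
  have hJr : (J:ℝ) ≠ 0 := by exact_mod_cast hJ.ne'
  have h := dir_mul_sub_one J ((s:ℝ) / J)
  rw [div_mul_cancel₀ _ hJr, e_int, sub_self, mul_eq_zero] at h
  refine h.resolve_right fun h2 => ?_
  rw [sub_eq_zero, e_eq_one_iff] at h2
  obtain ⟨n, hn⟩ := h2
  rw [div_eq_iff hJr] at hn
  exact hs ⟨n, by rw [mul_comm]; exact_mod_cast hn⟩

lemma norm_dir_le_sub {J N : ℕ} (hNJ : N ≤ J) {s : ℤ} (hs : s ≠ 0) (hsJ : |s| < J) :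
    ‖dir N ((s:ℝ) / J)‖ ≤ J - N := by
  have h0 : dir J ((s:ℝ) / J) = 0 :=
    dir_int_div_eq_zero (by have := abs_nonneg s; omega) fun hd =>
      hs (Int.eq_zero_of_abs_lt_dvd hd hsJ)
  have h1 := sum_range_add_sum_Ico (fun x : ℕ => e ((s:ℝ) / J * x)) hNJ
  have h2 : dir N ((s:ℝ) / J) = - ∑ x ∈ Ico N J, e ((s:ℝ) / J * x) := by
    rw [eq_neg_iff_add_eq_zero]
    exact h1.trans h0
  rw [h2, norm_neg]
  refine (norm_sum_le _ _).trans ?_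
  simp [norm_e, Nat.cast_sub hNJ]

/-- The Fourier transform of a block set is small at frequencies close to, but different from,
integers, and at frequencies close to half-integers. -/
lemma BlockSet.norm_hat_le_near {w₀ Q W b ℓ N a J : ℕ} {A : Finset ℕ}
    (h : BlockSet w₀ Q W b ℓ N a A) (hNJ : N ≤ J) (hℓ : 0 < ℓ) {r : ℕ} (hr0 : 0 < r)
    (hrM : r < J * ℓ) {s c : ℤ} (hsc : 2 * (r:ℤ) = s + c * (J * ℓ : ℕ)) (hs : |s| < 2 * J) :
    ‖hat A ((r:ℝ) / (J * ℓ : ℕ))‖ ≤ A.card * (Real.pi * |(s:ℝ)| / J) + 2 * a * (J - N) := by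
  have hJ : 0 < J := Nat.pos_of_ne_zero fun h0 => by simp [h0] at hrM
  have hJr : (0:ℝ) < J := by exact_mod_cast hJ
  have hℓr : (0:ℝ) < ℓ := by exact_mod_cast hℓ
  have hθ : (r:ℝ) / (J * ℓ : ℕ) = (c:ℝ) / 2 + s / (2 * (J * ℓ)) := by
    have h2 : 2 * (r:ℝ) = s + c * (J * ℓ) := by exact_mod_cast hsc
    push_cast
    field_simp
    linarith
  set g : ℕ → ℕ → ℂ := fun j d => e ((c:ℝ) / 2 * d) * e (s / (2 * J) * j) with hg
  have happrox : ∀ x ∈ A, ‖e ((r:ℝ) / (J * ℓ : ℕ) * x) - g (x / ℓ) (x % 2)‖ ≤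
      Real.pi * |(s:ℝ)| / J := by
    intro x _
    rw [hθ, add_mul, e_add, e_int_mul_nat_div_two, hg]
    simp only
    rw [← mul_sub, norm_mul, norm_e, one_mul]
    refine (norm_e_sub_e_le _ _).trans ?_
    have hx : (x:ℝ) = ((x % ℓ : ℕ) : ℝ) + ℓ * ((x / ℓ : ℕ) : ℝ) := by
      exact_mod_cast (Nat.mod_add_div x ℓ).symm
    have h3 : (s:ℝ) / (2 * (J * ℓ)) * x - s / (2 * J) * ((x / ℓ : ℕ) : ℝ) =
        s / (2 * J) * (((x % ℓ : ℕ) : ℝ) / ℓ) := by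
      rw [hx]
      field_simp
      ring
    have h4 : ((x % ℓ : ℕ) : ℝ) / ℓ ≤ 1 := by
      rw [div_le_one hℓr]
      exact_mod_cast (Nat.mod_lt x hℓ).le
    rw [h3, abs_mul, abs_div, abs_of_pos (by positivity : (0:ℝ) < 2 * J),
      abs_of_nonneg (by positivity : (0:ℝ) ≤ ((x % ℓ : ℕ) : ℝ) / ℓ)]
    calc 2 * Real.pi * (|(s:ℝ)| / (2 * J) * (((x % ℓ : ℕ) : ℝ) / ℓ))
        ≤ 2 * Real.pi * (|(s:ℝ)| / (2 * J) * 1) := by gcongr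
      _ = _ := by field_simp
  have hgsum : ∑ x ∈ A, g (x / ℓ) (x % 2) = a * ((1 + e ((c:ℝ) / 2)) * dir N (s / (2 * J))) := by
    rw [h.sum_eq g, dir]
    congr 1
    rw [mul_sum]
    refine sum_congr rfl fun j _ => ?_
    simp only [hg, sum_range_succ, range_zero, sum_empty, zero_add, Nat.cast_zero, mul_zero, e_zero,
      Nat.cast_one, mul_one]
    ring
  have hgnorm : ‖∑ x ∈ A, g (x / ℓ) (x % 2)‖ ≤ 2 * a * (J - N) := by
    have hJN : (0:ℝ) ≤ J - N := by
      rw [sub_nonneg]; exact_mod_cast hNJ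
    rw [hgsum, norm_mul, norm_mul, Complex.norm_natCast]
    rcases Int.even_or_odd' c with ⟨c', hc | hc⟩
    · have hs' : s = 2 * (r - c' * (J * ℓ : ℕ)) := by
        rw [hc] at hsc; linarith
      set s' : ℤ := r - c' * (J * ℓ : ℕ) with hs'def
      have hs0 : s' ≠ 0 := by
        intro h0
        rw [h0] at hs'def
        have h1 : (r:ℤ) = c' * (J * ℓ : ℕ) := by linarith
        have h2 : (0:ℤ) < c' * (J * ℓ : ℕ) := by omega
        have h3 : 0 < c' := pos_of_mul_pos_left h2 (by positivity)
        have h4 : 1 * ((J * ℓ : ℕ) : ℤ) ≤ c' * (J * ℓ : ℕ) :=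
          mul_le_mul_of_nonneg_right (by omega) (by positivity)
        omega
      have hsJ : |s'| < J := by
        rw [hs', abs_mul, abs_two] at hs
        omega
      have h1 : (s:ℝ) / (2 * J) = s' / J := by
        rw [hs']; push_cast; field_simp
      have h2 := norm_dir_le_sub hNJ hs0 hsJ
      have h3 : ‖1 + e ((c:ℝ) / 2)‖ ≤ 2 := by
        refine (norm_add_le _ _).trans ?_
        rw [norm_one, norm_e]; norm_num
      rw [h1]
      calc (a:ℝ) * (‖1 + e ((c:ℝ) / 2)‖ * ‖dir N ((s':ℝ) / J)‖) ≤ a * (2 * (J - N)) := by gcongr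
        _ = _ := by ring
    · have h1 : 1 + e ((c:ℝ) / 2) = 0 := by
        have h2 : (c:ℝ) / 2 = 1 / 2 + c' := by rw [hc]; push_cast; ring
        rw [h2, e_add_int, e]
        have : (2 * Real.pi * ((1/2 : ℝ) : ℂ) * Complex.I : ℂ) = Real.pi * Complex.I := by
          push_cast; ring
        rw [this, Complex.exp_pi_mul_I]
        norm_num
      rw [h1, norm_zero, zero_mul, mul_zero]
      positivity
  have hsplit : hat A ((r:ℝ) / (J * ℓ : ℕ)) =
      ∑ x ∈ A, (e ((r:ℝ) / (J * ℓ : ℕ) * x) - g (x / ℓ) (x % 2)) +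
        ∑ x ∈ A, g (x / ℓ) (x % 2) := by
    rw [sum_sub_distrib, sub_add_cancel, hat]
  rw [hsplit]
  refine (norm_add_le _ _).trans (add_le_add ?_ hgnorm)
  refine (norm_sum_le _ _).trans ?_
  rw [← nsmul_eq_mul]
  exact sum_le_card_nsmul _ _ _ happrox

end

section

open Finset Filter

lemma norm_dir_neg (L : ℕ) (θ : ℝ) : ‖dir L (-θ)‖ = ‖dir L θ‖ := norm_hat_neg (range L) θ

lemma norm_dir_le_of_far {M : ℕ} (hM : 0 < M) (L : ℕ) {q : ℤ} {K : ℝ} (hK : 0 < K)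
    (h : ∀ c : ℤ, K ≤ |(q:ℝ) - c * M|) : ‖dir L ((q:ℝ) / M)‖ ≤ M / K := by
  have hMr : (0:ℝ) < M := by exact_mod_cast hM
  set f := Int.fract ((q:ℝ) / M) with hf
  have hfq : f * M = q - ⌊(q:ℝ) / M⌋ * M := by
    rw [hf, Int.fract]
    field_simp
  have h0 : 0 ≤ f := Int.fract_nonneg _
  have h1 : f < 1 := Int.fract_lt_one _
  have h2 : K ≤ f * M := by
    have := h ⌊(q:ℝ) / M⌋
    rwa [← hfq, abs_of_nonneg (by positivity)] at this
  have h3 : K ≤ (1 - f) * M := by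
    have := h (⌊(q:ℝ) / M⌋ + 1)
    have e1 : (q:ℝ) - ((⌊(q:ℝ) / M⌋ + 1 : ℤ) : ℝ) * M = -((1 - f) * M) := by
      push_cast; linarith
    rwa [e1, abs_neg, abs_of_nonneg (mul_nonneg (by linarith) hMr.le)] at this
  have hf0 : 0 < f := by
    by_contra hcon
    have : f = 0 := le_antisymm (not_lt.1 hcon) h0
    rw [this, zero_mul] at h2
    linarith
  rw [← dir_fract]
  refine (norm_dir_le_div hf0 h1).trans ?_
  have h4 : 1 / f ≤ M / K := by
    rw [div_le_div_iff₀ hf0 hK]; linarith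
  have h5 : 1 / (1 - f) ≤ M / K := by
    rw [div_le_div_iff₀ (by linarith) hK]; linarith
  linarith

namespace BlockSet

variable {w₀ W b ℓ N a E M : ℕ} {A : Finset ℕ}

lemma mul_sum_norm_hat_sq_le (h : BlockSet w₀ (level M) W b ℓ N a A) (hM : 1 ≤ M)
    (hw : 5 ^ 10 ≤ w₀)
    (hd : (ℓ:ℝ) ≤ 9 / 4 * (Real.log (level M) * eulerProd w₀) * (2 * a)) {L : ℕ}
    (hL : A ⊆ range L) {ι : Type*} (R : Finset ι) (θ : ι → ℝ) {G : ℝ} (hG0 : 0 ≤ G)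
    (hG : ∀ r ∈ R, ∑ s ∈ R, ‖dir L (θ r - θ s)‖ ≤ G) :
    ℓ * N * ∑ r ∈ R, ‖hat A (θ r)‖ ^ 2 ≤ 9 / 4 * A.card ^ 2 *
      (G + R.card * (2 * L * (w₀:ℝ) ^ (-(9/10) : ℝ) + sieveErr (level M))) := by
  have h1 := sum_norm_hat_sq_le hw (one_le_level hM)
    (fun p hp => h.coprime p (prime_of_mem_sievePrimes hp) (lt_of_mem_sievePrimes hp)) hL
    h.sifted R θ hG0 hG
  have hm1 := one_le_mass (S := sievePrimes w₀ (level M))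
    (fun p hp => prime_of_mem_sievePrimes hp) (one_le_level hM)
  have hm : Real.log (level M) * eulerProd w₀ ≤ mass (sievePrimes w₀ (level M)) (level M) :=
    log_mul_prod_le_mass w₀ _
  have he := sieveErr_nonneg (level M)
  set X := G + R.card * (2 * L * (w₀:ℝ) ^ (-(9/10) : ℝ) + sieveErr (level M)) with hX
  have hX0 : 0 ≤ X := by positivity
  set μ := mass (sievePrimes w₀ (level M)) (level M) with hμ
  have hμ0 : 0 < μ := by linarith
  have h2 : (ℓ:ℝ) * N ≤ 9 / 4 * μ * A.card := by
    rw [h.card_eq]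
    calc (ℓ:ℝ) * N ≤ 9 / 4 * (Real.log (level M) * eulerProd w₀) * (2 * a) * N := by gcongr
      _ ≤ 9 / 4 * μ * (2 * a) * N := by gcongr
      _ = _ := by ring
  calc _ ≤ ℓ * N * (A.card * (μ⁻¹ * X)) := by gcongr
    _ ≤ 9 / 4 * μ * A.card * (A.card * (μ⁻¹ * X)) := by gcongr
    _ = _ := by field_simp

/-- A set with many blocks has small second moment over any bounded set of frequencies. -/
lemma sum_norm_hat_sq_le (h : BlockSet w₀ (level M) W b ℓ ((E - 2) * (4001 * E)) a A)
    (hE : 10 ^ 6 ≤ E) (hℓ : 0 < ℓ) (hM : M = E * (4001 * E) * ℓ) (hw : 5 ^ 10 ≤ w₀)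
    (hd : (ℓ:ℝ) ≤ 9 / 4 * (Real.log (level M) * eulerProd w₀) * (2 * a)) {R : Finset ℕ}
    (hR : R ⊆ range M)
    (herr : R.card * (2 * M * (w₀:ℝ) ^ (-(9/10) : ℝ) + sieveErr (level M)) ≤ (M:ℝ) / 100) :
    ∑ r ∈ R, ‖hat A ((r:ℝ) / M)‖ ^ 2 ≤ 23 / 10 * A.card ^ 2 := by
  have hEr : (10:ℝ) ^ 6 ≤ E := by exact_mod_cast hE
  have hℓr : (0:ℝ) < ℓ := by exact_mod_cast hℓ
  have hM1 : 1 ≤ M := by rw [hM]; exact Nat.succ_le_of_lt (by positivity)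
  have hM0 : (0:ℝ) < M := by exact_mod_cast hM1
  have hAM : A ⊆ range M := h.subset.trans (range_subset_range.2 (by
    rw [hM]
    exact Nat.mul_le_mul_right _ (Nat.mul_le_mul_right _ (Nat.sub_le _ _))))
  have h1 := h.mul_sum_norm_hat_sq_le hM1 hw hd hAM R (fun r => (r:ℝ) / M) (G := M) hM0.le
    fun r hr => (sum_norm_dir_div hR hr).le
  have hN : (ℓ:ℝ) * (((E - 2) * (4001 * E) : ℕ) : ℝ) = M * (1 - 2 / E) := by
    rw [hM]; push_cast [Nat.cast_sub (by omega : 2 ≤ E)]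
    field_simp
  have h2E : (2:ℝ) / E ≤ 1 / 1000 := by
    rw [div_le_div_iff₀ (by positivity) (by positivity)]; linarith
  rw [hN] at h1
  set Y := ∑ r ∈ R, ‖hat A ((r:ℝ) / M)‖ ^ 2 with hY
  have hY0 : 0 ≤ Y := sum_nonneg fun _ _ => by positivity
  have h3 : M * (999 / 1000) * Y ≤ 9 / 4 * (A.card:ℝ) ^ 2 * (M * (101 / 100)) := by
    calc _ ≤ M * (1 - 2 / E) * Y := by gcongr; linarith
      _ ≤ _ := h1
      _ ≤ _ := by gcongr; linarith
  have h4 : M * Y ≤ M * (23 / 10 * (A.card:ℝ) ^ 2) := by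
    have : 0 ≤ (M:ℝ) * A.card ^ 2 := by positivity
    nlinarith
  exact le_of_mul_le_mul_left h4 hM0

/-- A set with few blocks is far from being biased at frequencies away from half-integers. -/
lemma norm_hat_sq_le_of_far (h : BlockSet w₀ (level M) W b ℓ (4001 * E) a A)
    (hE : 0 < E) (hℓ : 0 < ℓ) (hM : M = E * (4001 * E) * ℓ) (hw : 5 ^ 10 ≤ w₀)
    (hd : (ℓ:ℝ) ≤ 9 / 4 * (Real.log (level M) * eulerProd w₀) * (2 * a))
    (herr : 3 * (2 * M * (w₀:ℝ) ^ (-(9/10) : ℝ) + E * sieveErr (level M)) ≤ (M:ℝ) / 200)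
    {r : ℕ} (hfar : ∀ s c : ℤ, 2 * (r:ℤ) = s + c * M → 400 * (E:ℤ) ≤ |s|) :
    ‖hat A ((r:ℝ) / M)‖ ^ 2 ≤ 65 / 100 * A.card ^ 2 := by
  have hEr : (0:ℝ) < E := by exact_mod_cast hE
  have hℓr : (0:ℝ) < ℓ := by exact_mod_cast hℓ
  have hM1 : 1 ≤ M := by rw [hM]; exact Nat.succ_le_of_lt (by positivity)
  have hM0 : (0:ℝ) < M := by exact_mod_cast hM1
  set L := 4001 * E * ℓ with hL
  have hML : (M:ℝ) = E * L := by rw [hM, hL]; push_cast; ring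
  have hL0 : (0:ℝ) < L := by rw [hL]; positivity
  set θ : ℝ := (r:ℝ) / M with hθ
  have hd1 : ‖dir L θ‖ ≤ L / 200 := by
    have := norm_dir_le_of_far hM1 L (q := (r:ℤ)) (K := 200 * E) (by positivity) fun c => by
      have h1 := hfar (2 * r - (2 * c) * M) (2 * c) (by ring)
      have h2 : (400:ℝ) * E ≤ |2 * (r:ℝ) - (2 * c) * M| := by exact_mod_cast h1
      rw [show 2 * (r:ℝ) - (2 * c) * M = 2 * (r - c * M) by ring, abs_mul, abs_two] at h2
      push_cast
      linarith
    rw [Int.cast_natCast] at this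
    refine this.trans (le_of_eq ?_)
    rw [hML]
    field_simp
  have hd2 : ‖dir L (2 * θ)‖ ≤ L / 200 := by
    have := norm_dir_le_of_far hM1 L (q := (2 * r : ℤ)) (K := 200 * E) (by positivity) fun c => by
      have h1 := hfar (2 * r - c * M) c (by ring)
      have h2 : (400:ℝ) * E ≤ |2 * (r:ℝ) - c * M| := by exact_mod_cast h1
      push_cast
      linarith
    push_cast at this
    rw [mul_div_assoc] at this
    refine this.trans (le_of_eq ?_)
    rw [hML]
    field_simp
  have hself : ‖dir L 0‖ = L := by simp [dir]
  set φ : Fin 3 → ℝ := ![0, θ, -θ] with hφ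
  have hrow : ∀ i ∈ (univ : Finset (Fin 3)), ∑ j, ‖dir L (φ i - φ j)‖ ≤ L + 2 * (L / 200) := by
    have e1 : ‖dir L (-θ)‖ ≤ L / 200 := by rwa [norm_dir_neg]
    have e2 : ‖dir L (-θ - θ)‖ ≤ L / 200 := by
      rwa [show -θ - θ = -(2 * θ) by ring, norm_dir_neg]
    have e3 : ‖dir L (θ - -θ)‖ ≤ L / 200 := by rwa [show θ - -θ = 2 * θ by ring]
    intro i _
    rw [Fin.sum_univ_three]
    fin_cases i
    · simp only [hφ, Fin.zero_eta, Matrix.cons_val, sub_zero, zero_sub, neg_neg, hself]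
      linarith
    · simp only [hφ, Fin.mk_one, Matrix.cons_val, sub_zero, sub_self, hself]
      linarith
    · simp only [hφ, Fin.reduceFinMk, Matrix.cons_val, sub_zero, sub_self, hself]
      linarith
  have h1 := h.mul_sum_norm_hat_sq_le hM1 hw hd h.subset univ φ (by positivity) hrow
  rw [Fin.sum_univ_three] at h1
  simp only [hφ, Matrix.cons_val] at h1
  rw [hat_zero, norm_hat_neg, Complex.norm_natCast, card_univ, Fintype.card_fin] at h1
  have hN : (ℓ:ℝ) * ((4001 * E : ℕ) : ℝ) = L := by rw [hL]; push_cast; ring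
  rw [hN, ← hL] at h1
  set Y := ‖hat A θ‖ ^ 2 with hY
  set n : ℝ := (A.card : ℝ) with hn
  have herr2 : 3 * (2 * L * (w₀:ℝ) ^ (-(9/10) : ℝ) + sieveErr (level M)) ≤ (L:ℝ) / 200 := by
    rw [hML] at herr
    have : E * (3 * (2 * L * (w₀:ℝ) ^ (-(9/10) : ℝ) + sieveErr (level M))) ≤ E * ((L:ℝ) / 200) := by
      linarith
    exact le_of_mul_le_mul_left this hEr
  have h2 : L * (n ^ 2 + Y + Y) ≤ L * (23 / 10 * n ^ 2) := by
    calc _ ≤ _ := h1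
      _ ≤ 9 / 4 * n ^ 2 * (L + 2 * (L / 200) + L / 200) := by
          push_cast
          gcongr
      _ ≤ _ := by
          have : 0 ≤ (L:ℝ) * n ^ 2 := by positivity
          linarith
  have h3 := le_of_mul_le_mul_left h2 hL0
  linarith

lemma norm_hat_le_div (h : BlockSet w₀ (level M) W b ℓ ((E - 2) * (4001 * E)) a A)
    (hE : 10 ^ 6 ≤ E) (hℓ : 0 < ℓ) (hM : M = E * (4001 * E) * ℓ) {r : ℕ} (hr0 : 0 < r)
    (hrM : r < M) {s c : ℤ} (hsc : 2 * (r:ℤ) = s + c * M) (hs : |s| < 400 * E) :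
    ‖hat A ((r:ℝ) / M)‖ ≤ 3 / E * A.card := by
  have hEr : (10:ℝ) ^ 6 ≤ E := by exact_mod_cast hE
  have hE0 : (0:ℝ) < E := by positivity
  have hNJ : (E - 2) * (4001 * E) ≤ E * (4001 * E) := Nat.mul_le_mul_right _ (Nat.sub_le _ _)
  subst hM
  have h1 := h.norm_hat_le_near hNJ hℓ hr0 hrM hsc (hs.trans_le (by push_cast; nlinarith))
  refine h1.trans ?_
  have hs' : |(s:ℝ)| ≤ 400 * E := by exact_mod_cast hs.le
  have h2 : Real.pi * |(s:ℝ)| / ((E * (4001 * E) : ℕ) : ℝ) ≤ (1/2) / E := by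
    push_cast
    rw [div_le_div_iff₀ (by positivity) (by positivity)]
    have hpi := Real.pi_lt_four
    have h3 : Real.pi * |(s:ℝ)| ≤ 4 * (400 * E) := by gcongr
    nlinarith
  have h3 : 2 * (a:ℝ) * (((E * (4001 * E) : ℕ) : ℝ) - (((E - 2) * (4001 * E) : ℕ) : ℝ)) ≤
      (5/2) / E * A.card := by
    rw [h.card_eq]
    push_cast [Nat.cast_sub (by omega : 2 ≤ E)]
    have h4 : 2 * (E:ℝ) ≤ 5/2 * (E - 2) := by linarith
    have h5 : (5/2) / (E:ℝ) * (2 * a * ((E - 2) * (4001 * E))) =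
        2 * a * (4001 * (5/2 * (E - 2))) := by field_simp
    rw [h5]
    calc _ = 2 * a * (4001 * (2 * (E:ℝ))) := by ring
      _ ≤ _ := by gcongr
  calc _ ≤ (A.card:ℝ) * ((1/2) / E) + (5/2) / E * A.card := by gcongr
    _ = _ := by ring

end BlockSet

end

/-! ### Solving a congruence in four sifted sets -/

section

open Finset Filter

/-- If a residue is not represented as a sum, the nonzero frequencies balance the main term. -/
lemma card_prod_le_sum_norm_hat {M : ℕ} (hM : 0 < M) {A₁ A₂ A₃ A₄ : Finset ℕ} {T : ℕ}
    (h : ∀ x₁ ∈ A₁, ∀ x₂ ∈ A₂, ∀ x₃ ∈ A₃, ∀ x₄ ∈ A₄, ¬ x₁ + x₂ + x₃ + x₄ ≡ T [MOD M]) :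
    (A₁.card * A₂.card * A₃.card * A₄.card : ℝ) ≤ ∑ r ∈ (range M).erase 0,
      ‖hat A₁ ((r:ℝ) / M)‖ * ‖hat A₂ ((r:ℝ) / M)‖ * ‖hat A₃ ((r:ℝ) / M)‖ *
        ‖hat A₄ ((r:ℝ) / M)‖ := by
  set f : ℕ → ℂ := fun r => hat A₁ ((r:ℝ) / M) * hat A₂ ((r:ℝ) / M) * hat A₃ ((r:ℝ) / M) *
    hat A₄ ((r:ℝ) / M) * e (-((T:ℝ) / M) * r) with hf
  have hzero : ∑ r ∈ range M, f r = 0 := by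
    have h1 : ∀ r, f r = ∑ x₁ ∈ A₁, ∑ x₂ ∈ A₂, ∑ x₃ ∈ A₃, ∑ x₄ ∈ A₄,
        e ((((x₁ + x₂ + x₃ + x₄ : ℤ) - T : ℤ) : ℝ) / M * r) := by
      intro r
      simp only [hf, hat]
      rw [sum_mul, sum_mul, sum_mul, sum_mul]
      refine sum_congr rfl fun x₁ _ => ?_
      rw [mul_sum A₂, sum_mul, sum_mul, sum_mul]
      refine sum_congr rfl fun x₂ _ => ?_
      rw [mul_sum A₃, sum_mul, sum_mul]
      refine sum_congr rfl fun x₃ _ => ?_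
      rw [mul_sum, sum_mul]
      refine sum_congr rfl fun x₄ _ => ?_
      rw [← e_add, ← e_add, ← e_add, ← e_add]
      congr 1
      push_cast
      ring
    simp_rw [h1]
    rw [sum_comm]
    refine sum_eq_zero fun x₁ h₁ => ?_
    rw [sum_comm]
    refine sum_eq_zero fun x₂ h₂ => ?_
    rw [sum_comm]
    refine sum_eq_zero fun x₃ h₃ => ?_
    rw [sum_comm]
    refine sum_eq_zero fun x₄ h₄ => ?_
    refine dir_int_div_eq_zero hM fun hd => h x₁ h₁ x₂ h₂ x₃ h₃ x₄ h₄ ?_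
    rw [Nat.modEq_iff_dvd, ← dvd_neg, neg_sub]
    exact_mod_cast hd
  rw [← add_sum_erase _ _ (mem_range.2 hM)] at hzero
  have h0 : f 0 = A₁.card * A₂.card * A₃.card * A₄.card := by
    simp [hf, hat_zero]
  have h2 : (A₁.card * A₂.card * A₃.card * A₄.card : ℝ) = ‖∑ r ∈ (range M).erase 0, f r‖ := by
    rw [← norm_neg, ← eq_neg_of_add_eq_zero_left hzero, h0]
    simp
  rw [h2]
  refine (norm_sum_le _ _).trans (le_of_eq (sum_congr rfl fun r _ => ?_))
  simp only [hf, norm_mul, norm_e, mul_one]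

lemma mul_four_le_fourth_powers {x₁ x₂ x₃ x₄ t : ℝ} (ht : 0 < t) :
    x₁ * x₂ * x₃ * x₄ ≤ (t * (x₁ ^ 4 + x₃ ^ 4) + t⁻¹ * (x₂ ^ 4 + x₄ ^ 4)) / 4 := by
  have h1 : (x₁ * x₃) ^ 2 ≤ (x₁ ^ 4 + x₃ ^ 4) / 2 := by nlinarith [sq_nonneg (x₁ ^ 2 - x₃ ^ 2)]
  have h2 : (x₂ * x₄) ^ 2 ≤ (x₂ ^ 4 + x₄ ^ 4) / 2 := by nlinarith [sq_nonneg (x₂ ^ 2 - x₄ ^ 2)]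
  have h3 : (x₁ * x₃) * (x₂ * x₄) ≤ (t * (x₁ * x₃) ^ 2 + t⁻¹ * (x₂ * x₄) ^ 2) / 2 := by
    have : 0 ≤ t⁻¹ * (t * (x₁ * x₃) - x₂ * x₄) ^ 2 := by positivity
    have e1 : t⁻¹ * (t * (x₁ * x₃) - x₂ * x₄) ^ 2 =
        t * (x₁ * x₃) ^ 2 + t⁻¹ * (x₂ * x₄) ^ 2 - 2 * ((x₁ * x₃) * (x₂ * x₄)) := by
      field_simp
      ring
    linarith
  have h4 := mul_le_mul_of_nonneg_left h1 ht.le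
  have h5 := mul_le_mul_of_nonneg_left h2 (inv_pos.2 ht).le
  linarith

/-- Combination of the estimates on the three ranges of frequencies. -/
lemma sum_mul_lt_one {S P R : Finset ℕ} {u₁ u₂ u₃ u₄ : ℕ → ℝ} {δ B t : ℝ}
    (h₁ : ∀ r, 0 ≤ u₁ r) (h₂ : ∀ r, 0 ≤ u₂ r) (h₃ : ∀ r, 0 ≤ u₃ r) (h₄ : ∀ r, 0 ≤ u₄ r)
    (h₂' : ∀ r, u₂ r ≤ 1) (h₄' : ∀ r, u₄ r ≤ 1) (hP : P ⊆ S) (hR : R ⊆ S)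
    (hP₁ : ∀ r ∈ P, u₁ r ≤ δ) (hP₃ : ∀ r ∈ P, u₃ r ≤ δ) (hδ : P.card * δ ^ 2 ≤ 3 / 100)
    (hS₂ : ∀ r ∈ S, r ∉ P → u₂ r ^ 2 ≤ 65 / 100) (hS₄ : ∀ r ∈ S, r ∉ P → u₄ r ^ 2 ≤ 65 / 100)
    (hR₁ : ∑ r ∈ R, u₁ r ^ 2 ≤ 13 / 10) (hR₃ : ∑ r ∈ R, u₃ r ^ 2 ≤ 13 / 10)
    (ht : 0 < t) (hBt : B / t ≤ 1 / 100)
    (hT₁ : ∑ r ∈ S \ R, u₁ r ^ 4 ≤ B / t ^ 2) (hT₃ : ∑ r ∈ S \ R, u₃ r ^ 4 ≤ B / t ^ 2)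
    (hT₂ : ∑ r ∈ S \ R, u₂ r ^ 4 ≤ B) (hT₄ : ∑ r ∈ S \ R, u₄ r ^ 4 ≤ B) :
    ∑ r ∈ S, u₁ r * u₂ r * u₃ r * u₄ r < 1 := by
  have hnn : ∀ r, 0 ≤ u₁ r * u₂ r * u₃ r * u₄ r := fun r =>
    mul_nonneg (mul_nonneg (mul_nonneg (h₁ r) (h₂ r)) (h₃ r)) (h₄ r)
  have hpt : ∀ r ∈ S, u₁ r * u₂ r * u₃ r * u₄ r ≤
      (if r ∈ P then δ ^ 2 else 0) +
      (if r ∈ R then 65 / 100 * ((u₁ r ^ 2 + u₃ r ^ 2) / 2) else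
        (t * (u₁ r ^ 4 + u₃ r ^ 4) + t⁻¹ * (u₂ r ^ 4 + u₄ r ^ 4)) / 4) := by
    intro r hr
    by_cases hrP : r ∈ P
    · rw [if_pos hrP]
      have hδ0 : 0 ≤ δ := (h₁ r).trans (hP₁ r hrP)
      have h5 : u₁ r * u₂ r * u₃ r * u₄ r ≤ δ * 1 * δ * 1 := by
        have := h₁ r; have := h₂ r; have := h₃ r; have := h₄ r
        gcongr
        · exact hP₁ r hrP
        · exact h₂' r
        · exact hP₃ r hrP
        · exact h₄' r
      have h6 : 0 ≤ (if r ∈ R then 65 / 100 * ((u₁ r ^ 2 + u₃ r ^ 2) / 2) else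
          (t * (u₁ r ^ 4 + u₃ r ^ 4) + t⁻¹ * (u₂ r ^ 4 + u₄ r ^ 4)) / 4) := by
        split_ifs <;> positivity
      linarith
    · rw [if_neg hrP, zero_add]
      split_ifs with hrR
      · have h5 : u₂ r * u₄ r ≤ 65 / 100 := by
          nlinarith [sq_nonneg (u₂ r - u₄ r), hS₂ r hr hrP, hS₄ r hr hrP]
        have h6 : u₁ r * u₃ r ≤ (u₁ r ^ 2 + u₃ r ^ 2) / 2 := by
          nlinarith [sq_nonneg (u₁ r - u₃ r)]
        calc u₁ r * u₂ r * u₃ r * u₄ r = (u₂ r * u₄ r) * (u₁ r * u₃ r) := by ring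
          _ ≤ _ := mul_le_mul h5 h6 (mul_nonneg (h₁ r) (h₃ r)) (by norm_num)
      · exact mul_four_le_fourth_powers ht
  refine (sum_le_sum hpt).trans_lt ?_
  rw [sum_add_distrib, sum_ite_mem, inter_eq_right.2 hP, sum_const, nsmul_eq_mul, sum_ite]
  have e1 : S.filter (fun r => r ∈ R) = R := by
    rw [filter_mem_eq_inter, inter_eq_right.2 hR]
  have e2 : S.filter (fun r => r ∉ R) = S \ R := by
    rw [filter_not, e1]
  rw [e1, e2, ← mul_sum, ← sum_div, sum_add_distrib, ← sum_div, sum_add_distrib, ← mul_sum,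
    ← mul_sum, sum_add_distrib, sum_add_distrib]
  have h7 : t * (∑ r ∈ S \ R, u₁ r ^ 4 + ∑ r ∈ S \ R, u₃ r ^ 4) ≤ 2 * (B / t) := by
    calc _ ≤ t * (B / t ^ 2 + B / t ^ 2) := by gcongr
      _ = _ := by field_simp; ring
  have h8 : t⁻¹ * (∑ r ∈ S \ R, u₂ r ^ 4 + ∑ r ∈ S \ R, u₄ r ^ 4) ≤ 2 * (B / t) := by
    calc _ ≤ t⁻¹ * (B + B) := by gcongr
      _ = _ := by field_simp; ring
  linarith

open Classical in
/-- The nonzero frequencies close to half-integers. -/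
noncomputable def nearHalf (E M : ℕ) : Finset ℕ :=
  ((range M).erase 0).filter fun r =>
    ∃ s c : ℤ, 0 ≤ c ∧ c ≤ 2 ∧ |s| < 400 * E ∧ 2 * (r:ℤ) = s + c * M

lemma card_nearHalf_le (E M : ℕ) : (nearHalf E M).card ≤ (800 * E + 1) * 3 := by
  classical
  have hsub : nearHalf E M ⊆ ((Finset.Icc (-(400 * E : ℤ)) (400 * E)) ×ˢ
      (Finset.Icc (0:ℤ) 2)).image fun sc => Int.toNat ((sc.1 + sc.2 * (M:ℤ)) / 2) := by
    intro r hr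
    rw [nearHalf, mem_filter] at hr
    obtain ⟨s, c, hc0, hc2, hs, h⟩ := hr.2
    rw [abs_lt] at hs
    rw [mem_image]
    refine ⟨(s, c), mem_product.2 ⟨Finset.mem_Icc.2 ⟨by omega, by omega⟩, Finset.mem_Icc.2 ⟨hc0, hc2⟩⟩, ?_⟩
    simp only
    rw [← h]
    omega
  refine (card_le_card hsub).trans (card_image_le.trans ?_)
  rw [card_product, Int.card_Icc, Int.card_Icc]
  refine Nat.mul_le_mul ?_ ?_
  · omega
  · norm_num

lemma far_of_notMem_nearHalf {E M r : ℕ} (hr : r ∈ (range M).erase 0) (h : r ∉ nearHalf E M)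
    (hEM : 400 * E ≤ M) {s c : ℤ} (hsc : 2 * (r:ℤ) = s + c * M) : 400 * (E:ℤ) ≤ |s| := by
  classical
  by_contra! hs
  have hrM : r < M := by simpa using (mem_erase.1 hr).2
  rw [nearHalf, mem_filter] at h
  have hEM' : 400 * (E:ℤ) ≤ M := by exact_mod_cast hEM
  have hs' := abs_lt.1 hs
  refine h ⟨hr, s, c, ?_, ?_, hs, hsc⟩
  · by_contra! hc
    have : c * (M:ℤ) ≤ -1 * M := mul_le_mul_of_nonneg_right (by omega) (by positivity)
    omega
  · by_contra! hc
    have : 3 * (M:ℤ) ≤ c * M := mul_le_mul_of_nonneg_right (by omega) (by positivity)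
    omega

end

section

open Finset Filter

lemma BlockSet.sieveSet {w₀ W b ℓ N a E M : ℕ} {A : Finset ℕ}
    (h : BlockSet w₀ (level M) W b ℓ N a A) (hM : M = E * (4001 * E) * ℓ) (hN : 4001 * E ≤ N)
    (hN' : N ≤ E * (4001 * E))
    (hd : (ℓ:ℝ) ≤ 9 / 4 * (Real.log (level M) * eulerProd w₀) * (2 * a)) :
    SieveSet w₀ (3 * E) M W b A where
  subset := h.subset.trans (range_subset_range.2 (by rw [hM]; exact Nat.mul_le_mul_right _ hN'))
  coprime := h.coprime
  sifted := h.sifted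
  dense := by
    have h1 : ((4001 * E : ℕ) : ℝ) ≤ N := by exact_mod_cast hN
    have h2 := eulerProd_pos w₀
    have h3 : 0 ≤ Real.log (level M) := Real.log_natCast_nonneg _
    rw [h.card_eq]
    calc (M:ℝ) = E * ((4001 * E : ℕ) : ℝ) * ℓ := by rw [hM]; push_cast; ring
      _ ≤ E * N * (9 / 4 * (Real.log (level M) * eulerProd w₀) * (2 * a)) := by gcongr
      _ ≤ E * N * (3 * (Real.log (level M) * eulerProd w₀) * (2 * a)) := by gcongr; norm_num
      _ = _ := by ring

lemma tail_normalized {A : Finset ℕ} {M i : ℕ} {B : ℝ} {U : Finset ℕ} (hA : 0 < (A.card : ℝ))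
    (hU : U ⊆ range M \ large A M i) (h : tail A M i ≤ B / 4 ^ i * A.card ^ 4) :
    ∑ r ∈ U, (‖hat A ((r:ℝ) / M)‖ / A.card) ^ 4 ≤ B / (2 ^ i) ^ 2 := by
  simp_rw [div_pow]
  rw [← sum_div, div_le_iff₀ (by positivity), ← pow_mul, mul_comm i 2, pow_mul,
    show (2:ℝ) ^ 2 = 4 by norm_num]
  exact (sum_le_sum_of_subset_of_nonneg hU fun _ _ _ => by positivity).trans h

lemma fourth_moment_normalized {A : Finset ℕ} {M : ℕ} {B : ℝ} {U : Finset ℕ}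
    (hA : 0 < (A.card : ℝ)) (hU : U ⊆ range M)
    (h : ∑ r ∈ range M, ‖hat A ((r:ℝ) / M)‖ ^ 4 ≤ B * A.card ^ 4) :
    ∑ r ∈ U, (‖hat A ((r:ℝ) / M)‖ / A.card) ^ 4 ≤ B := by
  simp_rw [div_pow]
  rw [← sum_div, div_le_iff₀ (by positivity)]
  exact (sum_le_sum_of_subset_of_nonneg hU fun _ _ _ => by positivity).trans h

lemma second_moment_normalized {A : Finset ℕ} {M : ℕ} {R : Finset ℕ} (hA : 0 < (A.card : ℝ))
    (h0 : 0 ∈ R) (h : ∑ r ∈ R, ‖hat A ((r:ℝ) / M)‖ ^ 2 ≤ 23 / 10 * A.card ^ 2) :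
    ∑ r ∈ R.erase 0, (‖hat A ((r:ℝ) / M)‖ / A.card) ^ 2 ≤ 13 / 10 := by
  simp_rw [div_pow]
  rw [← sum_div, div_le_iff₀ (by positivity)]
  rw [← add_sum_erase _ _ h0, Nat.cast_zero, zero_div, hat_zero, Complex.norm_natCast] at h
  linarith

lemma zero_mem_large {A : Finset ℕ} {M i : ℕ} (hM : 0 < M) : 0 ∈ large A M i := by
  rw [large, mem_filter, Nat.cast_zero, zero_div, hat_zero, Complex.norm_natCast]
  exact ⟨mem_range.2 hM, le_mul_of_one_le_left (by positivity) (one_le_pow₀ (by norm_num))⟩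

lemma BlockSet.card_pos {w₀ Q W b ℓ N a : ℕ} {A : Finset ℕ} (h : BlockSet w₀ Q W b ℓ N a A)
    (hN : 0 < N) (ha : 0 < a) : 0 < (A.card : ℝ) := by
  rw [h.card_eq]; positivity

set_option maxHeartbeats 1000000 in
/-- Four dense sifted sets, two long ones and two short ones, represent every residue as a
sum. -/
theorem exists_sum_modEq {E : ℕ} (hE : 10 ^ 6 ≤ E) : ∃ m₀ : ℕ, 5 ^ 10 ≤ 6 * m₀ ∧
    ∀ᶠ ℓ : ℕ in atTop, ∀ M : ℕ, M = E * (4001 * E) * ℓ →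
      ∀ (W a b₁ b₂ b₃ b₄ : ℕ) (A₁ A₂ A₃ A₄ : Finset ℕ),
      BlockSet (6 * m₀) (level M) W b₁ ℓ ((E - 2) * (4001 * E)) a A₁ →
      BlockSet (6 * m₀) (level M) W b₂ ℓ (4001 * E) a A₂ →
      BlockSet (6 * m₀) (level M) W b₃ ℓ ((E - 2) * (4001 * E)) a A₃ →
      BlockSet (6 * m₀) (level M) W b₄ ℓ (4001 * E) a A₄ →
      (ℓ:ℝ) ≤ 9 / 4 * (Real.log (level M) * eulerProd (6 * m₀)) * (2 * a) →
      ∀ T : ℕ, ∃ x₁ ∈ A₁, ∃ x₂ ∈ A₂, ∃ x₃ ∈ A₃, ∃ x₄ ∈ A₄,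
        x₁ + x₂ + x₃ + x₄ ≡ T [MOD M] := by
  have hEr : (10:ℝ) ^ 6 ≤ E := by exact_mod_cast hE
  have hE0 : (0:ℝ) < E := by positivity
  have hEn : 0 < E := by omega
  obtain ⟨B, hB, hmom⟩ := exists_fourth_moment_le (C := 3 * E) (by positivity)
  obtain ⟨i, hi⟩ : ∃ i : ℕ, B / 2 ^ i ≤ 1 / 100 := by
    obtain ⟨i, hi⟩ := pow_unbounded_of_one_lt (100 * B) (by norm_num : (1:ℝ) < 2)
    refine ⟨i, ?_⟩
    rw [div_le_div_iff₀ (by positivity) (by norm_num)]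
    linarith
  set K : ℝ := 2 * (B * 2 ^ (10 * i)) + 3 with hK
  have hK0 : 0 < K := by positivity
  obtain ⟨m₀, hm₀, hω⟩ : ∃ m₀ : ℕ, 5 ^ 10 ≤ 6 * m₀ ∧
      K * (2 * ((6 * m₀ : ℕ) : ℝ) ^ (-(9/10) : ℝ)) ≤ 1 / 1000 := by
    have h1 : Tendsto (fun m : ℕ => ((6 * m : ℕ) : ℝ)) atTop atTop :=
      tendsto_natCast_atTop_atTop.comp (tendsto_id.const_mul_atTop' (by norm_num : 0 < 6))
    have h2 : Tendsto (fun m : ℕ => K * (2 * ((6 * m : ℕ) : ℝ) ^ (-(9/10) : ℝ))) atTop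
        (nhds (K * (2 * 0))) :=
      (((tendsto_rpow_neg_atTop (by norm_num : (0:ℝ) < 9/10)).comp h1).const_mul 2).const_mul K
    rw [mul_zero, mul_zero] at h2
    have h3 := h2.eventually (ge_mem_nhds (by norm_num : (0:ℝ) < 1 / 1000))
    obtain ⟨m, hm1, hm2⟩ := (h3.and (eventually_ge_atTop (5 ^ 10))).exists
    exact ⟨m, by omega, hm1⟩
  refine ⟨m₀, hm₀, ?_⟩
  have htend : Tendsto (fun ℓ : ℕ => E * (4001 * E) * ℓ) atTop atTop :=
    tendsto_id.const_mul_atTop' (by positivity)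
  filter_upwards [htend.eventually (hmom m₀ hm₀ i),
    htend.eventually (eventually_log_pow_mul_sieveErr_le (1000 * K * E) 0),
    eventually_gt_atTop 0] with ℓ hmomM herrM hℓ M hM W a b₁ b₂ b₃ b₄ A₁ A₂ A₃ A₄ h₁ h₂ h₃ h₄ hd T
  rw [← hM] at hmomM herrM
  rw [pow_zero, mul_one] at herrM
  by_contra! hcon
  have hM0 : 0 < M := by rw [hM]; positivity
  have hMr : (0:ℝ) < M := by exact_mod_cast hM0
  have hEM : 400 * E ≤ M := by
    rw [hM]
    calc 400 * E ≤ 4001 * E := by omega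
      _ ≤ E * (4001 * E) := Nat.le_mul_of_pos_left _ hEn
      _ ≤ _ := Nat.le_mul_of_pos_right _ hℓ
  have ha : 0 < a := by
    by_contra h0
    have h1 : a = 0 := by omega
    rw [h1, Nat.cast_zero, mul_zero, mul_zero] at hd
    have : (0:ℝ) < ℓ := by exact_mod_cast hℓ
    linarith
  have hN1 : 4001 * E ≤ (E - 2) * (4001 * E) := Nat.le_mul_of_pos_left _ (by omega)
  have hN2 : (E - 2) * (4001 * E) ≤ E * (4001 * E) := Nat.mul_le_mul_right _ (Nat.sub_le _ _)
  have c₁ := h₁.card_pos (by omega) ha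
  have c₂ := h₂.card_pos (by omega) ha
  have c₃ := h₃.card_pos (by omega) ha
  have c₄ := h₄.card_pos (by omega) ha
  obtain ⟨l₁, t₁, -⟩ := hmomM W b₁ A₁ (h₁.sieveSet hM hN1 hN2 hd)
  obtain ⟨-, -, f₂⟩ := hmomM W b₂ A₂ (h₂.sieveSet hM le_rfl (hN1.trans hN2) hd)
  obtain ⟨l₃, t₃, -⟩ := hmomM W b₃ A₃ (h₃.sieveSet hM hN1 hN2 hd)
  obtain ⟨-, -, f₄⟩ := hmomM W b₄ A₄ (h₄.sieveSet hM le_rfl (hN1.trans hN2) hd)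
  set ω : ℝ := ((6 * m₀ : ℕ) : ℝ) ^ (-(9/10) : ℝ) with hωdef
  have hω0 : 0 ≤ ω := by positivity
  set err := sieveErr (level M) with herr
  have herr0 : 0 ≤ err := sieveErr_nonneg _
  have hKE : K * (2 * M * ω + E * err) ≤ M / 500 := by
    have : K * (2 * ω) * M ≤ 1 / 1000 * M := by gcongr
    linarith
  have hR'err : ((large A₁ M i ∪ large A₃ M i).card : ℝ) * (2 * M * ω + err) ≤ (M:ℝ) / 100 := by
    have h5 : ((large A₁ M i ∪ large A₃ M i).card : ℝ) ≤ K := by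
      have : ((large A₁ M i ∪ large A₃ M i).card : ℝ) ≤
          (large A₁ M i).card + (large A₃ M i).card := by exact_mod_cast card_union_le _ _
      linarith
    have h6 : err ≤ E * err := le_mul_of_one_le_left herr0 (by linarith)
    calc _ ≤ K * (2 * M * ω + E * err) := by gcongr
      _ ≤ _ := by linarith
  have h3err : 3 * (2 * M * ω + E * err) ≤ (M:ℝ) / 200 := by
    have h5 : 3 ≤ K := by rw [hK]; linarith [show 0 ≤ B * 2 ^ (10 * i) by positivity]
    calc _ ≤ K * (2 * M * ω + E * err) := by gcongr
      _ ≤ _ := by linarith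
  set R' := large A₁ M i ∪ large A₃ M i with hR'
  have hR'M : R' ⊆ range M := union_subset (filter_subset _ _) (filter_subset _ _)
  have h0R : 0 ∈ R' := mem_union_left _ (zero_mem_large hM0)
  set S := (range M).erase 0 with hS
  have hSR : S \ R'.erase 0 ⊆ range M \ R' := by
    intro r hr
    simp only [hS, Finset.mem_sdiff, mem_erase] at hr ⊢
    tauto
  have hSM : S \ R'.erase 0 ⊆ range M := hSR.trans sdiff_subset
  have hmemP : ∀ r ∈ nearHalf E M, 0 < r ∧ r < M ∧ ∃ s c : ℤ, |s| < 400 * E ∧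
      2 * (r:ℤ) = s + c * M := by
    classical
    intro r hr
    rw [nearHalf, mem_filter, mem_erase, mem_range] at hr
    obtain ⟨⟨hr0, hrM⟩, s, c, -, -, hs, hsc⟩ := hr
    exact ⟨Nat.pos_of_ne_zero hr0, hrM, s, c, hs, hsc⟩
  have hlt := sum_mul_lt_one (S := S) (P := nearHalf E M) (R := R'.erase 0)
    (u₁ := fun r => ‖hat A₁ ((r:ℝ) / M)‖ / A₁.card) (u₂ := fun r => ‖hat A₂ ((r:ℝ) / M)‖ / A₂.card)
    (u₃ := fun r => ‖hat A₃ ((r:ℝ) / M)‖ / A₃.card) (u₄ := fun r => ‖hat A₄ ((r:ℝ) / M)‖ / A₄.card)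
    (δ := 3 / E) (B := B) (t := 2 ^ i)
    (fun r => by positivity) (fun r => by positivity) (fun r => by positivity)
    (fun r => by positivity)
    (fun r => (div_le_one c₂).2 (norm_hat_le _ _)) (fun r => (div_le_one c₄).2 (norm_hat_le _ _))
    (by classical exact filter_subset _ _) (erase_subset_erase _ hR'M)
    (fun r hr => by
      obtain ⟨hr0, hrM, s, c, hs, hsc⟩ := hmemP r hr
      exact (div_le_iff₀ c₁).2 (h₁.norm_hat_le_div hE hℓ hM hr0 hrM hsc hs))
    (fun r hr => by
      obtain ⟨hr0, hrM, s, c, hs, hsc⟩ := hmemP r hr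
      exact (div_le_iff₀ c₃).2 (h₃.norm_hat_le_div hE hℓ hM hr0 hrM hsc hs))
    (by
      have h5 : ((nearHalf E M).card : ℝ) ≤ (800 * E + 1) * 3 := by
        exact_mod_cast card_nearHalf_le E M
      calc ((nearHalf E M).card : ℝ) * (3 / E) ^ 2 ≤ (800 * E + 1) * 3 * (3 / E) ^ 2 := by gcongr
        _ ≤ 3 / 100 := by
            rw [div_pow, mul_div_assoc', div_le_div_iff₀ (by positivity) (by norm_num)]
            nlinarith)
    (fun r hr hrP => by
      rw [div_pow, div_le_iff₀ (by positivity)]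
      exact h₂.norm_hat_sq_le_of_far hEn hℓ hM hm₀ hd h3err
        fun s c hsc => far_of_notMem_nearHalf hr hrP hEM hsc)
    (fun r hr hrP => by
      rw [div_pow, div_le_iff₀ (by positivity)]
      exact h₄.norm_hat_sq_le_of_far hEn hℓ hM hm₀ hd h3err
        fun s c hsc => far_of_notMem_nearHalf hr hrP hEM hsc)
    (second_moment_normalized c₁ h0R (h₁.sum_norm_hat_sq_le hE hℓ hM hm₀ hd hR'M hR'err))
    (second_moment_normalized c₃ h0R (h₃.sum_norm_hat_sq_le hE hℓ hM hm₀ hd hR'M hR'err))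
    (by positivity) hi
    (tail_normalized c₁ (hSR.trans (sdiff_subset_sdiff subset_rfl subset_union_left)) t₁)
    (tail_normalized c₃ (hSR.trans (sdiff_subset_sdiff subset_rfl subset_union_right)) t₃)
    (fourth_moment_normalized c₂ hSM f₂) (fourth_moment_normalized c₄ hSM f₄)
  have hge := card_prod_le_sum_norm_hat hM0 hcon
  have hfac : ∑ r ∈ S, ‖hat A₁ ((r:ℝ) / M)‖ / A₁.card * (‖hat A₂ ((r:ℝ) / M)‖ / A₂.card) *
      (‖hat A₃ ((r:ℝ) / M)‖ / A₃.card) * (‖hat A₄ ((r:ℝ) / M)‖ / A₄.card) =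
      (∑ r ∈ S, ‖hat A₁ ((r:ℝ) / M)‖ * ‖hat A₂ ((r:ℝ) / M)‖ * ‖hat A₃ ((r:ℝ) / M)‖ *
        ‖hat A₄ ((r:ℝ) / M)‖) / (A₁.card * A₂.card * A₃.card * A₄.card) := by
    rw [sum_div]
    refine sum_congr rfl fun r _ => ?_
    rw [div_mul_div_comm, div_mul_div_comm, div_mul_div_comm]
  rw [hfac, div_lt_one (by positivity)] at hlt
  linarith

end

/-! ### Passing from primes to residues -/

section

open Finset Filter

lemma totient_primorial (w : ℕ) : ((primorial w).totient : ℝ) = primorial w * eulerProd w := by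
  have hs : (range (w + 1)).filter Nat.Prime = (Ioc 0 w).filter Nat.Prime := by
    ext p
    simp only [mem_filter, mem_range, mem_Ioc, and_congr_left_iff]
    intro hp
    have := hp.pos
    omega
  have h := Nat.totient_eq_mul_prod_factors (primorial w)
  have hf : (primorial w).primeFactors = (Ioc 0 w).filter Nat.Prime := by
    rw [primorial, hs]
    exact Nat.primeFactors_prod fun p hp => (mem_filter.1 hp).2
  rw [hf] at h
  have h' := congrArg (fun x : ℚ => (x : ℝ)) h
  push_cast at h'
  exact h'

lemma not_dvd_primorial {w p : ℕ} (hp : p.Prime) (hw : w < p) : ¬ p ∣ primorial w := by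
  intro h
  obtain ⟨q, hq, hpq⟩ := (hp.prime.dvd_finsetProd_iff _).1 h
  rw [mem_filter, mem_range] at hq
  have := (Nat.prime_dvd_prime_iff_eq hp hq.2).1 hpq
  omega

/-- An even number is, modulo any `W`, a sum of two reduced residues. -/
lemma exists_coprime_add_modEq {W n : ℕ} (hW : 0 < W) (hn : Even n) :
    ∃ b c : ℕ, b < W ∧ c < W ∧ b.Coprime W ∧ c.Coprime W ∧ b + c ≡ n [MOD W] := by
  classical
  obtain ⟨b, hb⟩ := Nat.chineseRemainderOfFinset
    (fun p : ℕ => if (p:ℤ) ∣ n - 1 then 2 else 1) id W.primeFactors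
    (fun p hp => (Nat.prime_of_mem_primeFactors hp).ne_zero)
    (fun p hp q hq hpq => show p.Coprime q from (Nat.coprime_primes
      (Nat.prime_of_mem_primeFactors hp) (Nat.prime_of_mem_primeFactors hq)).2 hpq)
  have key : ∀ p : ℕ, p.Prime → p ∣ W → ¬ (p:ℤ) ∣ b ∧ ¬ (p:ℤ) ∣ n - b := by
    intro p hp hpW
    have h1 := Nat.modEq_iff_dvd.1 (hb p (Nat.mem_primeFactors.2 ⟨hp, hpW, hW.ne'⟩))
    have hp1 : ¬ (p:ℤ) ∣ 1 := by
      exact_mod_cast fun h => hp.one_lt.ne' (Nat.dvd_one.1 h)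
    simp only [id] at h1
    split_ifs at h1 with h
    · have h2 : ¬ (p:ℤ) ∣ 2 := by
        intro h2
        have h2' : p ∣ 2 := by exact_mod_cast h2
        have := (Nat.prime_dvd_prime_iff_eq hp Nat.prime_two).1 h2'
        subst this
        obtain ⟨r, rfl⟩ := hn
        push_cast at h
        omega
      push_cast at h1
      refine ⟨fun h3 => h2 ?_, fun h3 => hp1 ?_⟩
      · simpa using dvd_add h1 h3
      · have := dvd_sub (dvd_add h h1) h3
        rwa [show (n:ℤ) - 1 + (2 - b) - (n - b) = 1 by ring] at this
    · push_cast at h1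
      refine ⟨fun h3 => hp1 ?_, fun h3 => h ?_⟩
      · simpa using dvd_add h1 h3
      · have := dvd_sub h3 h1
        rwa [show (n:ℤ) - b - (1 - b) = n - 1 by ring] at this
  have hcop : ∀ x : ℕ, (∀ p : ℕ, p.Prime → p ∣ W → ¬ (p:ℤ) ∣ x) → (x % W).Coprime W := by
    intro x hx
    have : x.Coprime W := Nat.Coprime.symm <| Nat.coprime_of_dvd fun p hp hpW hpx =>
      hx p hp hpW (by exact_mod_cast hpx)
    unfold Nat.Coprime at this ⊢
    rwa [← Nat.gcd_rec, Nat.gcd_comm]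
  refine ⟨b % W, (n + (W - 1) * b) % W, Nat.mod_lt _ hW, Nat.mod_lt _ hW,
    hcop b fun p hp hpW => (key p hp hpW).1, hcop _ fun p hp hpW h => (key p hp hpW).2 ?_, ?_⟩
  · push_cast [Nat.cast_sub hW] at h
    have h3 : (p:ℤ) ∣ W * b := dvd_mul_of_dvd_left (by exact_mod_cast hpW) _
    have := dvd_sub h h3
    rwa [show (n:ℤ) + (W - 1) * b - W * b = n - b by ring] at this
  · have h1 : b + (n + (W - 1) * b) = n + W * b := by
      obtain ⟨v, rfl⟩ := Nat.exists_eq_succ_of_ne_zero hW.ne'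
      simp only [Nat.succ_eq_add_one, Nat.add_sub_cancel]; ring
    calc b % W + (n + (W - 1) * b) % W ≡ b + (n + (W - 1) * b) [MOD W] :=
          (Nat.mod_modEq _ _).add (Nat.mod_modEq _ _)
      _ ≡ n [MOD W] := by rw [h1]; simp [Nat.ModEq]

lemma exists_blockSet {w₀ Q W c ℓ N a : ℕ} (hcop : ∀ p : ℕ, p.Prime → w₀ < p → ¬ p ∣ W)
    (hQ : Q < c) (hcount : ∀ j < N, ∀ d < 2, a ≤ ((range (N * ℓ)).filter fun x =>
      (x / ℓ = j ∧ x % 2 = d) ∧ (W * x + c).Prime).card) :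
    ∃ A : Finset ℕ, BlockSet w₀ Q W c ℓ N a A ∧ ∀ x ∈ A, (W * x + c).Prime := by
  choose! B hB hBa using fun j hj d hd => exists_subset_card_eq (hcount j hj d hd)
  have hmem : ∀ x, x ∈ (range N ×ˢ range 2).biUnion (fun jd => B jd.1 jd.2) ↔
      ∃ j < N, ∃ d < 2, x ∈ B j d := by
    intro x; simp
  have hBm : ∀ j < N, ∀ d < 2, ∀ x ∈ B j d,
      x < N * ℓ ∧ (x / ℓ = j ∧ x % 2 = d) ∧ (W * x + c).Prime := by
    intro j hj d hd x hx
    simpa using hB j hj d hd hx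
  have hprime : ∀ x ∈ (range N ×ˢ range 2).biUnion (fun jd => B jd.1 jd.2),
      (W * x + c).Prime := by
    intro x hx
    obtain ⟨j, hj, d, hd, hx⟩ := (hmem x).1 hx
    exact (hBm j hj d hd x hx).2.2
  refine ⟨_, ⟨fun x hx => ?_, fun j hj d hd => ?_, hcop, fun x hx p hp hpx => ?_⟩, hprime⟩
  · obtain ⟨j, hj, d, hd, hx⟩ := (hmem x).1 hx
    exact mem_range.2 (hBm j hj d hd x hx).1
  · rw [← hBa j hj d hd]
    congr 1
    ext x
    rw [mem_filter, hmem]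
    constructor
    · rintro ⟨⟨j', hj', d', hd', hx⟩, h1, h2⟩
      have h3 := (hBm j' hj' d' hd' x hx).2.1
      rwa [← h1, ← h2, h3.1, h3.2]
    · exact fun hx => ⟨⟨j, hj, d, hd, hx⟩, (hBm j hj d hd x hx).2.1⟩
  · have h1 := (Nat.prime_dvd_prime_iff_eq (prime_of_mem_sievePrimes hp) (hprime x hx)).1 hpx
    have h2 : p ≤ Q := (mem_Ioc.1 (mem_filter.1 hp).1).2
    have : c ≤ W * x + c := Nat.le_add_left _ _
    omega

/-- The primes of a block, seen as primes in a residue class modulo `2 * W`. -/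
lemma card_primes_le_card_block {W c ℓ N j d u : ℕ} (hW : 0 < W) (hj : j < N) (hd : d < 2)
    (hu : u + 1 = W * (j * ℓ) + c) :
    ((Ioc u (u + W * ℓ)).filter fun p : ℕ =>
      p.Prime ∧ (p : ZMod (2 * W)) = ((W * d + c : ℕ) : ZMod (2 * W))).card ≤
    ((range (N * ℓ)).filter fun x => (x / ℓ = j ∧ x % 2 = d) ∧ (W * x + c).Prime).card := by
  classical
  refine (card_le_card ?_).trans (card_image_le (f := fun x => W * x + c))
  intro p hp
  simp only [mem_filter, mem_Ioc, ZMod.natCast_eq_natCast_iff] at hp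
  obtain ⟨⟨hp1, hp2⟩, hp, hmod⟩ := hp
  have hcp : c ≤ p := by omega
  obtain ⟨r, hr⟩ := Nat.exists_eq_add_of_le hcp
  have h1 : r ≡ W * d [MOD 2 * W] := by
    rw [hr, add_comm (W * d)] at hmod
    exact Nat.ModEq.add_left_cancel' c hmod
  have hWr : W ∣ r :=
    (Nat.modEq_zero_iff_dvd).1 ((h1.of_dvd (dvd_mul_left W 2)).trans
      (by rw [Nat.modEq_zero_iff_dvd]; exact dvd_mul_right _ _))
  obtain ⟨x, rfl⟩ := hWr
  rw [mul_comm 2 W] at h1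
  have h2 : x ≡ d [MOD 2] := Nat.ModEq.mul_left_cancel' hW.ne' h1
  have hxl : j * ℓ ≤ x := Nat.le_of_mul_le_mul_left (by omega : W * (j * ℓ) ≤ W * x) hW
  have hxu : x < (j + 1) * ℓ := by
    refine lt_of_mul_lt_mul_left (a := W) ?_ hW.le
    rw [add_one_mul, mul_add]; omega
  have hℓ : 0 < ℓ := by
    by_contra h
    have : ℓ = 0 := by omega
    subst this; simp at hxu
  rw [mem_image]
  refine ⟨x, ?_, by omega⟩
  rw [mem_filter, mem_range]
  refine ⟨hxu.trans_le (Nat.mul_le_mul_right _ hj), ⟨?_, ?_⟩, by rwa [add_comm, ← hr]⟩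
  · exact Nat.div_eq_of_lt_le hxl hxu
  · rw [h2, Nat.mod_eq_of_lt hd]

lemma exists_forall_card_primes_residueClass (q : ℕ) [NeZero q] {κ ε : ℝ} (hκ : 0 < κ)
    (hε : 0 < ε) : ∃ U : ℕ, ∀ a : ZMod q, IsUnit a → ∀ u h : ℕ, U ≤ u → κ * u ≤ h → h ≤ u →
      h / q.totient * (1 - h / u - ε) ≤
        ((Ioc u (u + h)).filter fun p : ℕ => p.Prime ∧ (p : ZMod q) = a).card *
          Real.log (u + h : ℕ) := by
  choose! U hU using fun (a : ZMod q) (ha : IsUnit a) =>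
    card_primes_residueClass_lower_bound ha hκ hε
  exact ⟨univ.sup U, fun a ha u h hu => hU a ha u h ((le_sup (mem_univ a)).trans hu)⟩

end

section

open Finset Filter

lemma le_log_level {M : ℕ} (hM : 1 ≤ M) :
    9 / 20 * Real.log M - Real.log 2 ≤ Real.log (level M) := by
  have hM0 : (0:ℝ) < M := by exact_mod_cast hM
  have h1 : (1:ℝ) ≤ level M := by exact_mod_cast one_le_level hM
  have h2 : (M:ℝ) ^ (9/20 : ℝ) ≤ 2 * level M := by
    have : (M:ℝ) ^ (9/20 : ℝ) < level M + 1 := Nat.lt_floor_add_one _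
    linarith
  have h3 := Real.log_le_log (by positivity) h2
  rw [Real.log_rpow hM0, Real.log_mul (by norm_num) (by positivity)] at h3
  linarith

lemma eventually_log_le_log_level {η : ℝ} (hη : 0 < η) :
    ∀ᶠ k : ℕ in atTop, ∀ M : ℕ, η * k ≤ M →
      Real.log k ≤ 9 / 4 * (998 / 1000) * Real.log (level M) := by
  filter_upwards [(Real.tendsto_log_atTop.comp tendsto_natCast_atTop_atTop).eventually_ge_atTop
    (300 * |Real.log 2 - 9 / 20 * Real.log η|), eventually_ge_atTop 1] with k hk hk1 M hM
  simp only [Function.comp_apply] at hk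
  have hk0 : (0:ℝ) < k := by exact_mod_cast hk1
  have hM0 : (0:ℝ) < M := lt_of_lt_of_le (by positivity) hM
  have h1 := le_log_level (M := M) (by exact_mod_cast hM0)
  have h2 := Real.log_le_log (by positivity) hM
  rw [Real.log_mul hη.ne' hk0.ne'] at h2
  have h3 := le_abs_self (Real.log 2 - 9 / 20 * Real.log η)
  have h4 := abs_nonneg (Real.log 2 - 9 / 20 * Real.log η)
  linarith

lemma two_dvd_primorial {w : ℕ} (hw : 2 ≤ w) : 2 ∣ primorial w :=
  dvd_prod_of_mem _ (mem_filter.2 ⟨mem_range.2 (by omega), Nat.prime_two⟩)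

/-- Blocks of length `ℓ ≍ η k` contain enough primes in every reduced residue class. -/
lemma eventually_exists_blockSet {w₀ : ℕ} (hw₀ : 2 ≤ w₀) {η : ℝ} (hη : 0 < η)
    (hηW : primorial w₀ * η ≤ 1 / 8000) :
    ∀ᶠ k : ℕ in atTop, ∀ ℓ : ℕ, η / 2 * k ≤ ℓ → ℓ ≤ η * k → ∃ a : ℕ,
      (∀ M : ℕ, ℓ ≤ M → (ℓ:ℝ) ≤ 9 / 4 * (Real.log (level M) * eulerProd w₀) * (2 * a)) ∧
      ∀ c N Q : ℕ, c.Coprime (primorial w₀) → (k:ℝ) / 8 + 1 ≤ c →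
        primorial w₀ * (N * ℓ) + c ≤ k → Q < c →
        ∃ A : Finset ℕ, BlockSet w₀ Q (primorial w₀) c ℓ N a A ∧
          ∀ x ∈ A, (primorial w₀ * x + c).Prime := by
  set W := primorial w₀ with hWdef
  have hW : 0 < W := primorial_pos _
  have h2W : 2 ∣ W := two_dvd_primorial hw₀
  have hV := eulerProd_pos w₀
  have : NeZero (2 * W) := ⟨by omega⟩
  have hWr : (1:ℝ) ≤ W := by exact_mod_cast hW
  have htot : ((2 * W).totient : ℝ) = 2 * (W * eulerProd w₀) := by
    rw [Nat.totient_mul_of_prime_of_dvd Nat.prime_two h2W, Nat.cast_mul, hWdef,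
      totient_primorial, Nat.cast_two]
  obtain ⟨U, hU⟩ := exists_forall_card_primes_residueClass (2 * W) (half_pos hη)
    (by norm_num : (0:ℝ) < 1 / 1000)
  filter_upwards [eventually_log_le_log_level (half_pos hη), eventually_ge_atTop (8 * U),
    eventually_ge_atTop 3] with k hlog hkU hk3 ℓ hℓ1 hℓ2
  have hk0 : (0:ℝ) < k := by positivity
  have hL : 0 < Real.log k := Real.log_pos (by exact_mod_cast (by omega : 1 < k))
  refine ⟨⌈ℓ / (2 * eulerProd w₀) * (998 / 1000) / Real.log k⌉₊, fun M hM => ?_,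
    fun c N Q hc hkc hck hQ => exists_blockSet (fun p => not_dvd_primorial) hQ
      fun j hj d hd => Nat.ceil_le.2 ?_⟩
  · have h1 := hlog M (hℓ1.trans (by exact_mod_cast hM))
    have h2 := Nat.le_ceil (ℓ / (2 * eulerProd w₀) * (998 / 1000) / Real.log k)
    have h3 : 0 ≤ Real.log (level M) := Real.log_natCast_nonneg _
    calc (ℓ:ℝ) = Real.log k * (ℓ / Real.log k) := by field_simp
      _ ≤ 9 / 4 * (998 / 1000) * Real.log (level M) * (ℓ / Real.log k) := by gcongr
      _ = 9 / 4 * (Real.log (level M) * eulerProd w₀) *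
          (2 * (ℓ / (2 * eulerProd w₀) * (998 / 1000) / Real.log k)) := by field_simp
      _ ≤ _ := by gcongr
  · have hc1 : 1 ≤ c := by omega
    obtain ⟨u, hu⟩ : ∃ u, u + 1 = W * (j * ℓ) + c := ⟨W * (j * ℓ) + c - 1, by omega⟩
    refine le_trans ?_ (Nat.cast_le.2 (card_primes_le_card_block hW hj hd hu))
    have hunit : IsUnit ((W * d + c : ℕ) : ZMod (2 * W)) := by
      rw [ZMod.isUnit_iff_coprime]
      have h1 : (W * d + c).Coprime W := by
        rwa [Nat.coprime_mul_left_add_left]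
      exact Nat.Coprime.mul_right (h1.coprime_dvd_right h2W) h1
    have huk : u + W * ℓ ≤ k := by
      have : W * (j * ℓ) + W * ℓ ≤ W * (N * ℓ) := by
        rw [← mul_add, ← add_one_mul]
        exact Nat.mul_le_mul_left _ (Nat.mul_le_mul_right _ hj)
      omega
    have hu8 : (k:ℝ) / 8 ≤ u := by
      have : (c:ℝ) ≤ u + 1 := by exact_mod_cast (by omega : c ≤ u + 1)
      linarith
    have huk' : (u:ℝ) ≤ k := by exact_mod_cast (by omega : u ≤ k)
    have hh : ((W * ℓ : ℕ) : ℝ) ≤ k / 8000 := by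
      push_cast
      calc (W:ℝ) * ℓ ≤ W * (η * k) := by gcongr
        _ = W * η * k := by ring
        _ ≤ 1 / 8000 * k := by gcongr
        _ = _ := by ring
    have hu0 : (0:ℝ) < u := by linarith [div_pos hk0 (by norm_num : (0:ℝ) < 8)]
    have key := hU _ hunit u (W * ℓ) (by
        have : (U:ℝ) ≤ u := by
          have : (8 * U : ℝ) ≤ k := by exact_mod_cast hkU
          linarith
        exact_mod_cast this)
      (by
        push_cast
        calc η / 2 * (u:ℝ) ≤ η / 2 * k := by gcongr
          _ ≤ 1 * ℓ := by linarith
          _ ≤ W * ℓ := by gcongr)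
      (by
        have : ((W * ℓ : ℕ) : ℝ) ≤ u := by linarith
        exact_mod_cast this)
    have hfrac : ((W * ℓ : ℕ) : ℝ) / u ≤ 1 / 1000 := by
      rw [div_le_iff₀ hu0]; linarith
    have hlogle : Real.log (u + W * ℓ : ℕ) ≤ Real.log k :=
      Real.log_le_log (by push_cast; positivity) (by exact_mod_cast huk)
    rw [div_le_iff₀ hL]
    calc ℓ / (2 * eulerProd w₀) * (998 / 1000)
        = ((W * ℓ : ℕ) : ℝ) / (2 * W).totient * (998 / 1000) := by
          rw [htot]; push_cast; field_simp
      _ ≤ ((W * ℓ : ℕ) : ℝ) / (2 * W).totient * (1 - ((W * ℓ : ℕ) : ℝ) / u - 1 / 1000) := by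
          gcongr; linarith
      _ ≤ _ := key
      _ ≤ _ := by gcongr

end

section

open Finset Filter

lemma eq_of_modEq_sub_one {M s : ℕ} (hM : 1 ≤ M) (hs : s + 1 < 2 * M)
    (h : s ≡ M - 1 [MOD M]) : s = M - 1 := by
  rcases lt_or_ge s M with h1 | h1
  · rwa [Nat.ModEq, Nat.mod_eq_of_lt h1, Nat.mod_eq_of_lt (by omega)] at h
  · rw [Nat.ModEq, Nat.mod_eq_sub_mod h1, Nat.mod_eq_of_lt (by omega),
      Nat.mod_eq_of_lt (by omega)] at h
    omega

lemma abs_progression_sub_le {W x s b m M S k B : ℕ} {δ : ℝ} (hx : x ≤ M) (hb : b < W)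
    (hm : W * m + B = k) (hB : B ≤ 4 * W) (hS : S + M = m + 1) (hs₁ : S ≤ 4 * s + 4)
    (hs₂ : 4 * s ≤ S + 12) (hWM : (W:ℝ) * M ≤ δ / 2 * k) (hW : 10 * (W:ℝ) ≤ δ * k) :
    |((W * x + (W * s + b) : ℕ) : ℝ) - k / 4| ≤ δ * k := by
  have hx' : (W:ℝ) * x ≤ W * M := by gcongr
  have hb' : (b:ℝ) ≤ W := by exact_mod_cast hb.le
  have hm' : (W:ℝ) * m + B = k := by exact_mod_cast hm
  have hB' : (B:ℝ) ≤ 4 * W := by exact_mod_cast hB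
  have hS' : (W:ℝ) * S + W * M = W * m + W := by
    rw [← mul_add, ← mul_add_one]; congr 1; exact_mod_cast hS
  have h₁ : (W:ℝ) * S ≤ 4 * (W * s) + 4 * W := by
    exact_mod_cast (by nlinarith : W * S ≤ 4 * (W * s) + 4 * W)
  have h₂ : 4 * ((W:ℝ) * s) ≤ W * S + 12 * W := by
    exact_mod_cast (by nlinarith : 4 * (W * s) ≤ W * S + 12 * W)
  have h0 : (0:ℝ) ≤ W * x := by positivity
  have h0b : (0:ℝ) ≤ b := by positivity
  have h0B : (0:ℝ) ≤ B := by positivity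
  have h0W : (0:ℝ) ≤ W := by positivity
  have h0M : (0:ℝ) ≤ W * M := by positivity
  push_cast
  rw [abs_le]
  constructor <;> linarith

lemma eventually_exists_four_primes {ε : ℝ} (hε : 0 < ε) (hε' : ε ≤ 1 / 16) :
    ∀ᶠ k : ℕ in atTop, Even k →
      ∃ p₁ p₂ p₃ p₄ : ℕ, p₁.Prime ∧ p₂.Prime ∧ p₃.Prime ∧ p₄.Prime ∧
        k = p₁ + p₂ + p₃ + p₄ ∧
        |(p₁ : ℝ) - (k : ℝ) / 4| ≤ ε * k ∧ |(p₂ : ℝ) - (k : ℝ) / 4| ≤ ε * k ∧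
        |(p₃ : ℝ) - (k : ℝ) / 4| ≤ ε * k ∧ |(p₄ : ℝ) - (k : ℝ) / 4| ≤ ε * k := by
  obtain ⟨E, hE⟩ : ∃ E : ℕ, 10 ^ 6 ≤ E := ⟨_, le_rfl⟩
  obtain ⟨m₀, hm₀, hev⟩ := exists_sum_modEq hE
  set W := primorial (6 * m₀) with hWdef
  have hw₀ : 2 ≤ 6 * m₀ := le_trans (by norm_num) hm₀
  have hW0 : 0 < W := primorial_pos _
  have hW2 : 2 ≤ W := Nat.le_of_dvd hW0 (two_dvd_primorial hw₀)
  obtain ⟨D, hD⟩ : ∃ D, D = E * (4001 * E) := ⟨_, rfl⟩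
  have hD1 : 1000 ≤ D := by rw [hD]; nlinarith
  have hWr : (0:ℝ) < W := by exact_mod_cast hW0
  have hDr : (1000:ℝ) ≤ D := by exact_mod_cast hD1
  have hη : 0 < ε / (2 * W * D) := by positivity
  have hηW : (W:ℝ) * (ε / (2 * W * D)) ≤ 1 / 8000 := by
    rw [show (W:ℝ) * (ε / (2 * W * D)) = ε / (2 * D) by field_simp,
      div_le_div_iff₀ (by positivity) (by norm_num)]
    linarith
  have hlin : ∀ c : ℝ, 0 < c → Tendsto (fun k : ℕ => c * (k:ℝ)) atTop atTop := fun c hc =>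
    tendsto_natCast_atTop_atTop.const_mul_atTop hc
  filter_upwards [eventually_exists_blockSet hw₀ hη hηW,
    (tendsto_nat_floor_atTop.comp (hlin _ hη)).eventually hev,
    (hlin _ hη).eventually_ge_atTop 2, (hlin _ hε).eventually_ge_atTop (10 * (W:ℝ)),
    eventually_ge_atTop (max 32 (4 * W))] with k hblock hsum hk2 hkW hk hkeven
  rw [max_le_iff] at hk
  set ℓ := ⌊ε / (2 * W * D) * (k:ℝ)⌋₊ with hℓ
  have hℓu : (ℓ:ℝ) ≤ ε / (2 * W * D) * k := Nat.floor_le (by positivity)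
  have hℓl : ε / (2 * W * D) / 2 * k ≤ ℓ := by
    have := Nat.lt_floor_add_one (ε / (2 * W * D) * (k:ℝ))
    linarith
  have hℓ1 : 1 ≤ ℓ := Nat.le_floor (by push_cast; linarith)
  obtain ⟨a, hdense, hset⟩ := hblock ℓ hℓl hℓu
  obtain ⟨M, hM⟩ : ∃ M, M = D * ℓ := ⟨_, rfl⟩
  have hℓM : ℓ ≤ M := by rw [hM]; exact Nat.le_mul_of_pos_left _ (by omega)
  have hM1 : 1 ≤ M := hℓ1.trans hℓM
  have hk32 : (32:ℝ) ≤ k := by exact_mod_cast hk.1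
  have hεk : ε * k ≤ k / 16 := by nlinarith
  have hWM : (W:ℝ) * M ≤ ε / 2 * k := by
    calc (W:ℝ) * M = W * D * ℓ := by rw [hM]; push_cast; ring
      _ ≤ W * D * (ε / (2 * W * D) * k) := by gcongr
      _ = ε / 2 * k := by field_simp
  obtain ⟨b₁, b₂, hb₁, hb₂, hc₁, hc₂, hb⟩ := exists_coprime_add_modEq (n := k - 2) hW0
    (hkeven.tsub even_two)
  obtain ⟨m, hm⟩ : W ∣ k - (b₁ + b₂ + 2) := by
    refine (Nat.modEq_iff_dvd' (by omega)).1 ?_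
    have := hb.add_right 2
    rwa [Nat.sub_add_cancel (by omega)] at this
  have hmk : W * m + (b₁ + b₂ + 2) = k := by omega
  have hMm : M ≤ m := by
    have h1 : (W:ℝ) * m + (b₁ + b₂ + 2 : ℕ) = k := by exact_mod_cast hmk
    have h2 : ((b₁ + b₂ + 2 : ℕ) : ℝ) ≤ 4 * W := by
      exact_mod_cast (by omega : b₁ + b₂ + 2 ≤ 4 * W)
    have h3 : (W:ℝ) * M ≤ W * m := by linarith
    exact_mod_cast le_of_mul_le_mul_left h3 hWr
  obtain ⟨S, hS⟩ : ∃ S, S + M = m + 1 := ⟨m + 1 - M, by omega⟩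
  have hprog : ∀ x s b : ℕ, x ≤ M → b < W → S ≤ 4 * s + 4 → 4 * s ≤ S + 12 →
      |((W * x + (W * s + b) : ℕ) : ℝ) - k / 4| ≤ ε * k := fun x s b hx hbW hs₁ hs₂ =>
    abs_progression_sub_le hx hbW hmk (by omega) hS hs₁ hs₂ hWM hkW
  have hexists : ∀ s b N : ℕ, N ≤ D → b < W → b.Coprime W → S ≤ 4 * s + 4 → 4 * s ≤ S + 12 →
      ∃ A : Finset ℕ, BlockSet (6 * m₀) (level M) W (W * s + b) ℓ N a A ∧
        ∀ x ∈ A, (W * x + (W * s + b)).Prime := by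
    intro s b N hN hbW hbc hs₁ hs₂
    have h0 := abs_le.1 (hprog 0 s b (Nat.zero_le _) hbW hs₁ hs₂)
    have h1 := abs_le.1 (hprog M s b le_rfl hbW hs₁ hs₂)
    rw [mul_zero, zero_add] at h0
    refine hset _ N _ ?_ ?_ ?_ ?_
    · rwa [Nat.coprime_mul_left_add_left]
    · linarith [h0.1]
    · have h2 : W * (N * ℓ) ≤ W * M := by
        rw [hM]; exact Nat.mul_le_mul_left _ (Nat.mul_le_mul_right _ hN)
      have h3 : ((W * M + (W * s + b) : ℕ) : ℝ) ≤ k := by linarith [h1.2]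
      have h4 : W * M + (W * s + b) ≤ k := by exact_mod_cast h3
      exact (Nat.add_le_add_right h2 _).trans h4
    · have h2 : (M:ℝ) ≤ W * M := by
        exact_mod_cast Nat.le_mul_of_pos_left M hW0
      have h3 : (M:ℝ) < (W * s + b : ℕ) := by linarith [h0.1]
      exact (level_le hM1).trans_lt (by exact_mod_cast h3)
  have hN₂ : 4001 * E ≤ D := by rw [hD]; exact Nat.le_mul_of_pos_left _ (by omega)
  have hN₁ : (E - 2) * (4001 * E) ≤ D := by
    rw [hD]; exact Nat.mul_le_mul_right _ (Nat.sub_le _ _)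
  have hs : S ≤ 4 * (S / 4) + 4 ∧ 4 * (S / 4) ≤ S + 12 := by omega
  have hs' : S ≤ 4 * (S - 3 * (S / 4)) + 4 ∧ 4 * (S - 3 * (S / 4)) ≤ S + 12 := by omega
  obtain ⟨A₁, hA₁, hp₁⟩ := hexists (S / 4) b₁ _ hN₁ hb₁ hc₁ hs.1 hs.2
  obtain ⟨A₂, hA₂, hp₂⟩ := hexists (S / 4) b₂ _ hN₂ hb₂ hc₂ hs.1 hs.2
  obtain ⟨A₃, hA₃, hp₃⟩ := hexists (S / 4) 1 _ hN₁ (by omega) (Nat.coprime_one_left _) hs.1 hs.2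
  obtain ⟨A₄, hA₄, hp₄⟩ := hexists (S - 3 * (S / 4)) 1 _ hN₂ (by omega) (Nat.coprime_one_left _)
    hs'.1 hs'.2
  obtain ⟨x₁, hx₁, x₂, hx₂, x₃, hx₃, x₄, hx₄, hx⟩ := hsum M (hD ▸ hM) W a _ _ _ _
    A₁ A₂ A₃ A₄ hA₁ hA₂ hA₃ hA₄ (hdense M hℓM) (M - 1)
  have hlt₁ := mem_range.1 (hA₁.subset hx₁)
  have hlt₂ := mem_range.1 (hA₂.subset hx₂)
  have hlt₃ := mem_range.1 (hA₃.subset hx₃)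
  have hlt₄ := mem_range.1 (hA₄.subset hx₄)
  have hle : ∀ {x N : ℕ}, N ≤ D → x < N * ℓ → x ≤ M := fun hN hxN => by
    rw [hM]; exact hxN.le.trans (Nat.mul_le_mul_right _ hN)
  have hx : x₁ + x₂ + x₃ + x₄ = M - 1 := by
    refine eq_of_modEq_sub_one hM1 ?_ hx
    have h1 : 2 * M = 2 * ((E - 2) * (4001 * E) * ℓ) + 4 * (4001 * E * ℓ) := by
      obtain ⟨F, rfl⟩ : ∃ F, E = F + 2 := ⟨E - 2, by omega⟩
      rw [hM, hD, Nat.add_sub_cancel]; ring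
    omega
  refine ⟨_, _, _, _, hp₁ x₁ hx₁, hp₂ x₂ hx₂, hp₃ x₃ hx₃, hp₄ x₄ hx₄, ?_,
    hprog _ _ _ (hle hN₁ hlt₁) hb₁ hs.1 hs.2, hprog _ _ _ (hle hN₂ hlt₂) hb₂ hs.1 hs.2,
    hprog _ _ _ (hle hN₁ hlt₃) (by omega) hs.1 hs.2,
    hprog _ _ _ (hle hN₂ hlt₄) (by omega) hs'.1 hs'.2⟩
  have h1 : m = (x₁ + x₂ + x₃ + x₄) + (S / 4 + S / 4 + S / 4 + (S - 3 * (S / 4))) := by omega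
  rw [← hmk, h1]
  ring

end

end FourPrimes

/-- Every sufficiently large even integer is a sum of four roughly equal primes:
for every `ε > 0` there is `N` such that every even `k ≥ N` can be written as
`k = p₁ + p₂ + p₃ + p₄` with each `pᵢ` prime and `|pᵢ - k/4| ≤ ε k`. -/
theorem even_sum_four_roughly_equal_primes (ε : ℝ) (hε : 0 < ε) :
    ∃ N : ℕ, ∀ k : ℕ, N ≤ k → Even k →
      ∃ p₁ p₂ p₃ p₄ : ℕ, p₁.Prime ∧ p₂.Prime ∧ p₃.Prime ∧ p₄.Prime ∧
        k = p₁ + p₂ + p₃ + p₄ ∧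
        |(p₁ : ℝ) - (k : ℝ) / 4| ≤ ε * k ∧ |(p₂ : ℝ) - (k : ℝ) / 4| ≤ ε * k ∧
        |(p₃ : ℝ) - (k : ℝ) / 4| ≤ ε * k ∧ |(p₄ : ℝ) - (k : ℝ) / 4| ≤ ε * k := by
  obtain ⟨N, hN⟩ := Filter.eventually_atTop.1 (FourPrimes.eventually_exists_four_primes
    (lt_min hε (by norm_num : (0:ℝ) < 1 / 16)) (min_le_right _ _))
  refine ⟨N, fun k hk hkeven => ?_⟩
  obtain ⟨p₁, p₂, p₃, p₄, h₁, h₂, h₃, h₄, hsum, e₁, e₂, e₃, e₄⟩ := hN k hk hkeven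
  have hle : min ε (1 / 16) * k ≤ ε * k :=
    mul_le_mul_of_nonneg_right (min_le_left _ _) k.cast_nonneg
  exact ⟨p₁, p₂, p₃, p₄, h₁, h₂, h₃, h₄, hsum, e₁.trans hle, e₂.trans hle, e₃.trans hle,
    e₄.trans hle⟩
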